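/- arXiv:1204.5755 — 2 statements merged into one kernel-verified Lean document; each statement's English description precedes it below -/
import Mathlib

section
/- A recurrent infinite binary word w is Sturmian if and only if every factor of w has exactly two or three semi-abelian returns in w. -/
/-- The factor of length `n` of the infinite word `w` starting at position `i`. -/
def wordAt {α : Type*} (w : ℕ → α) (i n : ℕ) : List α :=
  (List.range n).map (fun k => w (i + k))

/-- `u` is a factor of the infinite word `w`. -/
def IsFactorW {α : Type*} (w : ℕ → α) (u : List α) : Prop :=
  ∃ i, u = wordAt w i u.length

/-- `w` is recurrent: every factor occurs infinitely often. -/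
def RecurrentW {α : Type*} (w : ℕ → α) : Prop :=
  ∀ u, IsFactorW w u → ∀ N, ∃ i, N ≤ i ∧ u = wordAt w i u.length

/-- `w` is (purely) periodic. -/
def PeriodicW {α : Type*} (w : ℕ → α) : Prop :=
  ∃ T, 0 < T ∧ ∀ n, w (n + T) = w n

/-- `w` is ultimately periodic. -/
def UltPeriodicW {α : Type*} (w : ℕ → α) : Prop :=
  ∃ T, 0 < T ∧ ∃ n₀, ∀ n, n₀ ≤ n → w (n + T) = w n

/-- Two finite words are abelian equivalent: same number of occurrences of each letter. -/
def AbEquiv {α : Type*} [DecidableEq α] (u v : List α) : Prop :=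
  ∀ a : α, u.count a = v.count a

/-- Positions of occurrences of words abelian equivalent to `u` in `w`. -/
def abOcc {α : Type*} [DecidableEq α] (w : ℕ → α) (u : List α) : Set ℕ :=
  {i | AbEquiv (wordAt w i u.length) u}

/-- The semi-abelian returns to (the abelian class of) `u` in `w`: words extending from one
occurrence of the abelian class of `u` to the next one. -/
def semiAbReturns {α : Type*} [DecidableEq α] (w : ℕ → α) (u : List α) : Set (List α) :=
  {r | ∃ i j, i ∈ abOcc w u ∧ j ∈ abOcc w u ∧ i < j ∧
      (∀ k, i < k → k < j → k ∉ abOcc w u) ∧ r = wordAt w i (j - i)}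

/-- Positions of (exact) occurrences of `u` in `w`. -/
def occW {α : Type*} [DecidableEq α] (w : ℕ → α) (u : List α) : Set ℕ :=
  {i | u = wordAt w i u.length}

/-- The ordinary return words of `u` in `w`. -/
def returnWords {α : Type*} [DecidableEq α] (w : ℕ → α) (u : List α) : Set (List α) :=
  {r | ∃ i j, i ∈ occW w u ∧ j ∈ occW w u ∧ i < j ∧
      (∀ k, i < k → k < j → k ∉ occW w u) ∧ r = wordAt w i (j - i)}

/-- `u` has exactly `k` semi-abelian returns in `w`. -/
def ExactlyKSemiAbReturns {α : Type*} [DecidableEq α] (w : ℕ → α) (u : List α) (k : ℕ) : Prop :=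
  ∃ f : Fin k → List α, Function.Injective f ∧ semiAbReturns w u = Set.range f

/-- `u` has exactly `k` abelian returns in `w`: there are `k` pairwise non-abelian-equivalent
representatives so that every semi-abelian return is abelian equivalent to exactly one of them,
and each representative is realized. -/
def ExactlyKAbReturns {α : Type*} [DecidableEq α] (w : ℕ → α) (u : List α) (k : ℕ) : Prop :=
  ∃ f : Fin k → List α,
    (∀ i j, AbEquiv (f i) (f j) → i = j) ∧
    (∀ r ∈ semiAbReturns w u, ∃ i, AbEquiv r (f i)) ∧
    (∀ i, ∃ r ∈ semiAbReturns w u, AbEquiv r (f i))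

/-- `u` has at most `k` abelian returns in `w`. -/
def AtMostKAbReturns {α : Type*} [DecidableEq α] (w : ℕ → α) (u : List α) (k : ℕ) : Prop :=
  ∃ f : Fin k → List α, ∀ r ∈ semiAbReturns w u, ∃ i, AbEquiv r (f i)

/-- `u` has at least `k` abelian returns in `w`. -/
def AtLeastKAbReturns {α : Type*} [DecidableEq α] (w : ℕ → α) (u : List α) (k : ℕ) : Prop :=
  ∃ f : Fin k → List α,
    (∀ i j, AbEquiv (f i) (f j) → i = j) ∧
    (∀ i, ∃ r ∈ semiAbReturns w u, AbEquiv r (f i))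

/-- `u` has at least two semi-abelian returns in `w`. -/
def AtLeastTwoSemiAbReturns {α : Type*} [DecidableEq α] (w : ℕ → α) (u : List α) : Prop :=
  ∃ r₁ r₂, r₁ ∈ semiAbReturns w u ∧ r₂ ∈ semiAbReturns w u ∧ r₁ ≠ r₂

/-- The factor complexity of `w`. -/
noncomputable def complexityW {α : Type*} (w : ℕ → α) (n : ℕ) : ℕ :=
  {u : List α | u.length = n ∧ IsFactorW w u}.ncard

/-- A Sturmian word: aperiodic binary word with factor complexity `n + 1`. -/
def SturmianW (w : ℕ → Bool) : Prop :=
  ¬ UltPeriodicW w ∧ ∀ n, complexityW w n = n + 1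

/-- Right special factor of a binary word. -/
def RightSpecial (w : ℕ → Bool) (B : List Bool) : Prop :=
  IsFactorW w (B ++ [false]) ∧ IsFactorW w (B ++ [true])

/-- Left special factor of a binary word. -/
def LeftSpecial (w : ℕ → Bool) (B : List Bool) : Prop :=
  IsFactorW w (false :: B) ∧ IsFactorW w (true :: B)

/-- Bispecial factor of a binary word. -/
def Bispecial (w : ℕ → Bool) (B : List Bool) : Prop :=
  RightSpecial w B ∧ LeftSpecial w B

/-- `w` is `c`-balanced. -/
def CBalanced {α : Type*} [DecidableEq α] (w : ℕ → α) (c : ℕ) : Prop :=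
  ∀ u v : List α, IsFactorW w u → IsFactorW w v → u.length = v.length →
    ∀ a : α, |((u.count a : ℤ) - (v.count a : ℤ))| ≤ (c : ℤ)

namespace SemiAb

/-- The number of letters `true` among the first `n` letters of `w`. -/
def ones (w : ℕ → Bool) : ℕ → ℕ
  | 0 => 0
  | n + 1 => ones w n + (w n).toNat

/-- The window of length `n` at `i` contains exactly `c` letters `true`. -/
def InCl (w : ℕ → Bool) (n c i : ℕ) : Prop := ones w (i + n) = ones w i + c

/-- `i` and `i + m` are consecutive positions of the abelian class `(n, c)`. -/
def Ret (w : ℕ → Bool) (n c i m : ℕ) : Prop :=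
  0 < m ∧ InCl w n c i ∧ InCl w n c (i + m) ∧ ∀ k, 0 < k → k < m → ¬ InCl w n c (i + k)

/-- The factors of length `m` at `i` and of length `m'` at `j` are different. -/
def Diff (w : ℕ → Bool) (i m j m' : ℕ) : Prop :=
  m ≠ m' ∨ ∃ k, k < m ∧ k < m' ∧ w (i + k) ≠ w (j + k)

/-- Every factor reoccurs arbitrarily late. -/
def Rec (w : ℕ → Bool) : Prop := ∀ i n N, ∃ j, N ≤ j ∧ ∀ k < n, w (j + k) = w (i + k)

/-- No abelian class has four distinct returns. -/
def AtMostThree (w : ℕ → Bool) : Prop :=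
  ∀ n c, 0 < n → ∀ i₁ m₁ i₂ m₂ i₃ m₃ i₄ m₄,
    Ret w n c i₁ m₁ → Ret w n c i₂ m₂ → Ret w n c i₃ m₃ → Ret w n c i₄ m₄ →
    Diff w i₁ m₁ i₂ m₂ → Diff w i₁ m₁ i₃ m₃ → Diff w i₁ m₁ i₄ m₄ →
    Diff w i₂ m₂ i₃ m₃ → Diff w i₂ m₂ i₄ m₄ → Diff w i₃ m₃ i₄ m₄ → False

/-- Every abelian class has two distinct returns. -/
def AtLeastTwo (w : ℕ → Bool) : Prop :=
  ∀ n c i, 0 < n → InCl w n c i → ∃ i₁ m₁ i₂ m₂,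
    Ret w n c i₁ m₁ ∧ Ret w n c i₂ m₂ ∧ Diff w i₁ m₁ i₂ m₂

/-- `w` is balanced. -/
def Bal (w : ℕ → Bool) : Prop :=
  ∀ n i j, ones w (j + n) + ones w i ≤ ones w (i + n) + ones w j + 1

/-- `w` is recurrent and all its abelian classes have two or three returns. -/
structure Good (w : ℕ → Bool) : Prop where
  recur : Rec w
  four : AtMostThree w
  two : AtLeastTwo w

variable {w : ℕ → Bool}

theorem ones_succ (w : ℕ → Bool) (n : ℕ) : ones w (n + 1) = ones w n + (w n).toNat := rfl

theorem ones_succ_true {n : ℕ} (h : w n = true) : ones w (n + 1) = ones w n + 1 := by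
  simp [ones_succ, h]

theorem ones_succ_false {n : ℕ} (h : w n = false) : ones w (n + 1) = ones w n := by
  simp [ones_succ, h]

theorem ones_step (w : ℕ → Bool) (n : ℕ) :
    (w n = true ∧ ones w (n + 1) = ones w n + 1) ∨
      (w n = false ∧ ones w (n + 1) = ones w n) := by
  cases h : w n
  · exact Or.inr ⟨rfl, ones_succ_false h⟩
  · exact Or.inl ⟨rfl, ones_succ_true h⟩

theorem ones_add_bounds (w : ℕ → Bool) (i n : ℕ) :
    ones w i ≤ ones w (i + n) ∧ ones w (i + n) ≤ ones w i + n := by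
  induction n with
  | zero => simp
  | succ n ih =>
    have := ones_step w (i + n)
    rw [← add_assoc]
    omega

theorem ones_mono {i j : ℕ} (h : i ≤ j) : ones w i ≤ ones w j := by
  obtain ⟨k, rfl⟩ := Nat.exists_eq_add_of_le h
  exact (ones_add_bounds w i k).1

theorem ones_lip {i j : ℕ} (h : i ≤ j) : ones w j ≤ ones w i + (j - i) := by
  obtain ⟨k, rfl⟩ := Nat.exists_eq_add_of_le h
  have := (ones_add_bounds w i k).2
  omega

theorem ones_congr {v : ℕ → Bool} {i j n : ℕ} (h : ∀ k < n, w (i + k) = v (j + k)) :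
    ones w (i + n) + ones v j = ones v (j + n) + ones w i := by
  induction n with
  | zero => simp [add_comm]
  | succ n ih =>
    have := ih fun k hk => h k (by omega)
    rw [← add_assoc, ← add_assoc, ones_succ, ones_succ, h n (by omega)]
    omega

theorem ones_not (w : ℕ → Bool) (n : ℕ) : ones (fun k => !w k) n + ones w n = n := by
  induction n with
  | zero => rfl
  | succ n ih =>
    rw [ones_succ, ones_succ]
    cases w n <;> simp <;> omega

theorem ones_shift (w : ℕ → Bool) (s n : ℕ) :
    ones (fun k => w (s + k)) n + ones w s = ones w (s + n) := by
  induction n with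
  | zero => simp [ones]
  | succ n ih =>
    rw [← add_assoc, ones_succ, ones_succ]
    omega

theorem inCl_congr {n c i j : ℕ} (h : ∀ k < n, w (i + k) = w (j + k)) (hi : InCl w n c i) :
    InCl w n c j := by
  have := ones_congr h
  unfold InCl at *
  omega

theorem inCl_succ_of_eq {n c i : ℕ} (hi : InCl w n c i) (h : w i = w (i + n)) :
    InCl w n c (i + 1) := by
  unfold InCl at *
  have e : i + 1 + n = i + n + 1 := by omega
  rw [e, ones_succ, ones_succ, ← h]
  omega

theorem Diff.symm {i m j m' : ℕ} (h : Diff w i m j m') : Diff w j m' i m := by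
  rcases h with h | ⟨k, h1, h2, h3⟩
  · exact Or.inl h.symm
  · exact Or.inr ⟨k, h2, h1, h3.symm⟩

theorem diff_of_letter {i m j m' : ℕ} (hm : 0 < m) (hm' : 0 < m') (h : w i ≠ w j) :
    Diff w i m j m' :=
  Or.inr ⟨0, hm, hm', h⟩

theorem diff_of_length {i m j m' : ℕ} (h : m ≠ m') : Diff w i m j m' := Or.inl h

theorem exists_ret (hr : Rec w) {n c i : ℕ} (hi : InCl w n c i) : ∃ m, Ret w n c i m := by
  classical
  have hex : ∃ m, 0 < m ∧ InCl w n c (i + m) := by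
    obtain ⟨j, hj, h⟩ := hr i n (i + 1)
    refine ⟨j - i, by omega, ?_⟩
    rw [show i + (j - i) = j by omega]
    exact inCl_congr (fun k hk => (h k hk).symm) hi
  refine ⟨Nat.find hex, (Nat.find_spec hex).1, hi, (Nat.find_spec hex).2, ?_⟩
  intro k hk hlt hin
  exact Nat.find_min hex hlt ⟨hk, hin⟩

theorem ret_one {n c i : ℕ} (h : InCl w n c i) (h' : InCl w n c (i + 1)) : Ret w n c i 1 :=
  ⟨one_pos, h, h', fun k h1 h2 => by omega⟩

theorem Ret.le {n c i m m' : ℕ} (h : Ret w n c i m) (hm : 0 < m') (h' : InCl w n c (i + m')) :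
    m ≤ m' := by
  by_contra hlt
  exact h.2.2.2 m' hm (by omega) h'

theorem Ret.two_le {n c i m : ℕ} (h : Ret w n c i m) (h' : ¬ InCl w n c (i + 1)) : 2 ≤ m := by
  have := h.1
  rcases Nat.lt_or_ge 1 m with h1 | h1
  · exact h1
  · obtain rfl : m = 1 := by omega
    exact absurd h.2.2.1 h'

/-- If the weight passes from at most `c` to more than `c`, it steps up from `c`. -/
theorem exists_up_of_lt {n c i d : ℕ} (hi : ones w (i + n) ≤ ones w i + c)
    (hj : ones w (i + d) + c < ones w (i + d + n)) :
    ∃ k, InCl w n c k ∧ ¬ InCl w n c (k + 1) ∧ w k = false := by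
  induction d with
  | zero => simp at hj; omega
  | succ d ih =>
    by_cases h : ones w (i + d) + c < ones w (i + d + n)
    · exact ih h
    · refine ⟨i + d, ?_⟩
      have h1 := ones_step w (i + d)
      have h2 := ones_step w (i + d + n)
      unfold InCl
      rw [show i + d + 1 + n = i + d + n + 1 by omega]
      rw [show i + (d + 1) + n = i + d + n + 1 by omega, ← add_assoc] at hj
      rcases h1 with h1 | h1
      · omega
      · refine ⟨by omega, by omega, h1.1⟩

theorem exists_down_of_lt {n c i d : ℕ} (hi : ones w i + c ≤ ones w (i + n))
    (hj : ones w (i + d + n) < ones w (i + d) + c) :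
    ∃ k, InCl w n c k ∧ ¬ InCl w n c (k + 1) ∧ w k = true := by
  induction d with
  | zero => simp at hj; omega
  | succ d ih =>
    by_cases h : ones w (i + d + n) < ones w (i + d) + c
    · exact ih h
    · refine ⟨i + d, ?_⟩
      have h1 := ones_step w (i + d)
      have h2 := ones_step w (i + d + n)
      unfold InCl
      rw [show i + d + 1 + n = i + d + n + 1 by omega]
      rw [show i + (d + 1) + n = i + d + n + 1 by omega, ← add_assoc] at hj
      rcases h1 with h1 | h1
      · refine ⟨by omega, by omega, h1.1⟩
      · omega

/-- A class with weights on both sides has no flat `false` or no flat `true`. -/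
theorem Good.no_flats (hg : Good w) {n c i j : ℕ} (hn : 0 < n)
    (hi : ones w (i + n) < ones w i + c) (hj : ones w j + c < ones w (j + n)) {x y : ℕ}
    (hx : InCl w n c x) (hx0 : w x = false) (hx1 : w (x + n) = false)
    (hy : InCl w n c y) (hy0 : w y = true) (hy1 : w (y + n) = true) : False := by
  obtain ⟨u, hu, hu1, hu0⟩ : ∃ k, InCl w n c k ∧ ¬ InCl w n c (k + 1) ∧ w k = false := by
    obtain ⟨j', hj', h⟩ := hg.recur j n i
    have e := ones_congr h
    obtain ⟨d, rfl⟩ := Nat.exists_eq_add_of_le hj'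
    exact exists_up_of_lt (d := d) hi.le (by omega)
  obtain ⟨v, hv, hv1, hv0⟩ : ∃ k, InCl w n c k ∧ ¬ InCl w n c (k + 1) ∧ w k = true := by
    obtain ⟨i', hi', h⟩ := hg.recur i n j
    have e := ones_congr h
    obtain ⟨d, rfl⟩ := Nat.exists_eq_add_of_le hi'
    exact exists_down_of_lt (d := d) hj.le (by omega)
  obtain ⟨a, ha⟩ := exists_ret hg.recur hu
  obtain ⟨b, hb⟩ := exists_ret hg.recur hv
  have ha2 := ha.two_le hu1
  have hb2 := hb.two_le hv1
  have rx := ret_one hx (inCl_succ_of_eq hx (by rw [hx0, hx1]))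
  have ry := ret_one hy (inCl_succ_of_eq hy (by rw [hy0, hy1]))
  refine hg.four n c hn _ _ _ _ _ _ _ _ rx ry ha hb ?_ ?_ ?_ ?_ ?_ ?_
  · exact diff_of_letter one_pos one_pos (by simp [hx0, hy0])
  · exact diff_of_length (by omega)
  · exact diff_of_length (by omega)
  · exact diff_of_length (by omega)
  · exact diff_of_length (by omega)
  · exact diff_of_letter ha.1 hb.1 (by simp [hu0, hv0])

theorem inCl_not {n c i : ℕ} (hc : c ≤ n) :
    InCl (fun k => !w k) n c i ↔ InCl w n (n - c) i := by
  have h1 := ones_not w i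
  have h2 := ones_not w (i + n)
  unfold InCl
  omega

theorem inCl_le {n c i : ℕ} (h : InCl w n c i) : c ≤ n := by
  have := ones_add_bounds w i n
  unfold InCl at h
  omega

theorem ret_not {n c i m : ℕ} (hc : c ≤ n) :
    Ret (fun k => !w k) n c i m ↔ Ret w n (n - c) i m := by
  simp only [Ret, inCl_not hc]

theorem diff_not {i m j m' : ℕ} : Diff (fun k => !w k) i m j m' ↔ Diff w i m j m' := by
  simp [Diff]

theorem Good.not (hg : Good w) : Good (fun k => !w k) where
  recur := by
    intro i n N
    obtain ⟨j, hj, h⟩ := hg.recur i n N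
    exact ⟨j, hj, fun k hk => by simp [h k hk]⟩
  four := by
    intro n c hn i₁ m₁ i₂ m₂ i₃ m₃ i₄ m₄ r1 r2 r3 r4
    have hc := inCl_le r1.2.1
    simp only [diff_not]
    rw [ret_not hc] at r1 r2 r3 r4
    exact hg.four n _ hn _ _ _ _ _ _ _ _ r1 r2 r3 r4
  two := by
    intro n c i hn h
    have hc := inCl_le h
    rw [inCl_not hc] at h
    simp only [diff_not, ret_not hc]
    exact hg.two n _ i hn h

theorem bal_not (h : Bal fun k => !w k) : Bal w := by
  intro n i j
  have := h n j i
  have h1 := ones_not w i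
  have h2 := ones_not w (i + n)
  have h3 := ones_not w j
  have h4 := ones_not w (j + n)
  omega

theorem inCl_shift {s n c i : ℕ} : InCl (fun k => w (s + k)) n c i ↔ InCl w n c (s + i) := by
  have h1 := ones_shift w s i
  have h2 := ones_shift w s (i + n)
  unfold InCl
  rw [← add_assoc] at h2
  omega

theorem ret_shift {s n c i m : ℕ} :
    Ret (fun k => w (s + k)) n c i m ↔ Ret w n c (s + i) m := by
  simp only [Ret, inCl_shift, add_assoc]

theorem diff_shift {s i m j m' : ℕ} :
    Diff (fun k => w (s + k)) i m j m' ↔ Diff w (s + i) m (s + j) m' := by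
  simp only [Diff, add_assoc]

theorem ret_congr {n c i j m : ℕ} (h : ∀ k < m + n, w (i + k) = w (j + k))
    (hr : Ret w n c i m) : Ret w n c j m := by
  have key : ∀ x ≤ m, InCl w n c (i + x) ↔ InCl w n c (j + x) := by
    intro x hx
    constructor
    · refine inCl_congr fun k hk => ?_
      have := h (x + k) (by omega)
      simpa [add_assoc] using this
    · refine inCl_congr fun k hk => ?_
      have := h (x + k) (by omega)
      simpa [add_assoc] using this.symm
  obtain ⟨h1, h2, h3, h4⟩ := hr
  exact ⟨h1, (key 0 (by omega)).1 h2, (key m le_rfl).1 h3,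
    fun k hk hkm hin => h4 k hk hkm ((key k hkm.le).2 hin)⟩

theorem diff_congr {i i' m j j' m' : ℕ} (h : ∀ k < m, w (i + k) = w (i' + k))
    (h' : ∀ k < m', w (j + k) = w (j' + k)) (hd : Diff w i m j m') : Diff w i' m j' m' := by
  rcases hd with hd | ⟨k, h1, h2, h3⟩
  · exact Or.inl hd
  · exact Or.inr ⟨k, h1, h2, by rwa [← h k h1, ← h' k h2]⟩

theorem Good.shift (hg : Good w) (s : ℕ) : Good (fun k => w (s + k)) where
  recur := by
    intro i n N
    obtain ⟨j, hj, h⟩ := hg.recur (s + i) n (s + N)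
    refine ⟨j - s, by omega, fun k hk => ?_⟩
    have := h k hk
    change w (s + (j - s + k)) = w (s + (i + k))
    rw [show s + (j - s + k) = j + k by omega, this, add_assoc]
  four := by
    intro n c hn i₁ m₁ i₂ m₂ i₃ m₃ i₄ m₄ r1 r2 r3 r4
    simp only [diff_shift]
    rw [ret_shift] at r1 r2 r3 r4
    exact hg.four n _ hn _ _ _ _ _ _ _ _ r1 r2 r3 r4
  two := by
    intro n c i hn h
    rw [inCl_shift] at h
    simp only [diff_shift, ret_shift]
    obtain ⟨i₁, m₁, i₂, m₂, r1, r2, d⟩ := hg.two n c _ hn h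
    obtain ⟨j₁, hj₁, h₁⟩ := hg.recur i₁ (m₁ + n) s
    obtain ⟨j₂, hj₂, h₂⟩ := hg.recur i₂ (m₂ + n) s
    refine ⟨j₁ - s, m₁, j₂ - s, m₂, ?_, ?_, ?_⟩
    · rw [show s + (j₁ - s) = j₁ by omega]
      exact ret_congr (fun k hk => (h₁ k hk).symm) r1
    · rw [show s + (j₂ - s) = j₂ by omega]
      exact ret_congr (fun k hk => (h₂ k hk).symm) r2
    · rw [show s + (j₁ - s) = j₁ by omega, show s + (j₂ - s) = j₂ by omega]
      exact diff_congr (fun k hk => (h₁ k (by omega)).symm) (fun k hk => (h₂ k (by omega)).symm) d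

/-- The structure of a shortest pair of unbalanced factors. -/
theorem unbalanced_structure {n i j : ℕ}
    (hmin : ∀ m < n, ∀ i j, ones w (j + m) + ones w i ≤ ones w (i + m) + ones w j + 1)
    (h : ones w (i + n) + ones w j + 1 < ones w (j + n) + ones w i) :
    ∃ N, n = N + 2 ∧ w i = false ∧ w j = true ∧ w (i + (N + 1)) = false ∧
      w (j + (N + 1)) = true ∧ (∀ k, 0 < k → k ≤ N → w (i + k) = w (j + k)) ∧
      ones w (j + n) + ones w i = ones w (i + n) + ones w j + 2 := by
  have hb := ones_add_bounds w i n
  have hb' := ones_add_bounds w j n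
  have hn : 2 ≤ n := by omega
  obtain ⟨N, rfl⟩ := Nat.exists_eq_add_of_le' hn
  have key : ∀ k, 0 < k → k < N + 2 →
      ones w (j + k) + ones w i = ones w (i + k) + ones w j + 1 := by
    intro k h0 hk
    have h1 := hmin k hk i j
    have h2 := hmin (N + 2 - k) (by omega) (i + k) (j + k)
    rw [show j + k + (N + 2 - k) = j + (N + 2) by omega,
      show i + k + (N + 2 - k) = i + (N + 2) by omega] at h2
    omega
  have k1 := key 1 (by omega) (by omega)
  have k2 := key (N + 1) (by omega) (by omega)
  have s1 := ones_step w i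
  have s2 := ones_step w j
  have s3 := ones_step w (i + (N + 1))
  have s4 := ones_step w (j + (N + 1))
  rw [show i + (N + 1) + 1 = i + (N + 2) by omega] at s3
  rw [show j + (N + 1) + 1 = j + (N + 2) by omega] at s4
  refine ⟨N, rfl, ?_, ?_, ?_, ?_, ?_, ?_⟩
  · rcases s1 with s | s
    · omega
    · exact s.1
  · rcases s2 with s | s
    · exact s.1
    · omega
  · rcases s3 with s | s
    · omega
    · exact s.1
  · rcases s4 with s | s
    · exact s.1
    · omega
  · intro k h0 hk
    have e1 := key k h0 (by omega)
    have e2 := key (k + 1) (by omega) (by omega)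
    have t1 := ones_step w (i + k)
    have t2 := ones_step w (j + k)
    rw [← add_assoc, ← add_assoc] at e2
    rcases t1 with t1 | t1 <;> rcases t2 with t2 | t2
    · rw [t1.1, t2.1]
    · omega
    · omega
    · rw [t1.1, t2.1]
  · rcases s3 with s3 | s3 <;> rcases s4 with s4 | s4 <;> omega

theorem exists_minimal_unbalanced (h : ¬ Bal w) : ∃ n i j,
    (∀ m < n, ∀ i j, ones w (j + m) + ones w i ≤ ones w (i + m) + ones w j + 1) ∧
    ones w (i + n) + ones w j + 1 < ones w (j + n) + ones w i := by
  classical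
  unfold Bal at h
  push Not at h
  refine ⟨Nat.find h, ?_⟩
  obtain ⟨i, j, hij⟩ := Nat.find_spec h
  refine ⟨i, j, fun m hm i j => ?_, hij⟩
  have := Nat.find_min h hm
  push Not at this
  exact this i j

theorem exists_prev {j x : ℕ} (hj : w j = true) (hx : j < x) :
    ∃ y, j ≤ y ∧ y < x ∧ w y = true ∧ ∀ t, y < t → t < x → w t = false := by
  induction x with
  | zero => omega
  | succ x ih =>
    cases h : w x
    · have : j < x := by
        rcases Nat.lt_or_ge j x with h1 | h1
        · exact h1
        · obtain rfl : j = x := by omega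
          simp [hj] at h
      obtain ⟨y, h1, h2, h3, h4⟩ := ih this
      refine ⟨y, h1, by omega, h3, fun t ht htx => ?_⟩
      rcases Nat.lt_or_ge t x with h5 | h5
      · exact h4 t ht h5
      · obtain rfl : t = x := by omega
        exact h
    · exact ⟨x, by omega, by omega, h, fun t ht htx => by omega⟩

/-- A sequence of isolated letters `true`, each followed by one of two patterns built from a
common word `v`, realizes only one of the patterns infinitely often. -/
theorem two_patterns_absurd {v : ℕ → Bool} {N : ℕ} (hv : ∃ k, 0 < k ∧ k ≤ N ∧ v k = true)
    {TA TB : ℕ → Prop}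
    (hTA : ∀ y, TA y → w y = true ∧ w (y + 1) = false ∧
      (∀ k, 0 < k → k ≤ N → w (y + 1 + k) = v k) ∧ w (y + N + 2) = false)
    (hTB : ∀ y, TB y → w y = true ∧ (∀ k, 0 < k → k ≤ N → w (y + k) = v k) ∧
      w (y + N + 1) = true)
    (htype : ∀ y, w y = true → TA y ∨ TB y)
    (hA : ∀ M, ∃ y, M ≤ y ∧ TA y) (hB : ∀ M, ∃ y, M ≤ y ∧ TB y) : False := by
  classical
  set e := Nat.find hv with he
  obtain ⟨he0, heN, hev⟩ := Nat.find_spec hv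
  rw [← he] at he0 heN hev
  have hmin : ∀ k, 0 < k → k < e → v k = false := by
    intro k h0 hk
    have := Nat.find_min hv hk
    cases h : v k
    · rfl
    · exact absurd ⟨h0, by omega, h⟩ this
  have gapA : ∀ y, TA y → (∀ t, 0 < t → t ≤ e → w (y + t) = false) ∧ w (y + (e + 1)) = true := by
    intro y hy
    obtain ⟨h1, h2, h3, -⟩ := hTA y hy
    constructor
    · intro t h0 ht
      rcases Nat.lt_or_ge 1 t with h5 | h5
      · have := h3 (t - 1) (by omega) (by omega)
        rw [show y + 1 + (t - 1) = y + t by omega, hmin _ (by omega) (by omega)] at this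
        exact this
      · obtain rfl : t = 1 := by omega
        exact h2
    · have := h3 e he0 heN
      rw [hev] at this
      rw [← this]; congr 1; omega
  have gapB : ∀ y, TB y → (∀ t, 0 < t → t < e → w (y + t) = false) ∧ w (y + e) = true := by
    intro y hy
    obtain ⟨h1, h3, -⟩ := hTB y hy
    constructor
    · intro t h0 ht
      rw [h3 t h0 (by omega), hmin t h0 ht]
    · rw [h3 e he0 heN, hev]
  by_cases h2 : ∃ d, 0 < d ∧ e + d ≤ N ∧ v (e + d) = true
  · set d := Nat.find h2 with hd
    obtain ⟨hd0, hdN, hdv⟩ := Nat.find_spec h2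
    rw [← hd] at hd0 hdN hdv
    have hmin2 : ∀ k, 0 < k → k < d → v (e + k) = false := by
      intro k h0 hk
      have := Nat.find_min h2 hk
      cases h : v (e + k)
      · rfl
      · exact absurd ⟨h0, by omega, h⟩ this
    obtain ⟨j, -, hj⟩ := hB 0
    have hj := (hTB j hj).1
    have key : ∀ x, j < x → w x = true →
        (∀ t, 0 < t → t < d → w (x + t) = false) ∧ w (x + d) = true := by
      intro x hx hwx
      obtain ⟨y, hy1, hy2, hy3, hy4⟩ := exists_prev hj hx
      rcases htype y hy3 with hy | hy
      · obtain ⟨g1, g2⟩ := gapA y hy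
        have hxy : x = y + 1 + e := by
          by_contra hne
          rcases Nat.lt_or_ge x (y + 1 + e) with h5 | h5
          · have := g1 (x - y) (by omega) (by omega)
            rw [show y + (x - y) = x by omega] at this
            simp [this] at hwx
          · have := hy4 (y + (e + 1)) (by omega) (by omega)
            simp [this] at g2
        subst hxy
        obtain ⟨-, -, h3, -⟩ := hTA y hy
        constructor
        · intro t h0 ht
          rw [add_assoc, h3 _ (by omega) (by omega), hmin2 t h0 ht]
        · rw [add_assoc, h3 _ (by omega) (by omega), hdv]
      · obtain ⟨g1, g2⟩ := gapB y hy
        have hxy : x = y + e := by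
          by_contra hne
          rcases Nat.lt_or_ge x (y + e) with h5 | h5
          · have := g1 (x - y) (by omega) (by omega)
            rw [show y + (x - y) = x by omega] at this
            simp [this] at hwx
          · have := hy4 (y + e) (by omega) (by omega)
            simp [this] at g2
        subst hxy
        obtain ⟨-, h3, -⟩ := hTB y hy
        constructor
        · intro t h0 ht
          rw [add_assoc, h3 _ (by omega) (by omega), hmin2 t h0 ht]
        · rw [add_assoc, h3 _ (by omega) (by omega), hdv]
    obtain ⟨x, hx, hxA⟩ := hA (j + 1)
    obtain ⟨y, hy, hyB⟩ := hB (j + 1)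
    obtain ⟨a1, a2⟩ := key x (by omega) (hTA x hxA).1
    obtain ⟨b1, b2⟩ := key y (by omega) (hTB y hyB).1
    obtain ⟨c1, c2⟩ := gapA x hxA
    obtain ⟨d1, d2⟩ := gapB y hyB
    have e1 : e < d := by
      by_contra hh
      simp [c1 d hd0 (by omega)] at a2
    simp [b1 e he0 e1] at d2
  · have hz : ∀ t, 0 < t → e + t ≤ N → v (e + t) = false := by
      intro t h0 ht
      cases h : v (e + t)
      · rfl
      · exact absurd ⟨t, h0, ht, h⟩ h2
    have hNe : N + 1 ≤ 2 * e + 1 ∧ N + 1 ≥ e + 1 ∧ N + 1 - e ≥ e := by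
      obtain ⟨y, -, hy⟩ := hB 0
      obtain ⟨h1, h3, h4⟩ := hTB y hy
      have hz' : ∀ t, 0 < t → e + t ≤ N → w (y + e + t) = false := by
        intro t h0 ht
        rw [add_assoc, h3 _ (by omega) ht, hz t h0 ht]
      rcases htype (y + e) (gapB y hy).2 with h | h
      · obtain ⟨g1, g2⟩ := gapA _ h
        refine ⟨?_, by omega, ?_⟩
        · by_contra hh
          simp [hz' (e + 1) (by omega) (by omega)] at g2
        · by_contra hh
          have := g1 (N + 1 - e) (by omega) (by omega)
          rw [show y + e + (N + 1 - e) = y + N + 1 by omega, h4] at this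
          simp at this
      · obtain ⟨g1, g2⟩ := gapB _ h
        refine ⟨?_, by omega, ?_⟩
        · by_contra hh
          simp [hz' e (by omega) (by omega)] at g2
        · by_contra hh
          have := g1 (N + 1 - e) (by omega) (by omega)
          rw [show y + e + (N + 1 - e) = y + N + 1 by omega, h4] at this
          simp at this
    have step : ∀ y, TA y → TA (y + (e + 1)) := by
      intro y hy
      obtain ⟨g1, g2⟩ := gapA y hy
      obtain ⟨-, -, h3, h4⟩ := hTA y hy
      rcases htype _ g2 with h | h
      · exact h
      · obtain ⟨-, g4⟩ := gapB _ h
        exfalso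
        rcases Nat.lt_or_ge N (2 * e) with h5 | h5
        · rw [show y + (e + 1) + e = y + N + 2 by omega, h4] at g4
          simp at g4
        · rw [show y + (e + 1) + e = y + 1 + (e + e) by omega, h3 _ (by omega) (by omega),
            hz e he0 (by omega)] at g4
          simp at g4
    obtain ⟨y, -, hy⟩ := hA 0
    have all : ∀ k, TA (y + k * (e + 1)) := by
      intro k
      induction k with
      | zero => simpa using hy
      | succ k ih =>
        have := step _ ih
        rw [show y + (k + 1) * (e + 1) = y + k * (e + 1) + (e + 1) by ring]
        exact this
    obtain ⟨j, hj, hjB⟩ := hB y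
    have hdiv := Nat.div_add_mod (j - y) (e + 1)
    have hlt := Nat.mod_lt (j - y) (show 0 < e + 1 by omega)
    have hA' := all ((j - y) / (e + 1))
    rw [mul_comm] at hdiv
    obtain ⟨g1, g2⟩ := gapA _ hA'
    rcases Nat.eq_zero_or_pos ((j - y) % (e + 1)) with h0 | h0
    · have hj' : y + (j - y) / (e + 1) * (e + 1) = j := by omega
      rw [hj'] at g1
      have := (gapB j hjB).2
      simp [g1 e he0 le_rfl] at this
    · have hj' : y + (j - y) / (e + 1) * (e + 1) + (j - y) % (e + 1) = j := by omega
      have := g1 _ h0 (by omega)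
      rw [hj', (hTB j hjB).1] at this
      simp at this

/-- The case of isolated letters `true` whose gaps are almost constant. -/
theorem bal_of_isolated (hg : Good w) (h11 : ∀ i, w i = true → w (i + 1) = true → False)
    (hrun : ∀ N i j, (∀ k ≤ N + 1, w (i + k) = false) → w j = true →
      (∀ k, 0 < k → k ≤ N → w (j + k) = false) → w (j + (N + 1)) = true → False) : Bal w := by
  by_contra hnb
  obtain ⟨n, i, j, hmin, hij⟩ := exists_minimal_unbalanced hnb
  obtain ⟨N, rfl, hi0, hj0, hi1, hj1, hv, heq⟩ := unbalanced_structure hmin hij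
  obtain ⟨c, hc⟩ : ∃ c, ones w (j + (N + 2)) = ones w j + c + 1 :=
    ⟨ones w (j + (N + 2)) - ones w j - 1, by have := ones_add_bounds w i (N + 2); omega⟩
  have hic : ones w (i + (N + 2)) + 1 = ones w i + c := by omega
  have hN : 0 < N := by
    rcases Nat.eq_zero_or_pos N with rfl | h
    · exact (h11 j hj0 hj1).elim
    · exact h
  have hlow : ∀ x, ones w (x + (N + 2)) < ones w x + c →
      w x = false ∧ w (x + (N + 1)) = false ∧ (∀ k, 0 < k → k ≤ N → w (x + k) = w (i + k)) ∧
      ones w (x + (N + 2)) + 1 = ones w x + c := by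
    intro x hx
    obtain ⟨N', h1, h2, h3, h4, h5, h6, h7⟩ :=
      unbalanced_structure (i := x) (j := j) hmin (by omega)
    obtain rfl : N = N' := by omega
    exact ⟨h2, h4, fun k h0 hk => (h6 k h0 hk).trans (hv k h0 hk).symm, by omega⟩
  have hhigh : ∀ x, ones w x + c < ones w (x + (N + 2)) →
      w x = true ∧ w (x + (N + 1)) = true ∧ (∀ k, 0 < k → k ≤ N → w (x + k) = w (i + k)) := by
    intro x hx
    obtain ⟨N', h1, h2, h3, h4, h5, h6, h7⟩ :=
      unbalanced_structure (i := i) (j := x) hmin (by omega)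
    obtain rfl : N = N' := by omega
    exact ⟨h3, h5, fun k h0 hk => (h6 k h0 hk).symm⟩
  have hnc : ∃ k, 0 < k ∧ k ≤ N ∧ w (i + k) = true := by
    by_contra hh
    push Not at hh
    have hz : ∀ k, 0 < k → k ≤ N → w (i + k) = false := fun k h0 hk => by
      simpa using hh k h0 hk
    refine hrun N i j (fun k hk => ?_) hj0 (fun k h0 hk => ?_) hj1
    · rcases Nat.eq_zero_or_pos k with rfl | h0
      · exact hi0
      · rcases Nat.lt_or_ge N k with h5 | h5
        · obtain rfl : k = N + 1 := by omega
          exact hi1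
        · exact hz k h0 h5
    · rw [← hv k h0 hk, hz k h0 hk]
  have hisoA : ∀ x, ones w (x + (N + 2)) < ones w x + c → w (x + (N + 2)) = true := by
    intro x hx
    obtain ⟨a1, a2, a3, -⟩ := hlow x hx
    cases hlast : w (x + (N + 2))
    · exfalso
      have s1 := ones_succ_false a1
      have s2 := ones_succ_false hlast
      obtain ⟨b1, b2, b3, -⟩ := hlow (x + 1) (by
        rw [show x + 1 + (N + 2) = x + (N + 2) + 1 by omega]; omega)
      have hz : ∀ k, k < N → w (i + (k + 1)) = false := by
        intro k
        induction k with
        | zero => intro h; rw [← a3 1 (by omega) (by omega)]; exact b1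
        | succ k ih =>
          intro hk
          have h1 := ih (by omega)
          rw [← b3 (k + 1) (by omega) (by omega)] at h1
          rw [← a3 (k + 1 + 1) (by omega) (by omega)]
          rw [← h1]; congr 1; omega
      obtain ⟨k, hk0, hkN, hk⟩ := hnc
      have := hz (k - 1) (by omega)
      rw [show k - 1 + 1 = k by omega, hk] at this
      simp at this
    · rfl
  have hflat : ∀ x y, InCl w (N + 2) c x → w x = false → w (x + (N + 2)) = false →
      InCl w (N + 2) c y → w y = true → w (y + (N + 2)) = true → False :=
    fun x y h1 h2 h3 h4 h5 h6 =>
      hg.no_flats (by omega) (i := i) (j := j) (by omega) (by omega) h1 h2 h3 h4 h5 h6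
  by_cases h1f : ∃ y, InCl w (N + 2) c y ∧ w y = true ∧ w (y + (N + 2)) = true
  · obtain ⟨y, y1, y2, y3⟩ := h1f
    have h01 : ∀ x, w x = false → w (x + (N + 2)) = true := by
      intro x hx
      rcases lt_trichotomy (ones w (x + (N + 2))) (ones w x + c) with h | h | h
      · exact hisoA x h
      · cases hh : w (x + (N + 2))
        · exact (hflat x y h hx hh y1 y2 y3).elim
        · rfl
      · have := (hhigh x h).1
        simp [hx] at this
    have hi2 : w (i + 1) = false := by
      rw [hv 1 (by omega) (by omega)]
      cases hh : w (j + 1)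
      · rfl
      · exact (h11 j hj0 hh).elim
    have := h01 (i + 1) hi2
    rw [show i + 1 + (N + 2) = i + (N + 2) + 1 by omega] at this
    exact h11 _ (h01 i hi0) this
  · have h10 : ∀ y, w y = true → w (y + (N + 2)) = false := by
      intro y hy
      rcases lt_trichotomy (ones w (y + (N + 2))) (ones w y + c) with h | h | h
      · have := (hlow y h).1
        simp [hy] at this
      · cases hh : w (y + (N + 2))
        · rfl
        · exact (h1f ⟨y, h, hy, hh⟩).elim
      · cases hh : w (y + (N + 2))
        · rfl
        · exact (h11 _ (hhigh y h).2.1 hh).elim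
    have htypeA : ∀ y, w y = true → InCl w (N + 2) c y →
        w (y + 1) = false ∧
      (∀ k, 0 < k → k ≤ N → w (y + 1 + k) = w (i + k)) ∧ w (y + N + 2) = false := by
      intro y hy hcl
      have s1 := ones_succ_true hy
      have s2 := ones_succ_false (h10 y hy)
      unfold InCl at hcl
      obtain ⟨b1, b2, b3, -⟩ := hlow (y + 1) (by
        rw [show y + 1 + (N + 2) = y + (N + 2) + 1 by omega]; omega)
      exact ⟨b1, b3, h10 y hy⟩
    refine two_patterns_absurd (w := w) (v := fun k => w (i + k)) (N := N) hnc
      (TA := fun y => w y = true ∧ InCl w (N + 2) c y)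
      (TB := fun y => w y = true ∧ ones w y + c < ones w (y + (N + 2))) ?_ ?_ ?_ ?_ ?_
    · exact fun y hy => ⟨hy.1, htypeA y hy.1 hy.2⟩
    · exact fun y hy => ⟨hy.1, (hhigh y hy.2).2.2, (hhigh y hy.2).2.1⟩
    · intro y hy
      rcases lt_trichotomy (ones w (y + (N + 2))) (ones w y + c) with h | h | h
      · have := (hlow y h).1
        simp [hy] at this
      · exact Or.inl ⟨hy, h⟩
      · exact Or.inr ⟨hy, h⟩
    · intro M
      obtain ⟨x, hx, hxw⟩ := hg.recur i (N + 2) (M + 1)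
      have e := ones_congr hxw
      obtain ⟨y, rfl⟩ : ∃ y, x = y + 1 := ⟨x - 1, by omega⟩
      have hlx : ones w (y + 1 + (N + 2)) < ones w (y + 1) + c := by omega
      have e1 : y + 1 + (N + 2) = y + (N + 2) + 1 := by omega
      have e2 : y + 1 + (N + 1) = y + (N + 2) := by omega
      obtain ⟨a1, a2, a3, a4⟩ := hlow _ hlx
      rw [e1] at a4
      rw [e2] at a2
      have s2 := ones_succ_false a2
      refine ⟨y, by omega, ?_⟩
      rcases ones_step w y with s | s
      · exact ⟨s.1, by unfold InCl; omega⟩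
      · have := hisoA y (by omega)
        simp [a2] at this
    · intro M
      obtain ⟨x, hx, hxw⟩ := hg.recur j (N + 2) M
      have e := ones_congr hxw
      have hh : ones w x + c < ones w (x + (N + 2)) := by omega
      exact ⟨x, hx, (hhigh x hh).1, hh⟩

/-- `w` is a concatenation of blocks `1^P 0^Q` (where `b a = 0`) and `1^P 0^(Q+p)`
(where `b a = 1`), the block `a` starting at `q a`. -/
structure Blocks (w : ℕ → Bool) (P Q p : ℕ) (q b : ℕ → ℕ) : Prop where
  hP : 0 < P
  hQ : 0 < Q
  hp : 0 < p
  zero : q 0 = 0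
  next : ∀ a, (b a = 0 ∧ q (a + 1) = q a + P + Q) ∨ (b a = 1 ∧ q (a + 1) = q a + P + Q + p)
  isOne : ∀ a s, s < P → w (q a + s) = true
  isZero : ∀ a s, P ≤ s → q a + s < q (a + 1) → w (q a + s) = false

namespace Blocks
variable {P Q p : ℕ} {q b : ℕ → ℕ}

theorem mono (B : Blocks w P Q p q b) {a c : ℕ} (h : a ≤ c) : q a ≤ q c := by
  induction c, h using Nat.le_induction with
  | base => exact le_rfl
  | succ c _ ih => have := B.next c; omega

theorem exists_block (B : Blocks w P Q p q b) (x : ℕ) : ∃ a, q a ≤ x ∧ x < q (a + 1) := by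
  induction x with
  | zero =>
    have := B.next 0
    have := B.zero
    have := B.hP
    exact ⟨0, by omega, by omega⟩
  | succ x ih =>
    obtain ⟨a, h1, h2⟩ := ih
    rcases Nat.lt_or_ge (x + 1) (q (a + 1)) with h | h
    · exact ⟨a, by omega, h⟩
    · have := B.next (a + 1)
      have := B.hP
      exact ⟨a + 1, by omega, by omega⟩

theorem ones_eq (B : Blocks w P Q p q b) (a : ℕ) {x : ℕ} (h : q a ≤ x) (h' : x ≤ q (a + 1)) :
    ones w x = ones w (q a) + min (x - q a) P := by
  induction x, h using Nat.le_induction with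
  | base => simp
  | succ x hx ih =>
    have ih := ih (by omega)
    rcases Nat.lt_or_ge (x - q a) P with h1 | h1
    · have := B.isOne a (x - q a) h1
      rw [show q a + (x - q a) = x by omega] at this
      rw [ones_succ_true this]
      omega
    · have := B.isZero a (x - q a) h1 (by omega)
      rw [show q a + (x - q a) = x by omega] at this
      rw [ones_succ_false this]
      omega

theorem ones_next (B : Blocks w P Q p q b) (a : ℕ) :
    ones w (q (a + 1)) = ones w (q a) + P := by
  have := B.next a
  rw [B.ones_eq a (by omega) le_rfl]
  omega

theorem ones_ge (B : Blocks w P Q p q b) (a : ℕ) {x : ℕ} (h : q a ≤ x) :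
    ones w (q a) + min (x - q a) P ≤ ones w x := by
  rcases le_total x (q (a + 1)) with h' | h'
  · exact (B.ones_eq a h h').ge
  · have := ones_mono (w := w) h'
    have := B.ones_next a
    omega

theorem word_eq (B : Blocks w P Q p q b) {a c r : ℕ} (h : ∀ k < r, b (a + k) = b (c + k)) :
    q (a + r) + q c = q (c + r) + q a ∧
      ∀ s, q a + s < q (a + r) + P → w (q a + s) = w (q c + s) := by
  induction r with
  | zero =>
    refine ⟨by simp [add_comm], fun s hs => ?_⟩
    rw [B.isOne a s (by simpa using hs), B.isOne c s (by simpa using hs)]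
  | succ r ih =>
    obtain ⟨h1, h2⟩ := ih fun k hk => h k (by omega)
    have h3 := h r (by omega)
    have n1 := B.next (a + r)
    have n2 := B.next (c + r)
    have m1 := B.mono (Nat.le_add_right a r)
    have m2 := B.mono (Nat.le_add_right c r)
    have hlen : q (a + (r + 1)) + q c = q (c + (r + 1)) + q a := by
      rw [← add_assoc, ← add_assoc]; omega
    refine ⟨hlen, fun s hs => ?_⟩
    rcases Nat.lt_or_ge (q a + s) (q (a + r) + P) with h4 | h4
    · exact h2 s h4
    · rcases Nat.lt_or_ge (q a + s) (q (a + (r + 1))) with h5 | h5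
      · have z1 := B.isZero (a + r) (q a + s - q (a + r)) (by omega)
          (by rw [add_assoc a r 1]; omega)
        have z2 := B.isZero (c + r) (q c + s - q (c + r)) (by omega)
          (by rw [add_assoc c r 1]; omega)
        rw [show q (a + r) + (q a + s - q (a + r)) = q a + s by omega] at z1
        rw [show q (c + r) + (q c + s - q (c + r)) = q c + s by omega] at z2
        rw [z1, z2]
      · have z1 := B.isOne (a + (r + 1)) (q a + s - q (a + (r + 1))) (by omega)
        have z2 := B.isOne (c + (r + 1)) (q c + s - q (c + (r + 1))) (by omega)
        rw [show q (a + (r + 1)) + (q a + s - q (a + (r + 1))) = q a + s by omega] at z1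
        rw [show q (c + (r + 1)) + (q c + s - q (c + (r + 1))) = q c + s by omega] at z2
        rw [z1, z2]

end Blocks

/-- The blocks `a` and `a + 1 + e` are consecutive blocks of type `t`. -/
def Gap (b : ℕ → ℕ) (t a e : ℕ) : Prop :=
  b a = t ∧ (∀ k < e, b (a + 1 + k) ≠ t) ∧ b (a + 1 + e) = t

namespace Blocks
variable {P Q p : ℕ} {q b : ℕ → ℕ}

theorem le_one (B : Blocks w P Q p q b) (a : ℕ) : b a = 0 ∨ b a = 1 := by
  have := B.next a; omega

theorem lt_iff (B : Blocks w P Q p q b) {a c : ℕ} : q a < q c ↔ a < c := by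
  constructor
  · intro h
    by_contra hh
    have := B.mono (Nat.le_of_not_lt hh)
    omega
  · intro h
    have := B.mono (show a + 1 ≤ c from h)
    have := B.next a
    have := B.hP
    omega

theorem two_gaps (B : Blocks w P Q p q b) (hg : Good w) {n c t δ : ℕ} (hn : 0 < n) (hδ : δ ≤ P)
    (hmem : ∀ x, InCl w n c x ↔ ∃ a, b a = t ∧ x = q a + δ) (hex : ∃ a, b a = t) :
    ∃ a e a' e', Gap b t a e ∧ Gap b t a' e' ∧ e < e' := by
  have toGap : ∀ i m, Ret w n c i m → ∃ a e, Gap b t a e ∧ i = q a + δ ∧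
      i + m = q (a + 1 + e) + δ := by
    rintro i m ⟨hm, h1, h2, h3⟩
    obtain ⟨a, ha, rfl⟩ := (hmem _).1 h1
    obtain ⟨a', ha', h4⟩ := (hmem _).1 h2
    have hlt : a < a' := B.lt_iff.1 (by omega)
    obtain ⟨e, rfl⟩ : ∃ e, a' = a + 1 + e := ⟨a' - a - 1, by omega⟩
    refine ⟨a, e, ⟨ha, fun k hk hb => ?_, ha'⟩, rfl, h4⟩
    have l1 := B.lt_iff.2 (show a < a + 1 + k by omega)
    have l2 := B.lt_iff.2 (show a + 1 + k < a + 1 + e by omega)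
    refine h3 (q (a + 1 + k) - q a) (by omega) (by omega) ((hmem _).2 ⟨_, hb, by omega⟩)
  obtain ⟨a0, ha0⟩ := hex
  obtain ⟨i, m, i', m', r, r', hd⟩ := hg.two n c _ hn ((hmem _).2 ⟨a0, ha0, rfl⟩)
  obtain ⟨a, e, g, rfl, hm⟩ := toGap _ _ r
  obtain ⟨a', e', g', rfl, hm'⟩ := toGap _ _ r'
  rcases lt_trichotomy e e' with h | rfl | h
  · exact ⟨a, e, a', e', g, g', h⟩
  · exfalso
    have hb : ∀ k < 1 + e, b (a + k) = b (a' + k) := by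
      intro k hk
      rcases Nat.eq_zero_or_pos k with rfl | h0
      · rw [add_zero, add_zero, g.1, g'.1]
      · have h1 := g.2.1 (k - 1) (by omega)
        have h2 := g'.2.1 (k - 1) (by omega)
        rw [show a + 1 + (k - 1) = a + k by omega] at h1
        rw [show a' + 1 + (k - 1) = a' + k by omega] at h2
        have l1 := B.le_one (a + k)
        have l2 := B.le_one (a' + k)
        have l3 := B.le_one a
        have := g.1
        omega
    obtain ⟨h1, h2⟩ := B.word_eq hb
    rw [← add_assoc, ← add_assoc] at h1
    rw [← add_assoc] at h2
    rcases hd with hd | ⟨k, hk, hk', hd⟩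
    · omega
    · apply hd
      have := h2 (δ + k) (by omega)
      rw [add_assoc, add_assoc]
      exact this
  · exact ⟨a', e', a, e, g', g, h⟩

theorem exists_type (B : Blocks w P Q p q b) (hg : Good w) {t : ℕ} (ht : t ≤ 1) :
    ∃ a, b a = t := by
  by_contra hne
  push Not at hne
  have hall : ∀ a, b a = 1 - t := fun a => by
    have := B.le_one a
    have := hne a
    omega
  have hP := B.hP
  have hQ := B.hQ
  obtain ⟨a, e, a', e', g, g', h⟩ := B.two_gaps hg (n := P) (c := P) (t := 1 - t) (δ := 0)
    hP (by omega) (by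
      intro x
      constructor
      · intro hx
        obtain ⟨a, h1, h2⟩ := B.exists_block x
        refine ⟨a, hall a, ?_⟩
        have e1 := B.ones_eq a h1 h2.le
        have n1 := B.next a
        have n2 := B.next (a + 1)
        have o1 := B.ones_next a
        have f1 := B.ones_eq a (x := x + P)
        have f2 := B.ones_eq (a + 1) (x := x + P)
        unfold InCl at hx
        omega
      · rintro ⟨a, -, rfl⟩
        have n1 := B.next a
        have f1 := B.ones_eq a (x := q a + 0 + P) (by omega) (by omega)
        unfold InCl
        rw [f1]
        simp) ⟨0, hall 0⟩
  exact g'.2.1 0 (by omega) (hall _)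

theorem two_gaps_one (B : Blocks w P Q p q b) (hg : Good w) :
    ∃ a e a' e', Gap b 1 a e ∧ Gap b 1 a' e' ∧ e < e' := by
  have hP := B.hP
  have hQ := B.hQ
  have hp := B.hp
  refine B.two_gaps hg (n := Q + p) (c := 0) (t := 1) (δ := P) (by omega) le_rfl ?_
    (B.exists_type hg le_rfl)
  intro x
  constructor
  · intro hx
    obtain ⟨a, h1, h2⟩ := B.exists_block x
    have e1 := B.ones_eq a h1 h2.le
    have n1 := B.next a
    have o1 := B.ones_next a
    have f1 := B.ones_ge a (x := x + (Q + p)) (by omega)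
    have f2 := B.ones_ge (a + 1) (x := x + (Q + p))
    unfold InCl at hx
    exact ⟨a, by omega, by omega⟩
  · rintro ⟨a, hb, rfl⟩
    have n1 := B.next a
    have f1 := B.ones_eq a (x := q a + P) (by omega) (by omega)
    have f2 := B.ones_eq a (x := q a + P + (Q + p)) (by omega) (by omega)
    unfold InCl
    omega

theorem two_gaps_zero (B : Blocks w P Q p q b) (hg : Good w) :
    ∃ a e a' e', Gap b 0 a e ∧ Gap b 0 a' e' ∧ e < e' := by
  have hP := B.hP
  have hQ := B.hQ
  have hp := B.hp
  refine B.two_gaps hg (n := 2 * P + Q) (c := 2 * P) (t := 0) (δ := 0) (by omega) (by omega) ?_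
    (B.exists_type hg (by omega))
  intro x
  constructor
  · intro hx
    obtain ⟨a, h1, h2⟩ := B.exists_block x
    have e1 := B.ones_eq a h1 h2.le
    have n1 := B.next a
    have n2 := B.next (a + 1)
    have o1 := B.ones_next a
    have o2 := B.ones_next (a + 1)
    have f1 := B.ones_eq (a + 1) (x := x + (2 * P + Q))
    have f0 := B.ones_eq a (x := x + (2 * P + Q))
    have f2 := ones_lip (w := w) (i := q (a + 1 + 1)) (j := x + (2 * P + Q))
    unfold InCl at hx
    exact ⟨a, by omega, by omega⟩
  · rintro ⟨a, hb, rfl⟩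
    have n1 := B.next a
    have n2 := B.next (a + 1)
    have o1 := B.ones_next a
    have f2 := B.ones_eq (a + 1) (x := q a + 0 + (2 * P + Q)) (by omega) (by omega)
    unfold InCl
    rw [f2]
    simp only [add_zero]
    omega

theorem next_zero (B : Blocks w P Q p q b) {a : ℕ} (h : b a = 0) : q (a + 1) = q a + P + Q := by
  have := B.next a
  omega

theorem next_one (B : Blocks w P Q p q b) {a : ℕ} (h : b a = 1) :
    q (a + 1) = q a + P + Q + p := by
  have := B.next a
  omega

theorem next_ge (B : Blocks w P Q p q b) (a : ℕ) : q a + P + Q ≤ q (a + 1) := by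
  have := B.next a
  omega

theorem ones_run (B : Blocks w P Q p q b) (a : ℕ) {x : ℕ} (h : q a ≤ x) (h' : x ≤ q a + P) :
    ones w x + q a = ones w (q a) + x := by
  have h1 := B.next_ge a
  have := B.ones_eq a h (by omega)
  omega

theorem ones_rest (B : Blocks w P Q p q b) (a : ℕ) {x : ℕ} (h : q a + P ≤ x)
    (h' : x ≤ q (a + 1)) : ones w x = ones w (q a) + P := by
  have := B.ones_eq a (by omega) h'
  omega

theorem isZero' (B : Blocks w P Q p q b) (a : ℕ) {x : ℕ} (h : q a + P ≤ x)
    (h' : x < q (a + 1)) : w x = false := by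
  have := B.isZero a (x - q a) (by omega) (by omega)
  rwa [show q a + (x - q a) = x by omega] at this

theorem isOne' (B : Blocks w P Q p q b) (a : ℕ) {x : ℕ} (h : q a ≤ x)
    (h' : x < q a + P) : w x = true := by
  have := B.isOne a (x - q a) (by omega)
  rwa [show q a + (x - q a) = x by omega] at this

theorem gap_one_length (B : Blocks w P Q p q b) {a e : ℕ} (g : Gap b 1 a e) :
    q (a + 1 + e) = q (a + 1) + e * (P + Q) := by
  have h : ∀ k ≤ e, q (a + 1 + k) = q (a + 1) + k * (P + Q) := by
    intro k
    induction k with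
    | zero => simp
    | succ k ih =>
      intro hk
      have := ih (by omega)
      have h1 := g.2.1 k (by omega)
      have := B.next (a + 1 + k)
      rw [← add_assoc, add_mul]
      omega
  exact h e le_rfl

theorem gap_zero_length (B : Blocks w P Q p q b) {a e : ℕ} (g : Gap b 0 a e) :
    q (a + 1 + e) = q (a + 1) + e * (P + Q + p) := by
  have h : ∀ k ≤ e, q (a + 1 + k) = q (a + 1) + k * (P + Q + p) := by
    intro k
    induction k with
    | zero => simp
    | succ k ih =>
      intro hk
      have := ih (by omega)
      have h1 := g.2.1 k (by omega)
      have := B.next (a + 1 + k)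
      rw [← add_assoc, add_mul]
      omega
  exact h e le_rfl

/-- Blocks of both types cannot both be repeated. -/
theorem not_both_repeat (B : Blocks w P Q p q b) (hg : Good w) {x y z : ℕ}
    (hx : b x = 0) (hx1 : b (x + 1) = 0) (hy : b y = 1) (hy1 : b (y + 1) = 1)
    (hz : b z = 0) (hz1 : b (z + 1) = 1) : False := by
  have hP := B.hP
  have hQ := B.hQ
  have hp := B.hp
  obtain ⟨n, hn⟩ : ∃ n, n = 2 * P + 2 * Q + p := ⟨_, rfl⟩
  have hX : ones w (q x) + 2 * P < ones w (q x + n) := by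
    have x1 := B.next_zero hx
    have x2 := B.next_zero hx1
    have ox1 := B.ones_next x
    have ox2 := B.ones_next (x + 1)
    have h2 := B.ones_ge (x + 1 + 1) (x := q x + n) (by omega)
    omega
  have hY : ones w (q y + P + n) < ones w (q y + P) + 2 * P := by
    have y1 := B.next_one hy
    have y2 := B.next_one hy1
    have oy1 := B.ones_next y
    have oy2 := B.ones_next (y + 1)
    have h1 := B.ones_rest y (x := q y + P) le_rfl (by omega)
    rcases Nat.lt_or_ge p P with h | h
    · have h2 := B.ones_run (y + 1 + 1) (x := q y + P + n) (by omega) (by omega)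
      omega
    · have h2 := ones_mono (w := w) (i := q y + P + n) (j := q (y + 1 + 1)) (by omega)
      omega
  have z1 := B.next_zero hz
  have z2 := B.next_one hz1
  have z3 := B.next_ge (z + 1 + 1)
  have oz1 := B.ones_next z
  have oz2 := B.ones_next (z + 1)
  have ez : q z + n = q (z + 1 + 1) := by omega
  have ez' : q z + P + n = q (z + 1 + 1) + P := by omega
  refine hg.no_flats (n := n) (c := 2 * P) (i := q y + P) (j := q x)
    (x := q z + P) (y := q z) (by omega) hY hX ?_ ?_ ?_ ?_ ?_ ?_
  · have h1 := B.ones_rest z (x := q z + P) le_rfl (by omega)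
    have h2 := B.ones_rest (z + 1 + 1) (x := q (z + 1 + 1) + P) le_rfl (by omega)
    unfold InCl
    rw [ez']
    omega
  · exact B.isZero z P le_rfl (by omega)
  · rw [ez']
    exact B.isZero (z + 1 + 1) P le_rfl (by omega)
  · unfold InCl
    rw [ez]
    omega
  · simpa using B.isOne z 0 hP
  · rw [ez]
    simpa using B.isOne (z + 1 + 1) 0 hP

/-- The block before the end of a nonempty gap. -/
theorem Gap.last_one (B : Blocks w P Q p q b) {a e : ℕ} (g : Gap b 1 a e) (he : 0 < e) :
    b (a + e) = 0 := by
  have h := g.2.1 (e - 1) (by omega)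
  rw [show a + 1 + (e - 1) = a + e by omega] at h
  have := B.le_one (a + e)
  omega

theorem Gap.last_zero (B : Blocks w P Q p q b) {a e : ℕ} (g : Gap b 0 a e) (he : 0 < e) :
    b (a + e) = 1 := by
  have h := g.2.1 (e - 1) (by omega)
  rw [show a + 1 + (e - 1) = a + e by omega] at h
  have := B.le_one (a + e)
  omega

/-- A block meeting the part of the word spanned by a gap. -/
theorem Gap.block_cases (B : Blocks w P Q p q b) {t a e x c : ℕ} (g : Gap b t a e)
    (h : q a ≤ x) (h' : x < q (a + e + 1)) (c1 : q c ≤ x) (c2 : x < q (c + 1)) :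
    (c = a ∨ (a < c ∧ b c ≠ t)) ∧ ((c < a + e ∧ b (c + 1) ≠ t) ∨ c = a + e) := by
  have hac : a ≤ c := by
    have := B.lt_iff (a := a) (c := c + 1)
    omega
  have hce : c < a + e + 1 := by
    have := B.lt_iff (a := c) (c := a + e + 1)
    omega
  constructor
  · rcases Nat.eq_or_lt_of_le hac with h | h
    · exact Or.inl h.symm
    · have := g.2.1 (c - a - 1) (by omega)
      rw [show a + 1 + (c - a - 1) = c by omega] at this
      exact Or.inr ⟨h, this⟩
  · rcases Nat.lt_or_ge c (a + e) with h | h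
    · have := g.2.1 (c - a) (by omega)
      rw [show a + 1 + (c - a) = c + 1 by omega] at this
      exact Or.inl ⟨h, this⟩
    · exact Or.inr (by omega)

theorem long_two_start (B : Blocks w P Q p q b) {n y s : ℕ} (hn : n + 1 = P + 2 * Q + p)
    (hp2 : 2 ≤ p) (h0 : b y = 0) (h1 : b (y + 1) = 1) (hs : s + Q = q (y + 1)) :
    InCl w n P s ∧ InCl w n P (s + 1) := by
  have hP := B.hP
  have hQ := B.hQ
  have y1 := B.next_zero h0
  have y2 := B.next_one h1
  have oy1 := B.ones_next y
  have oy2 := B.ones_next (y + 1)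
  have f1 := B.ones_rest y (x := s) (by omega) (by omega)
  have f2 := B.ones_rest (y + 1) (x := s + n) (by omega) (by omega)
  have f3 := B.ones_rest y (x := s + 1) (by omega) (by omega)
  have f4 := B.ones_rest (y + 1) (x := s + 1 + n) (by omega) (by omega)
  unfold InCl
  omega

theorem long_two_mid (B : Blocks w P Q p q b) {n y : ℕ} (hn : n + 1 = P + 2 * Q + p)
    (h1 : b y = 1) (h0 : b (y + 1) = 0) :
    InCl w n P (q y + P) ∧ InCl w n P (q y + P + 1) := by
  have hP := B.hP
  have hQ := B.hQ
  have hp := B.hp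
  have y1 := B.next_one h1
  have y2 := B.next_zero h0
  have oy1 := B.ones_next y
  have oy2 := B.ones_next (y + 1)
  have f1 := B.ones_rest y (x := q y + P) (by omega) (by omega)
  have f2 := B.ones_rest (y + 1) (x := q y + P + n) (by omega) (by omega)
  have f3 := B.ones_rest y (x := q y + P + 1) (by omega) (by omega)
  have f4 := B.ones_rest (y + 1) (x := q y + P + 1 + n) (by omega) (by omega)
  unfold InCl
  omega

theorem long_two_not_mem (B : Blocks w P Q p q b) {n a e x : ℕ} (hn : n + 1 = P + 2 * Q + p)
    (hp2 : 2 ≤ p) (ha : b (a + 1) = 0) (g : Gap b 1 a e) (h : q a + P + 1 < x)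
    (h' : x + Q < q (a + e + 1)) : ¬ InCl w n P x := by
  have hP := B.hP
  have hQ := B.hQ
  obtain ⟨c, c1, c2⟩ := B.exists_block x
  obtain ⟨k1, k2⟩ := Gap.block_cases B g (by omega) (by omega) c1 c2
  have o1 := B.ones_next c
  have o2 := B.ones_next (c + 1)
  have n3 := B.next_ge (c + 1 + 1)
  unfold InCl
  rcases k1 with rfl | ⟨k1, k3⟩
  · have n1 := B.next_one g.1
    have n2 := B.next_zero ha
    have f1 := B.ones_rest c (x := x) (by omega) (by omega)
    have f2 := B.ones_ge (c + 1 + 1) (x := x + n) (by omega)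
    intro hcl
    have f3 := B.ones_run (c + 1 + 1) (x := q (c + 1 + 1) + 1) (by omega) (by omega)
    have f4 := ones_mono (w := w) (i := q (c + 1 + 1) + 1) (j := x + n) (by omega)
    omega
  · have k0 : b c = 0 := by
      have := B.le_one c
      omega
    have n1 := B.next_zero k0
    rcases Nat.lt_or_ge x (q c + P) with h5 | h5
    · have f1 := B.ones_run c c1 h5.le
      rcases Nat.lt_or_ge (x + n) (q (c + 1) + P) with h6 | h6
      · have f2 := B.ones_run (c + 1) (x := x + n) (by omega) h6.le
        omega
      · have f2 := B.ones_run (c + 1) (x := q (c + 1) + P) (by omega) le_rfl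
        have f3 := ones_mono (w := w) h6
        omega
    · rcases k2 with ⟨k2, k4⟩ | rfl
      · have k5 : b (c + 1) = 0 := by
          have := B.le_one (c + 1)
          omega
        have n2 := B.next_zero k5
        have f1 := B.ones_rest c h5 c2.le
        have f3 := B.ones_run (c + 1 + 1) (x := q (c + 1 + 1) + 1) (by omega) (by omega)
        have f4 := ones_mono (w := w) (i := q (c + 1 + 1) + 1) (j := x + n) (by omega)
        omega
      · omega

/-- Isolated long blocks, `p ≥ 2`. -/
theorem isolated_long_of_two_le (B : Blocks w P Q p q b) (hg : Good w) (hp2 : 2 ≤ p)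
    (hYY : ∀ a, b a = 1 → b (a + 1) = 0) {z : ℕ} (hz : b z = 0) (hz1 : b (z + 1) = 1)
    {a e a' e' : ℕ} (g : Gap b 1 a e) (g' : Gap b 1 a' e') (he : 0 < e) (hlt : e < e') :
    False := by
  have hP := B.hP
  have hQ := B.hQ
  obtain ⟨n, hn⟩ : ∃ n, n + 1 = P + 2 * Q + p := ⟨P + 2 * Q + p - 1, by omega⟩
  have key : ∀ a e, Gap b 1 a e → 0 < e → ∀ m, m + 1 = e * (P + Q) + p →
      Ret w n P (q a + P + 1) m ∧ w (q a + P + 1) = false := by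
    intro a e g he m hm
    have hl := B.gap_one_length g
    have lend := g.2.2
    rw [show a + 1 + e = a + e + 1 by omega] at lend hl
    have a1 := B.next_one g.1
    have a2 := hYY a g.1
    have hmul : P + Q ≤ e * (P + Q) := Nat.le_mul_of_pos_left _ he
    refine ⟨⟨by omega, (B.long_two_mid hn g.1 a2).2, ?_, fun k hk hk2 => ?_⟩, ?_⟩
    · exact (B.long_two_start hn hp2 (Gap.last_one B g he) lend (by omega)).1
    · exact B.long_two_not_mem hn hp2 a2 g (by omega) (by omega)
    · exact B.isZero' a (by omega) (by omega)
  have hm1 : P + Q ≤ e * (P + Q) := Nat.le_mul_of_pos_left _ he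
  have hm2 : e * (P + Q) < e' * (P + Q) := Nat.mul_lt_mul_of_pos_right hlt (by omega)
  obtain ⟨m3, hm3⟩ : ∃ m, m + 1 = e * (P + Q) + p := ⟨e * (P + Q) + p - 1, by omega⟩
  obtain ⟨m4, hm4⟩ : ∃ m, m + 1 = e' * (P + Q) + p := ⟨e' * (P + Q) + p - 1, by omega⟩
  obtain ⟨r3, w3⟩ := key a e g he m3 hm3
  obtain ⟨r4, w4⟩ := key a' e' g' (by omega) m4 hm4
  have z1 := B.next_zero hz
  have z2 := B.next_one hz1
  obtain ⟨s, hs⟩ : ∃ s, s + Q = q (z + 1) := ⟨q (z + 1) - Q, by omega⟩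
  have hA := B.long_two_start hn hp2 hz hz1 hs
  have r1 := ret_one hA.1 hA.2
  obtain ⟨m, r2⟩ := exists_ret hg.recur hA.2
  have m2 : m ≤ P + Q - 1 := by
    refine r2.le (by omega) ?_
    rw [show s + 1 + (P + Q - 1) = q (z + 1) + P by omega]
    exact (B.long_two_mid hn hz1 (hYY _ hz1)).1
  have d12 : Diff w s 1 (s + 1) m := by
    rcases Nat.lt_or_ge 1 Q with h | h
    · have : 2 ≤ m := by
        refine r2.two_le ?_
        have z3 := B.next_zero (hYY _ hz1)
        have oz1 := B.ones_next z
        have oz2 := B.ones_next (z + 1)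
        have f1 := B.ones_rest z (x := s + 1 + 1) (by omega) (by omega)
        have f2 := B.ones_run (z + 1 + 1) (x := s + 1 + 1 + n) (by omega) (by omega)
        unfold InCl
        omega
      exact diff_of_length (by omega)
    · refine diff_of_letter one_pos r2.1 ?_
      rw [B.isZero' z (x := s) (by omega) (by omega),
        B.isOne' (z + 1) (x := s + 1) (by omega) (by omega)]
      simp
  exact hg.four n P (by omega) _ _ _ _ _ _ _ _ r1 r2 r3 r4 d12
    (diff_of_length (by omega)) (diff_of_length (by omega)) (diff_of_length (by omega))
    (diff_of_length (by omega)) (diff_of_length (by omega))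

theorem long_one_start (B : Blocks w P Q 1 q b) {n y s : ℕ} (hn : n = P + 2 * Q + 2)
    (h0 : b y = 0) (h1 : b (y + 1) = 1) (hs : s + 1 + Q = q (y + 1)) :
    InCl w n (P + 1) s ∧ InCl w n (P + 1) (s + 1) := by
  have hP := B.hP
  have hQ := B.hQ
  have y1 := B.next_zero h0
  have y2 := B.next_one h1
  have oy1 := B.ones_next y
  have oy2 := B.ones_next (y + 1)
  have f1 := B.ones_run y (x := s) (by omega) (by omega)
  have f2 := B.ones_rest (y + 1) (x := s + n) (by omega) (by omega)
  have f3 := B.ones_rest y (x := s + 1) (by omega) (by omega)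
  have f4 := B.ones_run (y + 1 + 1) (x := s + 1 + n) (by omega) (by omega)
  unfold InCl
  omega

theorem long_one_mid (B : Blocks w P Q 1 q b) {n y s : ℕ} (hn : n = P + 2 * Q + 2)
    (h1 : b y = 1) (h0 : b (y + 1) = 0) (hs : s + 1 = q y + P) :
    InCl w n (P + 1) s ∧ InCl w n (P + 1) (s + 1) := by
  have hP := B.hP
  have hQ := B.hQ
  have y1 := B.next_one h1
  have y2 := B.next_zero h0
  have oy1 := B.ones_next y
  have oy2 := B.ones_next (y + 1)
  have f1 := B.ones_run y (x := s) (by omega) (by omega)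
  have f2 := B.ones_rest (y + 1) (x := s + n) (by omega) (by omega)
  have f3 := B.ones_rest y (x := s + 1) (by omega) (by omega)
  have f4 := B.ones_run (y + 1 + 1) (x := s + 1 + n) (by omega) (by omega)
  unfold InCl
  omega

theorem long_one_not_mem (B : Blocks w P Q 1 q b) {n a e x : ℕ} (hn : n = P + 2 * Q + 2)
    (hP2 : 2 ≤ P) (ha : b (a + 1) = 0) (g : Gap b 1 a e) (h : q a + P < x)
    (h' : x + Q + 1 < q (a + e + 1)) : ¬ InCl w n (P + 1) x := by
  have hQ := B.hQ
  obtain ⟨c, c1, c2⟩ := B.exists_block x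
  obtain ⟨k1, k2⟩ := Gap.block_cases B g (by omega) (by omega) c1 c2
  have o1 := B.ones_next c
  have o2 := B.ones_next (c + 1)
  have n3 := B.next_ge (c + 1 + 1)
  unfold InCl
  rcases k1 with rfl | ⟨k1, k3⟩
  · have n1 := B.next_one g.1
    have n2 := B.next_zero ha
    have f1 := B.ones_rest c (x := x) (by omega) (by omega)
    have f3 := B.ones_run (c + 1 + 1) (x := q (c + 1 + 1) + 2) (by omega) (by omega)
    have f4 := ones_mono (w := w) (i := q (c + 1 + 1) + 2) (j := x + n) (by omega)
    omega
  · have k0 : b c = 0 := by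
      have := B.le_one c
      omega
    have n1 := B.next_zero k0
    have k5 : c < a + e → b (c + 1) = 0 := by
      have := B.le_one (c + 1)
      omega
    rcases Nat.lt_or_ge x (q c + P) with h5 | h5
    · have f1 := B.ones_run c c1 h5.le
      rcases Nat.lt_or_ge (x + n) (q (c + 1) + P) with h6 | h6
      · have f2 := B.ones_run (c + 1) (x := x + n) (by omega) h6.le
        omega
      · have f2 := B.ones_run (c + 1) (x := q (c + 1) + P) (by omega) le_rfl
        have f3 := ones_mono (w := w) h6
        rcases Nat.lt_or_ge (x + 1) (q c + P) with h7 | h7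
        · omega
        · rcases k2 with ⟨k2, -⟩ | rfl
          · have n2 := B.next_zero (k5 k2)
            have f4 := B.ones_run (c + 1 + 1) (x := x + n) (by omega) (by omega)
            omega
          · omega
    · rcases k2 with ⟨k2, -⟩ | rfl
      · have n2 := B.next_zero (k5 k2)
        have f1 := B.ones_rest c h5 c2.le
        have f3 := B.ones_run (c + 1 + 1) (x := q (c + 1 + 1) + 2) (by omega) (by omega)
        have f4 := ones_mono (w := w) (i := q (c + 1 + 1) + 2) (j := x + n) (by omega)
        omega
      · omega

/-- Isolated long blocks, `p = 1`. -/
theorem isolated_long_of_eq_one (B : Blocks w P Q 1 q b) (hg : Good w) (hP2 : 2 ≤ P)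
    (hYY : ∀ a, b a = 1 → b (a + 1) = 0) {z : ℕ} (hz : b z = 0) (hz1 : b (z + 1) = 1)
    {a e a' e' : ℕ} (g : Gap b 1 a e) (g' : Gap b 1 a' e') (he : 0 < e) (hlt : e < e') :
    False := by
  have hQ := B.hQ
  obtain ⟨n, hn⟩ : ∃ n, n = P + 2 * Q + 2 := ⟨_, rfl⟩
  have key : ∀ a e, Gap b 1 a e → 0 < e → Ret w n (P + 1) (q a + P) (e * (P + Q)) := by
    intro a e g he
    have hl := B.gap_one_length g
    have lend := g.2.2
    rw [show a + 1 + e = a + e + 1 by omega] at lend hl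
    have a1 := B.next_one g.1
    have a2 := hYY a g.1
    have hmul : P + Q ≤ e * (P + Q) := Nat.le_mul_of_pos_left _ he
    obtain ⟨s, hs⟩ : ∃ s, s + 1 = q a + P := ⟨q a + P - 1, by omega⟩
    refine ⟨by omega, ?_, ?_, fun k hk hk2 => ?_⟩
    · rw [← hs]
      exact (B.long_one_mid hn g.1 a2 hs).2
    · exact (B.long_one_start hn (Gap.last_one B g he) lend (by omega)).1
    · exact B.long_one_not_mem hn hP2 a2 g (by omega) (by omega)
  have hm1 : P + Q ≤ e * (P + Q) := Nat.le_mul_of_pos_left _ he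
  have hm2 : e * (P + Q) < e' * (P + Q) := Nat.mul_lt_mul_of_pos_right hlt (by omega)
  have r3 := key a e g he
  have r4 := key a' e' g' (by omega)
  have z1 := B.next_zero hz
  have z2 := B.next_one hz1
  obtain ⟨s, hs⟩ : ∃ s, s + 1 + Q = q (z + 1) := ⟨q (z + 1) - Q - 1, by omega⟩
  have hA := B.long_one_start hn hz hz1 hs
  have r1 := ret_one hA.1 hA.2
  obtain ⟨m, r2⟩ := exists_ret hg.recur hA.2
  have m2 : m ≤ P + Q - 1 := by
    refine r2.le (by omega) (B.long_one_mid hn hz1 (hYY _ hz1) (by omega)).1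
  exact hg.four n (P + 1) (by omega) _ _ _ _ _ _ _ _ r1 r2 r3 r4
    (diff_of_letter one_pos r2.1 (by
      rw [B.isOne' z (x := s) (by omega) (by omega),
        B.isZero' z (x := s + 1) (by omega) (by omega)]
      simp))
    (diff_of_length (by omega)) (diff_of_length (by omega)) (diff_of_length (by omega))
    (diff_of_length (by omega)) (diff_of_length (by omega))

theorem short_two_start (B : Blocks w P Q p q b) {n c y : ℕ} (hn : n + 1 = 2 * P + Q + p)
    (hc : c + 1 = 2 * P) (h1 : b y = 1) : InCl w n c (q y) ∧ InCl w n c (q y + 1) := by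
  have hP := B.hP
  have hQ := B.hQ
  have y1 := B.next_one h1
  have oy1 := B.ones_next y
  have f1 := B.ones_run y (x := q y + 1) (by omega) (by omega)
  have f2 := B.ones_run (y + 1) (x := q y + n) (by omega) (by omega)
  have f3 := B.ones_run (y + 1) (x := q y + 1 + n) (by omega) (by omega)
  unfold InCl
  omega

theorem short_two_not_mem (B : Blocks w P Q p q b) {n c y x r : ℕ}
    (hn : n + 1 = 2 * P + Q + p) (hc : c + 1 = 2 * P) (hP2 : 2 ≤ P)
    (h1 : b y = 1) (hr : q (y + 1 + 1) = q (y + 1) + P + Q + r) (h : q y + 1 < x) (hx : x + p < q (y + 1) + r) :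
    r ≤ p → ¬ InCl w n c x := by
  intro hrp
  have hP := B.hP
  have hQ := B.hQ
  have y1 := B.next_one h1
  have oy1 := B.ones_next y
  have oy2 := B.ones_next (y + 1)
  have y3 := B.next_ge (y + 1 + 1)
  unfold InCl
  rcases Nat.lt_or_ge x (q y + P) with h5 | h5
  · have f1 := B.ones_run y (x := x) (by omega) (by omega)
    rcases Nat.lt_or_ge (x + n) (q (y + 1 + 1)) with h6 | h6
    · have f2 := B.ones_rest (y + 1) (x := x + n) (by omega) (by omega)
      omega
    · have f2 := B.ones_run (y + 1 + 1) (x := x + n) (by omega) (by omega)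
      omega
  · have f1 := B.ones_rest y (x := x) (by omega) (by omega)
    rcases Nat.lt_or_ge (x + n) (q (y + 1 + 1)) with h6 | h6
    · have f2 := B.ones_rest (y + 1) (x := x + n) (by omega) (by omega)
      omega
    · have f2 := B.ones_run (y + 1 + 1) (x := x + n) (by omega) (by omega)
      omega

/-- Isolated short blocks, `P ≥ 2`. -/
theorem isolated_short_of_two_le (B : Blocks w P Q p q b) (hg : Good w) (hP2 : 2 ≤ P)
    {y z : ℕ} (hy : b y = 1) (hy1 : b (y + 1) = 1)
    (hz : b z = 1) (hz1 : b (z + 1) = 0) : False := by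
  have hp := B.hp
  have hQ := B.hQ
  obtain ⟨n, hn⟩ : ∃ n, n + 1 = 2 * P + Q + p := ⟨2 * P + Q + p - 1, by omega⟩
  obtain ⟨c, hc⟩ : ∃ c, c + 1 = 2 * P := ⟨2 * P - 1, by omega⟩
  have y1 := B.next_one hy
  have y2 := B.next_one hy1
  have z1 := B.next_one hz
  have z2 := B.next_zero hz1
  have hA := B.short_two_start hn hc hy
  have hA1 := B.short_two_start hn hc hy1
  have hz' := B.short_two_start hn hc hz
  have r1 := ret_one hA.1 hA.2
  obtain ⟨m, hm⟩ : ∃ m, m + 1 = P + Q + p := ⟨P + Q + p - 1, by omega⟩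
  obtain ⟨m', hm'⟩ : ∃ m, m + 1 = P + Q := ⟨P + Q - 1, by omega⟩
  have r2 : Ret w n c (q y + 1) m := by
    refine ⟨by omega, hA.2, ?_, fun k h1 h2 => ?_⟩
    · rw [show q y + 1 + m = q (y + 1) by omega]
      exact hA1.1
    · exact B.short_two_not_mem hn hc hP2 hy y2 (by omega) (by omega) le_rfl
  have hC : InCl w n c (q z + 1 + m') := by
    have oz1 := B.ones_next z
    have oz2 := B.ones_next (z + 1)
    have z3 := B.next_ge (z + 1 + 1)
    have f1 := B.ones_rest z (x := q z + 1 + m') (by omega) (by omega)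
    have f2 := B.ones_run (z + 1 + 1) (x := q z + 1 + m' + n) (by omega) (by omega)
    unfold InCl
    omega
  have r3 : Ret w n c (q z + 1) m' := by
    refine ⟨by omega, hz'.2, hC, fun k h1 h2 => ?_⟩
    exact B.short_two_not_mem (r := 0) hn hc hP2 hz (by omega) (by omega) (by omega) (by omega)
  have wz' := B.isZero' z (x := q z + 1 + m') (by omega) (by omega)
  obtain ⟨m4, r4⟩ := exists_ret hg.recur hC
  exact hg.four n _ (by omega) _ _ _ _ _ _ _ _ r1 r2 r3 r4
    (diff_of_length (by omega)) (diff_of_length (by omega))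
    (diff_of_letter r1.1 r4.1 (by
      rw [B.isOne' y (x := q y) (by omega) (by omega), wz']; simp)) (diff_of_length (by omega))
    (diff_of_letter r2.1 r4.1 (by
      rw [B.isOne' y (x := q y + 1) (by omega) (by omega), wz']; simp))
    (diff_of_letter r3.1 r4.1 (by
      rw [B.isOne' z (x := q z + 1) (by omega) (by omega), wz']; simp))

theorem short_one_start (B : Blocks w 1 Q p q b) {n y : ℕ} (hn : n = 2 * Q + p + 4)
    (h : (b y = 1 ∧ b (y + 1) = 0) ∨ (b y = 0 ∧ b (y + 1) = 1)) :
    InCl w n 3 (q y) ∧ ∀ s, s + 1 = q y → InCl w n 3 s ∧ w s = false := by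
  have hQ := B.hQ
  have e1 : q (y + 1 + 1) = q y + 2 + 2 * Q + p := by
    rcases h with ⟨h0, h1⟩ | ⟨h0, h1⟩
    · have := B.next_one h0
      have := B.next_zero h1
      omega
    · have := B.next_zero h0
      have := B.next_one h1
      omega
  have y3 := B.next_ge (y + 1 + 1)
  have oy1 := B.ones_next y
  have oy2 := B.ones_next (y + 1)
  have f2 := B.ones_rest (y + 1 + 1) (x := q y + n) (by omega) (by omega)
  refine ⟨by unfold InCl; omega, fun s hs => ?_⟩
  rcases y with _ | y
  · have := B.zero
    omega
  · have y0 := B.next_ge y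
    have oy0 := B.ones_next y
    have f1 := B.ones_rest y (x := s) (by omega) (by omega)
    have f3 := B.ones_rest (y + 1 + 1 + 1) (x := s + n) (by omega) (by omega)
    exact ⟨by unfold InCl; omega, B.isZero' y (by omega) (by omega)⟩

theorem short_one_not_mem (B : Blocks w 1 Q p q b) {n a e x : ℕ} (hn : n = 2 * Q + p + 4)
    (hp2 : 2 ≤ p) (ha : b (a + 1) = 1) (g : Gap b 0 a e) (h : q a < x)
    (h' : x + 1 < q (a + e)) : ¬ InCl w n 3 x := by
  have hQ := B.hQ
  obtain ⟨c, c1, c2⟩ := B.exists_block x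
  have hae := B.next_ge (a + e)
  obtain ⟨k1, k2⟩ := Gap.block_cases B g h.le (by omega) c1 c2
  replace k2 : c < a + e ∧ b (c + 1) ≠ 0 := by
    rcases k2 with h | rfl
    · exact h
    · omega
  have k3 : b (c + 1) = 1 := by
    have := B.le_one (c + 1)
    omega
  have n2 := B.next_one k3
  have o1 := B.ones_next c
  have o2 := B.ones_next (c + 1)
  have o3 := B.ones_next (c + 1 + 1)
  have n3 : q (c + 1 + 1) + 1 + Q ≤ q (c + 1 + 1 + 1) ∧
      (c + 1 < a + e → q (c + 1 + 1) + 1 + Q + p ≤ q (c + 1 + 1 + 1)) := by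
    refine ⟨B.next_ge _, fun h => ?_⟩
    have h1 := g.2.1 (c + 1 - a) (by omega)
    rw [show a + 1 + (c + 1 - a) = c + 1 + 1 by omega] at h1
    have := B.next (c + 1 + 1)
    omega
  have h2 : c + 1 < a + e ∨ x + 1 < q (c + 1) := by
    rcases Nat.lt_or_ge (c + 1) (a + e) with h | h
    · exact Or.inl h
    · rw [show a + e = c + 1 by omega] at h'
      exact Or.inr h'
  unfold InCl
  rcases Nat.eq_or_lt_of_le c1 with h3 | h3
  · rcases k1 with rfl | ⟨k1, k4⟩
    · omega
    · have := B.next c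
      have f1 := ones_mono (w := w) (i := x + n) (j := q (c + 1 + 1)) (by omega)
      rw [← h3] at f1 ⊢
      omega
  · have f0 := B.ones_rest c (x := x) (by omega) c2.le
    have f1 : x + n ≤ q (c + 1 + 1 + 1) := by
      rcases k1 with rfl | ⟨k1, k4⟩
      · have := B.next_zero g.1
        omega
      · have := B.next c
        omega
    have := ones_mono (w := w) f1
    omega

/-- Isolated short blocks, `P = 1`. -/
theorem isolated_short_of_eq_one (B : Blocks w 1 Q p q b) (hg : Good w) (hp2 : 2 ≤ p)
    (hXX : ∀ a, b a = 0 → b (a + 1) = 1) {z : ℕ} (hz : b z = 1) (hz1 : b (z + 1) = 0)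
    {a e a' e' : ℕ} (g : Gap b 0 a e) (g' : Gap b 0 a' e') (he : 0 < e) (hlt : e < e') :
    False := by
  have hQ := B.hQ
  obtain ⟨n, hn⟩ : ∃ n, n = 2 * Q + p + 4 := ⟨_, rfl⟩
  have key : ∀ a f, Gap b 0 a (f + 1) →
      Ret w n 3 (q a) (Q + f * (1 + Q + p)) ∧ w (q a) = true := by
    intro a f g
    have hl := B.gap_zero_length g
    have lend := g.2.2
    rw [show a + 1 + (f + 1) = a + (f + 1) + 1 by omega] at lend hl
    have hb := g.1
    have a1 := B.next_zero hb
    have a2 := hXX a hb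
    have hlast := Gap.last_zero B g (Nat.succ_pos f)
    have ae := B.next_one hlast
    have hend := (B.short_one_start hn (Or.inl ⟨hlast, lend⟩)).2
      (q a + (Q + f * (1 + Q + p)))
    rw [add_mul] at hl
    refine ⟨⟨by omega, (B.short_one_start hn (Or.inr ⟨hb, a2⟩)).1, (hend (by omega)).1,
      fun k hk hk2 => ?_⟩, B.isOne' a le_rfl (by omega)⟩
    exact B.short_one_not_mem hn hp2 a2 g (by omega) (by omega)
  have z1 := B.next_one hz
  have hzs := B.short_one_start hn (Or.inl ⟨hz, hz1⟩)
  have hzs' := B.short_one_start hn (Or.inr ⟨hz1, hXX _ hz1⟩)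
  have hs := hzs'.2 (q z + (Q + p)) (by omega)
  have r1 : Ret w n 3 (q z + (Q + p)) 1 :=
    ret_one hs.1 (by rw [show q z + (Q + p) + 1 = q (z + 1) by omega]; exact hzs'.1)
  have r2 : Ret w n 3 (q z) (Q + p) := by
    refine ⟨by omega, hzs.1, hs.1, fun k h1 h2 => ?_⟩
    have z2 := B.next_zero hz1
    have z3 := B.next_one (hXX _ hz1)
    have oz1 := B.ones_next z
    have oz2 := B.ones_next (z + 1)
    have oz3 := B.ones_next (z + 1 + 1)
    have f1 := B.ones_rest z (x := q z + k) (by omega) (by omega)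
    have f2 := ones_mono (w := w) (i := q z + k + n) (j := q (z + 1 + 1 + 1)) (by omega)
    unfold InCl
    omega
  have wz := B.isOne' z (x := q z) le_rfl (by omega)
  obtain ⟨f, rfl⟩ : ∃ f, e = f + 1 := ⟨e - 1, by omega⟩
  obtain ⟨f', rfl⟩ : ∃ f', e' = f' + 1 := ⟨e' - 1, by omega⟩
  obtain ⟨r3, w3⟩ := key a f g
  obtain ⟨r4, w4⟩ := key a' f' g'
  have hm2 : f * (1 + Q + p) < f' * (1 + Q + p) :=
    Nat.mul_lt_mul_of_pos_right (by omega) (by omega)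
  have hne : ∀ f, Q + p ≠ Q + f * (1 + Q + p) := by
    intro f
    rcases Nat.eq_zero_or_pos f with rfl | h
    · omega
    · have : 1 + Q + p ≤ f * (1 + Q + p) := Nat.le_mul_of_pos_left _ h
      omega
  exact hg.four n 3 (by omega) _ _ _ _ _ _ _ _ r1 r2 r3 r4
    (diff_of_letter r1.1 r2.1 (by rw [hs.2, wz]; simp))
    (diff_of_letter r1.1 r3.1 (by rw [hs.2, w3]; simp))
    (diff_of_letter r1.1 r4.1 (by rw [hs.2, w4]; simp))
    (diff_of_length (hne f)) (diff_of_length (hne f')) (diff_of_length (by omega))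

/-- Only blocks with `P = p = 1` are compatible with two or three returns. -/
theorem eq_one (B : Blocks w P Q p q b) (hg : Good w) : P = 1 ∧ p = 1 := by
  have hP := B.hP
  have hp := B.hp
  obtain ⟨a, e, a', e', g, g', hlt⟩ := B.two_gaps_one hg
  obtain ⟨c, f, c', f', k, k', hlt'⟩ := B.two_gaps_zero hg
  have hYX : b a' = 1 ∧ b (a' + 1) = 0 := by
    have := g'.2.1 0 (by omega)
    have := B.le_one (a' + 1)
    exact ⟨g'.1, by simp at *; omega⟩
  have hXY : b (a' + e') = 0 ∧ b (a' + e' + 1) = 1 := by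
    have h1 := g'.2.1 (e' - 1) (by omega)
    rw [show a' + 1 + (e' - 1) = a' + e' by omega] at h1
    have := B.le_one (a' + e')
    have h2 := g'.2.2
    rw [show a' + 1 + e' = a' + e' + 1 by omega] at h2
    exact ⟨by omega, h2⟩
  by_contra hne
  by_cases hYY : ∀ a, b a = 1 → b (a + 1) = 0
  · have he : 0 < e := by
      rcases Nat.eq_zero_or_pos e with rfl | h
      · have h1 := hYY a g.1
        have h2 := g.2.2
        simp at h2; omega
      · exact h
    rcases Nat.lt_or_ge 1 p with h | h
    · exact B.isolated_long_of_two_le hg h hYY hXY.1 hXY.2 g g' he hlt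
    · obtain rfl : p = 1 := by omega
      exact B.isolated_long_of_eq_one hg (by omega) hYY hXY.1 hXY.2 g g' he hlt
  · push Not at hYY
    obtain ⟨y, hy, hy1⟩ := hYY
    have hy1 : b (y + 1) = 1 := by have := B.le_one (y + 1); omega
    by_cases hXX : ∀ a, b a = 0 → b (a + 1) = 1
    · have hf : 0 < f := by
        rcases Nat.eq_zero_or_pos f with rfl | h
        · have h1 := hXX c k.1
          have h2 := k.2.2
          simp at h2; omega
        · exact h
      rcases Nat.lt_or_ge 1 P with h | h
      · exact B.isolated_short_of_two_le hg h hy hy1 hYX.1 hYX.2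
      · obtain rfl : P = 1 := by omega
        exact B.isolated_short_of_eq_one hg (by omega) hXX hYX.1 hYX.2 k k' hf hlt'
    · push Not at hXX
      obtain ⟨x, hx, hx1⟩ := hXX
      have hx1 : b (x + 1) = 0 := by have := B.le_one (x + 1); omega
      exact B.not_both_repeat hg hx hx1 hy hy1 hXY.1 hXY.2

end Blocks

theorem inCl_two_iff {i : ℕ} : InCl w 2 1 i ↔ w i ≠ w (i + 1) := by
  unfold InCl
  rw [show i + 2 = i + 1 + 1 from rfl, ones_succ, ones_succ]
  cases w i <;> cases w (i + 1) <;> simp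

/-- The returns to the class of `01` are described by runs of letters. -/
theorem ret_two_run {i m : ℕ} (h : Ret w 2 1 i m) :
    w i ≠ w (i + 1) ∧ (∀ k, 1 ≤ k → k ≤ m → w (i + k) = w (i + 1)) ∧
      w (i + m + 1) ≠ w (i + 1) := by
  have h1 : ∀ k, 1 ≤ k → k ≤ m → w (i + k) = w (i + 1) := by
    intro k hk
    induction k, hk using Nat.le_induction with
    | base => simp
    | succ k hk ih =>
      intro hm
      rw [← ih (by omega)]
      have := h.2.2.2 k (by omega) (by omega)
      rw [inCl_two_iff, not_not] at this
      exact this.symm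
  refine ⟨inCl_two_iff.1 h.2.1, h1, ?_⟩
  have := inCl_two_iff.1 h.2.2.1
  rw [h1 m h.1 le_rfl] at this
  exact this.symm

theorem exists_change (hr : Rec w) {i j : ℕ} (h : w i ≠ w j) (t : Bool) :
    ∃ k, w k ≠ t ∧ w (k + 1) = t := by
  have key : ∀ i d, w i ≠ t → w (i + d) = t → ∃ k, w k ≠ t ∧ w (k + 1) = t := by
    intro i d hi
    induction d with
    | zero => exact fun h => absurd h hi
    | succ d ih =>
      intro h
      by_cases hd : w (i + d) = t
      · exact ih hd
      · exact ⟨i + d, hd, h⟩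
  have key' : ∀ i j, w i ≠ t → w j = t → ∃ k, w k ≠ t ∧ w (k + 1) = t := by
    intro i j hi hj
    obtain ⟨j', h1, h2⟩ := hr j 1 i
    refine key i (j' - i) hi ?_
    rw [show i + (j' - i) = j' by omega]
    have := h2 0 one_pos
    simp only [add_zero] at this
    rw [this, hj]
  by_cases hi : w i = t
  · exact key' j i (fun hj => h (hi.trans hj.symm)) hi
  · refine key' i j hi ?_
    revert h hi
    cases w i <;> cases w j <;> cases t <;> simp

/-- All runs of the letter `t` have the same length. -/
def ConstRun (w : ℕ → Bool) (t : Bool) : Prop :=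
  ∀ i m i' m', Ret w 2 1 i m → Ret w 2 1 i' m' → w (i + 1) = t → w (i' + 1) = t → m = m'

theorem diff_of_run {i m i' m' : ℕ} (h : Ret w 2 1 i m) (h' : Ret w 2 1 i' m')
    (hw : w (i + 1) ≠ w (i' + 1)) : Diff w i m i' m' := by
  refine diff_of_letter h.1 h'.1 ?_
  have h1 := (ret_two_run h).1
  have h2 := (ret_two_run h').1
  revert hw h1 h2
  cases w i <;> cases w i' <;> cases w (i + 1) <;> cases w (i' + 1) <;> simp

theorem Good.constRun (hg : Good w) : ConstRun w true ∨ ConstRun w false := by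
  by_contra h
  push Not at h
  unfold ConstRun at h
  push Not at h
  obtain ⟨⟨i₁, m₁, i₂, m₂, r1, r2, t1, t2, n1⟩, i₃, m₃, i₄, m₄, r3, r4, t3, t4, n2⟩ := h
  exact hg.four 2 1 two_pos _ _ _ _ _ _ _ _ r1 r2 r3 r4 (diff_of_length n1)
    (diff_of_run r1 r3 (by simp [t1, t3])) (diff_of_run r1 r4 (by simp [t1, t4]))
    (diff_of_run r2 r3 (by simp [t2, t3])) (diff_of_run r2 r4 (by simp [t2, t4]))
    (diff_of_length n2)

theorem exists_run (hr : Rec w) {t : Bool} {i j : ℕ} (h : w i ≠ w j) :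
    ∃ k m, Ret w 2 1 k m ∧ w (k + 1) = t := by
  obtain ⟨k, h1, h2⟩ := exists_change hr h t
  obtain ⟨m, hm⟩ := exists_ret hr (n := 2) (c := 1) (i := k) (inCl_two_iff.2 (by rwa [h2]))
  exact ⟨k, m, hm, h2⟩

theorem Good.two_run_lengths (hg : Good w) {i j : ℕ} (hne : w i ≠ w j) :
    ∃ Q p, 0 < Q ∧ 0 < p ∧ ∀ k m, Ret w 2 1 k m → w (k + 1) = false → m = Q ∨ m = Q + p := by
  classical
  obtain ⟨k₀, P, rP, tP⟩ := exists_run hg.recur (t := true) hne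
  have hex : ∃ Q, ∃ k, Ret w 2 1 k Q ∧ w (k + 1) = false := by
    obtain ⟨k, m, h1, h2⟩ := exists_run hg.recur (t := false) hne
    exact ⟨m, k, h1, h2⟩
  obtain ⟨k₁, r1, t1⟩ := Nat.find_spec hex
  have hmin : ∀ k m, Ret w 2 1 k m → w (k + 1) = false → Nat.find hex ≤ m :=
    fun k m h1 h2 => Nat.find_min' hex ⟨k, h1, h2⟩
  generalize Nat.find hex = Q at r1 hmin
  by_cases hall : ∀ k m, Ret w 2 1 k m → w (k + 1) = false → m = Q
  · exact ⟨Q, 1, r1.1, one_pos, fun k m h1 h2 => Or.inl (hall k m h1 h2)⟩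
  · push Not at hall
    obtain ⟨k₂, m₂, r2, t2, hm2⟩ := hall
    have := hmin k₂ m₂ r2 t2
    refine ⟨Q, m₂ - Q, r1.1, by omega, fun k m r3 t3 => ?_⟩
    by_contra hm
    push Not at hm
    exact hg.four 2 1 two_pos _ _ _ _ _ _ _ _ rP r1 r2 r3
      (diff_of_run rP r1 (by simp [tP, t1])) (diff_of_run rP r2 (by simp [tP, t2]))
      (diff_of_run rP r3 (by simp [tP, t3])) (diff_of_length (by omega))
      (diff_of_length (by omega)) (diff_of_length (by omega))

/-- The words with constant length of runs of the letter `true` are made of blocks. -/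
theorem Good.exists_blocks (hg : Good w) (hT : ConstRun w true) {i j : ℕ} (hne : w i ≠ w j) :
    ∃ s P Q p q b, Blocks (fun k => w (s + k)) P Q p q b := by
  obtain ⟨k₀, P, rP, tP⟩ := exists_run hg.recur (t := true) hne
  obtain ⟨Q, p, hQ, hp, hl⟩ := hg.two_run_lengths hne
  have step : ∀ x : {x : ℕ // w x = false ∧ w (x + 1) = true}, ∃ l, (l = Q ∨ l = Q + p) ∧
      (∀ k, 1 ≤ k → k ≤ P → w (x + k) = true) ∧
      (∀ k, 1 ≤ k → k ≤ l → w (x + P + k) = false) ∧ w (x + P + l + 1) = true := by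
    rintro ⟨x, h0, h1⟩
    obtain ⟨m, hm⟩ := exists_ret hg.recur (n := 2) (c := 1) (i := x)
      (inCl_two_iff.2 (by rw [h0, h1]; simp))
    obtain rfl := hT _ _ _ _ hm rP h1 tP
    obtain ⟨-, h2, h3⟩ := ret_two_run hm
    rw [h1] at h2 h3
    obtain ⟨l, h4⟩ := exists_ret hg.recur hm.2.2.1
    obtain ⟨-, h5, h6⟩ := ret_two_run h4
    have h3' : w (x + m + 1) = false := by simpa using h3
    rw [h3'] at h5 h6
    exact ⟨l, hl _ _ h4 h3', h2, h5, by simpa using h6⟩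
  choose l hl1 hl2 hl3 hl4 using step
  obtain ⟨x₀, hx0, hx1⟩ := exists_change hg.recur hne true
  let nx : {x : ℕ // w x = false ∧ w (x + 1) = true} →
      {x : ℕ // w x = false ∧ w (x + 1) = true} := fun x => ⟨x + P + l x, by
    have := hl3 x (l x) (by have := hl1 x; omega) le_rfl
    exact this, hl4 x⟩
  let X : ℕ → {x : ℕ // w x = false ∧ w (x + 1) = true} :=
    fun a => nx^[a] ⟨x₀, by simpa using hx0, hx1⟩
  have hX : ∀ a, (X (a + 1) : ℕ) = X a + P + l (X a) := by
    intro a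
    simp only [X, Function.iterate_succ_apply', nx]
  have hX0 : (X 0 : ℕ) = x₀ := rfl
  have hle : ∀ a, x₀ ≤ X a := by
    intro a
    induction a with
    | zero => exact le_rfl
    | succ a ih => have := hX a; omega
  refine ⟨x₀ + 1, P, Q, p, fun a => X a - x₀, fun a => if l (X a) = Q then 0 else 1,
    rP.1, hQ, hp, ?_, ?_, ?_, ?_⟩
  · simp [hX0]
  · intro a
    have h1 := hX a
    have h2 := hl1 (X a)
    have h3 := hle a
    by_cases h : l (X a) = Q
    · left
      simp only [h, if_true, true_and]
      omega
    · right
      simp only [h, if_false, true_and]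
      omega
  · intro a s hs
    have := hl2 (X a) (s + 1) (by omega) (by omega)
    have h3 := hle a
    exact (congrArg w (by omega)).trans this
  · intro a s hs hs'
    have h1 := hX a
    have h3 := hle a
    have h4 := hle (a + 1)
    have := hl3 (X a) (s - P + 1) (by omega) (by omega)
    exact (congrArg w (by omega)).trans this

theorem bal_of_shift (hr : Rec w) {s : ℕ} (h : Bal fun k => w (s + k)) : Bal w := by
  intro n i j
  obtain ⟨i', hi, ei⟩ := hr i n s
  obtain ⟨j', hj, ej⟩ := hr j n s
  have h1 := h n (i' - s) (j' - s)
  have e1 := ones_shift w s (j' - s + n)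
  have e2 := ones_shift w s (i' - s)
  have e3 := ones_shift w s (i' - s + n)
  have e4 := ones_shift w s (j' - s)
  rw [show s + (j' - s + n) = j' + n by omega] at e1
  rw [show s + (i' - s + n) = i' + n by omega] at e3
  rw [show s + (i' - s) = i' by omega] at e2
  rw [show s + (j' - s) = j' by omega] at e4
  have := ones_congr ei
  have := ones_congr ej
  omega

theorem Blocks.bal {q b : ℕ → ℕ} {Q : ℕ} (B : Blocks w 1 Q 1 q b) (hg : Good w) : Bal w := by
  have hQ := B.hQ
  have hpos : ∀ i, w i = true → ∃ a, i = q a := by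
    intro i hi
    obtain ⟨a, h1, h2⟩ := B.exists_block i
    refine ⟨a, ?_⟩
    by_contra h
    rw [B.isZero' a (x := i) (by omega) h2] at hi
    simp at hi
  have hone : ∀ a, w (q a) = true := fun a => B.isOne' a le_rfl (by omega)
  refine bal_of_isolated hg ?_ ?_
  · intro i hi hi1
    obtain ⟨a, rfl⟩ := hpos i hi
    have := B.next_ge a
    rw [B.isZero' a (x := q a + 1) (by omega) (by omega)] at hi1
    simp at hi1
  · intro N i j h0 hj hj0 hj1
    obtain ⟨a, rfl⟩ := hpos j hj
    have h1 := B.next a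
    have hN : Q ≤ N := by
      by_contra hlt
      rw [B.isZero' a (x := q a + (N + 1)) (by omega) (by omega)] at hj1
      simp at hj1
    obtain ⟨c, c1, c2⟩ := B.exists_block i
    have h2 := B.next c
    have h3 : i ≠ q c := by
      rintro rfl
      have := h0 0 (by omega)
      rw [add_zero, hone] at this
      simp at this
    have h4 := h0 (q (c + 1) - i) (by omega)
    rw [show i + (q (c + 1) - i) = q (c + 1) by omega, hone] at h4
    simp at h4

theorem bal_of_constRun (hg : Good w) (hT : ConstRun w true) {i j : ℕ} (hne : w i ≠ w j) :
    Bal w := by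
  obtain ⟨s, P, Q, p, q, b, B⟩ := hg.exists_blocks hT hne
  obtain ⟨rfl, rfl⟩ := B.eq_one (hg.shift s)
  exact bal_of_shift hg.recur (B.bal (hg.shift s))

theorem Good.bal (hg : Good w) : Bal w := by
  by_cases hc : ∀ i j, w i = w j
  · intro n i j
    have := ones_congr (w := w) (v := w) (i := i) (j := j) (n := n) fun k _ => hc _ _
    omega
  · push Not at hc
    obtain ⟨i, j, hne⟩ := hc
    rcases hg.constRun with h | h
    · exact bal_of_constRun hg h hne
    · refine bal_not (bal_of_constRun hg.not ?_ (i := i) (j := j) (by simpa using hne))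
      intro i m i' m' r r' t t'
      rw [ret_not (by omega)] at r r'
      exact h i m i' m' r r' (by simpa using t) (by simpa using t')

theorem wordAt_length (w : ℕ → Bool) (i n : ℕ) : (wordAt w i n).length = n := by
  simp [wordAt]

theorem wordAt_succ (w : ℕ → Bool) (i n : ℕ) :
    wordAt w i (n + 1) = wordAt w i n ++ [w (i + n)] := by
  simp [wordAt, List.range_succ]

theorem wordAt_eq_iff {i j n : ℕ} :
    wordAt w i n = wordAt w j n ↔ ∀ k < n, w (i + k) = w (j + k) := by
  simp [wordAt]

theorem factor_iff {n : ℕ} {u : List Bool} :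
    (u.length = n ∧ IsFactorW w u) ↔ ∃ i, u = wordAt w i n := by
  constructor
  · rintro ⟨rfl, i, h⟩
    exact ⟨i, h⟩
  · rintro ⟨i, rfl⟩
    rw [IsFactorW, wordAt_length]
    exact ⟨rfl, i, rfl⟩

/-- The factor of length `n` at `i` is right special. -/
def Spec (w : ℕ → Bool) (n i : ℕ) : Prop :=
  ∃ j, (∀ k < n, w (j + k) = w (i + k)) ∧ w (j + n) ≠ w (i + n)

theorem complexity_zero : complexityW w 0 = 1 := by
  have : {u : List Bool | u.length = 0 ∧ IsFactorW w u} = {[]} := by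
    ext u
    rw [Set.mem_ofPred_eq, factor_iff]
    simp [wordAt]
  rw [complexityW, this, Set.ncard_singleton]

theorem complexity_succ (n : ℕ) : complexityW w (n + 1) =
    complexityW w n + {u | ∃ i, u = wordAt w i n ∧ Spec w n i}.ncard := by
  let A : Bool → Set (List Bool) := fun b => {u | ∃ i, u = wordAt w i n ∧ w (i + n) = b}
  have hfin : ∀ b, (A b).Finite := fun b =>
    (List.finite_length_eq Bool n).subset (by
      rintro u ⟨i, rfl, -⟩
      exact wordAt_length w i n)
  have h1 : {u : List Bool | u.length = n + 1 ∧ IsFactorW w u} =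
      (fun u => u ++ [false]) '' A false ∪ (fun u => u ++ [true]) '' A true := by
    ext u
    rw [Set.mem_ofPred_eq, factor_iff]
    constructor
    · rintro ⟨i, rfl⟩
      rw [wordAt_succ]
      cases h : w (i + n)
      · exact Or.inl ⟨_, ⟨i, rfl, h⟩, rfl⟩
      · exact Or.inr ⟨_, ⟨i, rfl, h⟩, rfl⟩
    · rintro (⟨_, ⟨i, rfl, h⟩, rfl⟩ | ⟨_, ⟨i, rfl, h⟩, rfl⟩) <;>
        exact ⟨i, by rw [wordAt_succ, h]⟩
  have h2 : {u : List Bool | u.length = n ∧ IsFactorW w u} = A false ∪ A true := by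
    ext u
    rw [Set.mem_ofPred_eq, factor_iff]
    constructor
    · rintro ⟨i, rfl⟩
      cases h : w (i + n)
      · exact Or.inl ⟨i, rfl, h⟩
      · exact Or.inr ⟨i, rfl, h⟩
    · rintro (⟨i, rfl, -⟩ | ⟨i, rfl, -⟩) <;> exact ⟨i, rfl⟩
  have h3 : {u | ∃ i, u = wordAt w i n ∧ Spec w n i} = A false ∩ A true := by
    ext u
    constructor
    · rintro ⟨i, rfl, j, hj, hn⟩
      have e := (wordAt_eq_iff.2 hj).symm
      cases h : w (i + n)
      · exact ⟨⟨i, rfl, h⟩, j, e, by simpa [h] using hn⟩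
      · exact ⟨⟨j, e, by simpa [h] using hn⟩, i, rfl, h⟩
    · rintro ⟨⟨i, rfl, hi⟩, j, e, hj⟩
      exact ⟨i, rfl, j, fun k hk => (wordAt_eq_iff.1 e k hk).symm, by simp [hi, hj]⟩
  have inj : ∀ b : Bool, Function.Injective fun u : List Bool => u ++ [b] :=
    fun b u v h => by simpa using h
  rw [complexityW, complexityW, h1, h2, h3, Set.ncard_union_add_ncard_inter _ _ (hfin _) (hfin _),
    Set.ncard_union_eq _ ((hfin _).image _) ((hfin _).image _),
    Set.ncard_image_of_injective _ (inj _), Set.ncard_image_of_injective _ (inj _)]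
  rw [Set.disjoint_left]
  rintro _ ⟨u, -, rfl⟩ ⟨v, -, h⟩
  simpa using congrArg List.getLast? h

theorem complexity_iff : (∀ n, complexityW w n = n + 1) ↔ ∀ n, (∃ i, Spec w n i) ∧
    ∀ i j, Spec w n i → Spec w n j → ∀ k < n, w (i + k) = w (j + k) := by
  have key : ∀ n, {u | ∃ i, u = wordAt w i n ∧ Spec w n i}.ncard = 1 ↔ (∃ i, Spec w n i) ∧
      ∀ i j, Spec w n i → Spec w n j → ∀ k < n, w (i + k) = w (j + k) := by
    intro n
    rw [Set.ncard_eq_one]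
    constructor
    · rintro ⟨u, hu⟩
      constructor
      · obtain ⟨i, -, h⟩ : u ∈ {u | ∃ i, u = wordAt w i n ∧ Spec w n i} := by rw [hu]; rfl
        exact ⟨i, h⟩
      · intro i j hi hj
        have h1 : wordAt w i n ∈ {u | ∃ i, u = wordAt w i n ∧ Spec w n i} := ⟨i, rfl, hi⟩
        have h2 : wordAt w j n ∈ {u | ∃ i, u = wordAt w i n ∧ Spec w n i} := ⟨j, rfl, hj⟩
        rw [hu, Set.mem_singleton_iff] at h1 h2
        exact wordAt_eq_iff.1 (h1.trans h2.symm)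
    · rintro ⟨⟨i, hi⟩, h⟩
      refine ⟨wordAt w i n, Set.eq_singleton_iff_unique_mem.2 ⟨⟨i, rfl, hi⟩, ?_⟩⟩
      rintro _ ⟨j, rfl, hj⟩
      exact wordAt_eq_iff.2 (h j i hj hi)
  constructor
  · intro h n
    rw [← key]
    have h1 := complexity_succ (w := w) n
    rw [h, h] at h1
    omega
  · intro h n
    induction n with
    | zero => exact complexity_zero
    | succ n ih => rw [complexity_succ, ih, (key n).2 (h n)]

theorem ultPeriodic_of_eq {i j : ℕ} (hij : i ≠ j) (h : ∀ k, w (i + k) = w (j + k)) :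
    UltPeriodicW w := by
  rcases Nat.lt_or_gt_of_ne hij with hlt | hlt
  · refine ⟨j - i, by omega, i, fun n hn => ?_⟩
    have := h (n - i)
    rw [show i + (n - i) = n by omega, show j + (n - i) = n + (j - i) by omega] at this
    exact this.symm
  · refine ⟨i - j, by omega, j, fun n hn => ?_⟩
    have := h (n - j)
    rwa [show j + (n - j) = n by omega, show i + (n - j) = n + (i - j) by omega] at this

theorem exists_spec (hnp : ¬ UltPeriodicW w) (n : ℕ) : ∃ i, Spec w n i := by
  by_contra hno
  apply hnp
  obtain ⟨i, j, hij, h⟩ := Finite.exists_ne_map_eq_of_infinite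
    fun (i : ℕ) (k : Fin n) => w (i + k)
  refine ultPeriodic_of_eq hij fun k => ?_
  induction k using Nat.strong_induction_on with
  | _ k ih =>
    rcases Nat.lt_or_ge k n with hk | hk
    · exact congrFun h ⟨k, hk⟩
    · by_contra hne
      refine hno ⟨j + (k - n), i + (k - n), fun l hl => ?_, ?_⟩
      · have := ih (k - n + l) (by omega)
        rwa [← add_assoc, ← add_assoc] at this
      · rwa [add_assoc, add_assoc, Nat.sub_add_cancel hk]

theorem Bal.absurd_of_ends (hb : Bal w) {i j d : ℕ}
    (h : ∀ k < d, w (i + 1 + k) = w (j + 1 + k)) (hi : w i = false) (hj : w j = true)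
    (hi' : w (i + 1 + d) = false) (hj' : w (j + 1 + d) = true) : False := by
  have h1 := hb (d + 2) i j
  have h2 := ones_congr h
  have h3 := ones_succ_false hi
  have h4 := ones_succ_true hj
  have h5 := ones_succ_false hi'
  have h6 := ones_succ_true hj'
  rw [show i + (d + 2) = i + 1 + d + 1 by omega, show j + (d + 2) = j + 1 + d + 1 by omega] at h1
  omega

theorem Spec.exists_next {n i : ℕ} (h : Spec w n i) (b : Bool) :
    ∃ j, (∀ k < n, w (j + k) = w (i + k)) ∧ w (j + n) = b := by
  obtain ⟨j, h1, h2⟩ := h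
  by_cases hb : w (i + n) = b
  · exact ⟨i, fun _ _ => rfl, hb⟩
  · refine ⟨j, h1, ?_⟩
    revert hb h2
    cases w (i + n) <;> cases w (j + n) <;> cases b <;> simp

/-- In a balanced word, there is at most one right special factor of each length. -/
theorem Bal.spec_unique (hb : Bal w) {n i j : ℕ} (hi : Spec w n i) (hj : Spec w n j) :
    ∀ k < n, w (i + k) = w (j + k) := by
  have key : ∀ d ≤ n, ∀ k, n - d ≤ k → k < n → w (i + k) = w (j + k) := by
    intro d
    induction d with
    | zero => intro _ k h1 h2; omega
    | succ d ih =>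
      intro hd k h1 h2
      have ih := ih (by omega)
      by_cases hk : n - d ≤ k
      · exact ih k hk h2
      · by_contra hne
        obtain ⟨i', ei, hi'⟩ := hi.exists_next (w (i + k))
        obtain ⟨j', ej, hj'⟩ := hj.exists_next (w (j + k))
        rw [← ei k h2] at hne hi'
        rw [← ej k h2] at hne hj'
        have hmid : ∀ l < d, w (i' + k + 1 + l) = w (j' + k + 1 + l) := by
          intro l hl
          rw [show i' + k + 1 + l = i' + (k + 1 + l) by omega,
            show j' + k + 1 + l = j' + (k + 1 + l) by omega, ei _ (by omega), ej _ (by omega)]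
          exact ih _ (by omega) (by omega)
        rw [show i' + n = i' + k + 1 + d by omega] at hi'
        rw [show j' + n = j' + k + 1 + d by omega] at hj'
        cases ha : w (i' + k)
        · have hc : w (j' + k) = true := by simpa [ha] using hne
          exact hb.absurd_of_ends hmid ha hc (hi'.trans ha) (hj'.trans hc)
        · have hc : w (j' + k) = false := by simpa [ha] using hne
          exact hb.absurd_of_ends (fun l hl => (hmid l hl).symm) hc ha (hj'.trans hc)
            (hi'.trans ha)
  exact fun k hk => key n le_rfl k (by omega) hk

theorem Bal.complexity (hb : Bal w) (hnp : ¬ UltPeriodicW w) (n : ℕ) :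
    complexityW w n = n + 1 :=
  complexity_iff.2 (fun n => ⟨exists_spec hnp n, fun _ _ hi hj => hb.spec_unique hi hj⟩) n

theorem Rec.periodic (hr : Rec w) (h : UltPeriodicW w) : ∃ T, 0 < T ∧ ∀ i, w (i + T) = w i := by
  obtain ⟨T, hT, n₀, h⟩ := h
  refine ⟨T, hT, fun i => ?_⟩
  obtain ⟨j, hj, e⟩ := hr i (T + 1) n₀
  have e0 := e 0 (by omega)
  rw [← e T (by omega), h j hj]
  simpa using e0

theorem periodic_mul {T : ℕ} (h : ∀ i, w (i + T) = w i) (i m : ℕ) : w (i + T * m) = w i := by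
  induction m with
  | zero => simp
  | succ m ih => rw [mul_add, mul_one, ← add_assoc, h, ih]

theorem ones_period {T : ℕ} (h : ∀ i, w (i + T) = w i) (i : ℕ) :
    ones w (i + T) = ones w i + ones w T := by
  induction i with
  | zero => simp [ones]
  | succ i ih =>
    rw [show i + 1 + T = i + T + 1 by omega, ones_succ, ones_succ, h, ih]
    omega

theorem sum_ones_period {T : ℕ} (h : ∀ i, w (i + T) = w i) (n : ℕ) :
    ∑ i ∈ Finset.range T, ones w (i + n) = ∑ i ∈ Finset.range T, ones w i + n * ones w T := by
  induction n with
  | zero => simp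
  | succ n ih =>
    have h1 : ∀ m, ∑ i ∈ Finset.range m, ones w (i + (n + 1)) + ones w n =
        ∑ i ∈ Finset.range m, ones w (i + n) + ones w (m + n) := by
      intro m
      induction m with
      | zero => simp
      | succ m ih =>
        rw [Finset.sum_range_succ, Finset.sum_range_succ,
          show m + 1 + n = m + (n + 1) by omega]
        omega
    have h2 := h1 T
    have h3 := ones_period h n
    rw [add_comm n T] at h3
    rw [add_mul, one_mul]
    omega

/-- The heavy windows of length `n` of a periodic balanced word. -/
theorem Bal.exists_heavy (hb : Bal w) {T : ℕ} (hT : 0 < T) (h : ∀ i, w (i + T) = w i) (n : ℕ) :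
    ∃ c, (∀ i, InCl w n c i ∨ InCl w n (c + 1) i) ∧
      ((Finset.range T).filter fun i => ones w (i + n) = ones w i + (c + 1)).card =
        n * ones w T % T := by
  classical
  have hex : ∃ c, ∃ i, InCl w n c i :=
    ⟨ones w n, 0, by simp [InCl, ones]⟩
  obtain ⟨i₀, hi₀⟩ := Nat.find_spec hex
  have hmin : ∀ c i, InCl w n c i → Nat.find hex ≤ c := fun c i hi => Nat.find_min' hex ⟨i, hi⟩
  generalize Nat.find hex = c at hi₀ hmin
  have hall : ∀ i, InCl w n c i ∨ InCl w n (c + 1) i := by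
    intro i
    have h1 := hb n i₀ i
    have h2 := (ones_add_bounds w i n).1
    have h3 := hmin (ones w (i + n) - ones w i) i (by unfold InCl; omega)
    unfold InCl at *
    omega
  have hi₁ : InCl w n c (i₀ % T) := by
    refine inCl_congr (fun k _ => ?_) hi₀
    have := periodic_mul h (i₀ % T + k) (i₀ / T)
    rw [← this]
    congr 1
    have := Nat.mod_add_div i₀ T
    omega
  refine ⟨c, hall, ?_⟩
  have hsum := sum_ones_period h n
  have h1 : ∑ i ∈ Finset.range T, ones w (i + n) = ∑ i ∈ Finset.range T, (ones w i + c +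
      if ones w (i + n) = ones w i + (c + 1) then 1 else 0) := by
    refine Finset.sum_congr rfl fun i _ => ?_
    have := hall i
    unfold InCl at this
    split_ifs <;> omega
  rw [Finset.sum_add_distrib, Finset.sum_add_distrib, ← Finset.card_filter, Finset.sum_const,
    Finset.card_range, smul_eq_mul] at h1
  have hlt : ((Finset.range T).filter
      fun i => ones w (i + n) = ones w i + (c + 1)).card < T := by
    conv_rhs => rw [← Finset.card_range T]
    refine Finset.card_lt_card (Finset.filter_ssubset.2 ⟨i₀ % T, ?_, ?_⟩)
    · exact Finset.mem_range.2 (Nat.mod_lt _ hT)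
    · unfold InCl at hi₁
      omega
  have : n * ones w T = ((Finset.range T).filter
      fun i => ones w (i + n) = ones w i + (c + 1)).card + T * c := by omega
  rw [this, Nat.add_mul_mod_self_left, Nat.mod_eq_of_lt hlt]

theorem Good.not_ultPeriodic (hg : Good w) : ¬ UltPeriodicW w := by
  classical
  intro hup
  have hb := hg.bal
  have hex := hg.recur.periodic hup
  obtain ⟨hT, h⟩ := Nat.find_spec hex
  have hmin : ∀ T, 0 < T → (∀ i, w (i + T) = w i) → Nat.find hex ≤ T :=
    fun T h1 h2 => Nat.find_min' hex ⟨h1, h2⟩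
  generalize Nat.find hex = T at hT h hmin
  have hcop : Nat.Coprime (ones w T) T := by
    have hd : 0 < Nat.gcd (ones w T) T := Nat.gcd_pos_of_pos_right _ hT
    obtain ⟨p', hp'⟩ := Nat.gcd_dvd_left (ones w T) T
    obtain ⟨T', hT'⟩ := Nat.gcd_dvd_right (ones w T) T
    generalize hdd : Nat.gcd (ones w T) T = d at *
    have hT'0 : 0 < T' := Nat.pos_of_ne_zero (by rintro rfl; omega)
    obtain ⟨c, h1, h2⟩ := hb.exists_heavy hT h T'
    have h3 : T' * ones w T % T = 0 := by
      rw [hp']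
      refine Nat.mod_eq_zero_of_dvd ⟨p', ?_⟩
      rw [← mul_assoc, mul_comm T' d, ← hT']
    rw [h3, Finset.card_eq_zero, Finset.filter_eq_empty_iff] at h2
    have h4 : ∀ i, InCl w T' c i := by
      intro i
      refine (h1 i).resolve_right fun hi => ?_
      refine h2 (x := i % T) (Finset.mem_range.2 (Nat.mod_lt _ hT)) ?_
      refine inCl_congr (w := w) (n := T') (c := c + 1) (i := i) (fun k _ => ?_) hi
      have := periodic_mul h (i % T + k) (i / T)
      rw [← this]
      congr 1
      have := Nat.mod_add_div i T
      omega
    have h5 : ∀ i, w (i + T') = w i := by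
      intro i
      have e1 := h4 i
      have e2 := h4 (i + 1)
      unfold InCl at e1 e2
      rw [show i + 1 + T' = i + T' + 1 by omega] at e2
      rcases ones_step w i with ⟨a1, a2⟩ | ⟨a1, a2⟩ <;>
        rcases ones_step w (i + T') with ⟨b1, b2⟩ | ⟨b1, b2⟩ <;>
        first
        | (exfalso; omega)
        | rw [a1, b1]
    have h6 := hmin T' hT'0 h5
    have : d = 1 := by
      by_contra hne
      have : 2 * T' ≤ d * T' := Nat.mul_le_mul_right _ (by omega)
      omega
    rw [Nat.Coprime, hdd, this]
  have hres : ∃ n c i₀, 0 < n ∧ InCl w n c i₀ ∧ ∀ i, InCl w n c i → i % T = i₀ % T := by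
    rcases Nat.lt_or_ge 1 T with hT1 | hT1
    · obtain ⟨n, -, hn⟩ := Nat.exists_mul_mod_eq_one_of_coprime hcop hT1
      obtain ⟨c, h1, h2⟩ := hb.exists_heavy hT h n
      rw [mul_comm] at hn
      rw [hn, Finset.card_eq_one] at h2
      obtain ⟨i₀, h2⟩ := h2
      have hmem : ∀ i, i ∈ (Finset.range T).filter
          (fun i => ones w (i + n) = ones w i + (c + 1)) ↔ i = i₀ := by
        intro i
        rw [h2, Finset.mem_singleton]
      have h3 := Finset.mem_filter.1 ((hmem i₀).2 rfl)
      refine ⟨n, c + 1, i₀, Nat.pos_of_ne_zero (by rintro rfl; simp at hn), h3.2, fun i hi => ?_⟩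
      rw [Nat.mod_eq_of_lt (Finset.mem_range.1 h3.1)]
      refine (hmem _).1 (Finset.mem_filter.2 ⟨Finset.mem_range.2 (Nat.mod_lt _ hT), ?_⟩)
      refine inCl_congr (w := w) (n := n) (c := c + 1) (i := i) (fun k _ => ?_) hi
      have := periodic_mul h (i % T + k) (i / T)
      rw [← this]
      congr 1
      have := Nat.mod_add_div i T
      omega
    · obtain rfl : T = 1 := by omega
      exact ⟨1, ones w 1, 0, one_pos, by simp [InCl, ones], fun i _ => by omega⟩
  obtain ⟨n, c, i₀, hn, hi₀, hcl⟩ := hres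
  obtain ⟨i₁, m₁, i₂, m₂, r1, r2, hd⟩ := hg.two n c i₀ hn hi₀
  have hm : ∀ i m, Ret w n c i m → m = T := by
    intro i m r
    have h1 := hcl _ r.2.1
    have h2 := hcl _ r.2.2.1
    have h3 : T ∣ m := by
      have := (Nat.modEq_iff_dvd' (Nat.le_add_right i m)).1 (h1.trans h2.symm)
      rwa [Nat.add_sub_cancel_left] at this
    refine le_antisymm (r.le hT ?_) (Nat.le_of_dvd r.1 h3)
    refine inCl_congr (fun k _ => ?_) r.2.1
    rw [show i + T + k = i + k + T by omega, h]
  rcases hd with hd | ⟨k, -, -, hk⟩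
  · exact hd ((hm _ _ r1).trans (hm _ _ r2).symm)
  · apply hk
    have h1 := hcl _ r1.2.1
    have h2 := hcl _ r2.2.1
    have e1 := Nat.mod_add_div i₁ T
    have e2 := Nat.mod_add_div i₂ T
    have p1 := periodic_mul h (i₁ % T + k) (i₁ / T)
    have p2 := periodic_mul h (i₂ % T + k) (i₂ / T)
    rw [show i₁ % T + k + T * (i₁ / T) = i₁ + k by omega] at p1
    rw [show i₂ % T + k + T * (i₂ / T) = i₂ + k by omega] at p2
    rw [p1, p2, h1, h2]

theorem Good.sturmian (hg : Good w) : SturmianW w :=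
  ⟨hg.not_ultPeriodic, hg.bal.complexity hg.not_ultPeriodic⟩

theorem ultPeriodic_of_no_spec {x d n : ℕ} (hd : 0 < d)
    (hx : ∀ k < n, w (x + d + k) = w (x + k)) (hs : ∀ t ≤ d, ¬ Spec w n (x + t)) :
    UltPeriodicW w := by
  have key : ∀ y, (∀ k < n, w (x + y + d + k) = w (x + y + k)) ∧
      ∀ t ≤ d, ¬ Spec w n (x + y + t) := by
    intro y
    induction y with
    | zero => exact ⟨hx, hs⟩
    | succ y ih =>
      obtain ⟨h1, h2⟩ := ih
      have h3 : w (x + y + d + n) = w (x + y + n) := by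
        by_contra hne
        exact h2 0 (by omega) ⟨x + y + d, h1, hne⟩
      have h4 : ∀ k < n, w (x + (y + 1) + d + k) = w (x + (y + 1) + k) := by
        intro k hk
        rw [show x + (y + 1) + d + k = x + y + d + (k + 1) by omega,
          show x + (y + 1) + k = x + y + (k + 1) by omega]
        rcases Nat.lt_or_ge (k + 1) n with h5 | h5
        · exact h1 _ h5
        · rw [show k + 1 = n by omega, h3]
      refine ⟨h4, fun t ht => ?_⟩
      rcases Nat.lt_or_ge t d with h5 | h5
      · have := h2 (t + 1) h5
        rwa [show x + y + (t + 1) = x + (y + 1) + t by omega] at this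
      · obtain rfl : t = d := by omega
        rintro ⟨j, h6, h7⟩
        have h8 := h2 1 (by omega)
        rw [show x + y + 1 = x + (y + 1) by omega] at h8
        by_cases h9 : w (x + (y + 1) + t + n) = w (x + (y + 1) + n)
        · exact h8 ⟨j, fun k hk => (h6 k hk).trans (h4 k hk), by rwa [← h9]⟩
        · exact h8 ⟨_, h4, h9⟩
  refine ultPeriodic_of_eq (i := x + d) (j := x) (by omega) fun y => ?_
  by_contra hne
  rcases Nat.eq_zero_or_pos n with rfl | hn
  · refine (key y).2 0 (by omega) ⟨x + d + y, by simp, ?_⟩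
    simpa using hne
  · have := (key y).1 0 hn
    rw [add_zero, add_zero, add_right_comm] at this
    exact hne this

/-- In a word with at most `N + 2` factors of length `N + 1`, one of which is `(!b) v` with `v` a
palindrome and is right special, a factor `b v b` forces ultimate periodicity. -/
theorem ultPeriodic_of_palindrome {N p s : ℕ} {b : Bool}
    (hc : complexityW w (N + 1) = N + 2) (hs : w s = !b)
    (hu : ∀ i, Spec w (N + 1) i → ∀ k < N + 1, w (i + k) = w (s + k))
    (hsp : ∀ k, 0 < k → k ≤ N → w (s + k) = w (p + k)) (hp : w p = b) (hp' : w (p + (N + 1)) = b)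
    (hpal : ∀ k l, 0 < k → 0 < l → k + l = N + 1 → w (p + k) = w (p + l)) :
    UltPeriodicW w := by
  classical
  have hne : ∀ q < N + 2, ¬ ∀ k < N + 1, w (p + q + k) = w (s + k) := by
    intro q hq h
    have h0 := h 0 (by omega)
    rw [add_zero, add_zero, hs] at h0
    rcases Nat.eq_zero_or_pos q with rfl | hq0
    · rw [add_zero, hp] at h0
      simp at h0
    · rcases Nat.lt_or_ge q (N + 1) with hq1 | hq1
      · obtain ⟨l, hl⟩ := Nat.exists_eq_add_of_lt hq1
        have h1 := h (l + 1) (by omega)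
        rw [hsp _ (by omega) (by omega), show p + q + (l + 1) = p + (N + 1) by omega, hp',
          ← hpal q (l + 1) hq0 (by omega) (by omega), h0] at h1
        simp at h1
      · rw [show q = N + 1 by omega, hp'] at h0
        simp at h0
  have hfin : {u : List Bool | u.length = N + 1 ∧ IsFactorW w u}.Finite :=
    (List.finite_length_eq Bool (N + 1)).subset fun u hu => hu.1
  have hmem : ∀ i, wordAt w i (N + 1) ∈ hfin.toFinset := fun i => by
    rw [Set.Finite.mem_toFinset, Set.mem_ofPred_eq, factor_iff]
    exact ⟨i, rfl⟩
  rw [complexityW, Set.ncard_eq_toFinset_card _ hfin] at hc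
  obtain ⟨q, hq, q', hq', hqq, he⟩ := Finset.exists_ne_map_eq_of_card_lt_of_maps_to
    (s := Finset.range (N + 2)) (t := hfin.toFinset.erase (wordAt w s (N + 1)))
    (f := fun q => wordAt w (p + q) (N + 1))
    (by rw [Finset.card_erase_of_mem (hmem s), hc]; simp)
    (fun q hq => Finset.mem_erase.2
      ⟨fun he => hne q (by simpa using hq) (wordAt_eq_iff.1 he), hmem _⟩)
  wlog hlt : q < q' generalizing q q'
  · exact this q' hq' q hq hqq.symm he.symm (by omega)
  rw [Finset.mem_range] at hq'
  have he := wordAt_eq_iff.1 he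
  refine ultPeriodic_of_no_spec (x := p + q) (d := q' - q) (n := N + 1) (by omega) ?_ ?_
  · intro k hk
    rw [he k hk, show p + q + (q' - q) = p + q' by omega]
  · intro t ht hsp
    refine hne (q + t) (by omega) ?_
    rw [← add_assoc]
    exact hu _ hsp

/-- Sturmian words are balanced. -/
theorem bal_of_sturmian (h : SturmianW w) : Bal w := by
  obtain ⟨hnp, hc⟩ := h
  have hu := complexity_iff.1 hc
  by_contra hb
  obtain ⟨n, i, j, hmin, hij⟩ := exists_minimal_unbalanced hb
  obtain ⟨N, rfl, hi, hj, hi', hj', hij', -⟩ := unbalanced_structure hmin hij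
  have hpre : ∀ k ≤ N, ones w (i + 1 + k) + ones w (j + 1) = ones w (j + 1 + k) + ones w (i + 1) :=
    fun k hk => ones_congr fun l hl => by
      rw [add_assoc, add_assoc]
      exact hij' _ (by omega) (by omega)
  have e1 := ones_succ_false hi
  have e2 := ones_succ_true hj
  have e3 := ones_succ_false hi'
  have e4 := ones_succ_true hj'
  have hsum : ∀ k l, k + l = N →
      ones w (j + 1 + k) + ones w (j + 1 + l) = ones w (j + 1) + ones w (j + (N + 1)) := by
    intro k l hkl
    have m1 := hmin (k + 1) (by omega) i (j + 1 + l)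
    have m2 := hmin (k + 1) (by omega) (i + 1 + l) j
    rw [show j + 1 + l + (k + 1) = j + (N + 1) + 1 by omega,
      show i + (k + 1) = i + 1 + k by omega] at m1
    rw [show i + 1 + l + (k + 1) = i + (N + 1) + 1 by omega,
      show j + (k + 1) = j + 1 + k by omega] at m2
    have p1 := hpre k (by omega)
    have p2 := hpre l (by omega)
    have p3 := hpre N le_rfl
    rw [show i + 1 + N = i + (N + 1) by omega, show j + 1 + N = j + (N + 1) by omega] at p3
    omega
  have hpal : ∀ k l, 0 < k → 0 < l → k + l = N + 1 → w (j + k) = w (j + l) := by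
    intro k l hk hl hkl
    obtain ⟨k, rfl⟩ := Nat.exists_eq_add_of_le' hk
    obtain ⟨l, rfl⟩ := Nat.exists_eq_add_of_le' hl
    have s1 := hsum k (l + 1) (by omega)
    have s2 := hsum (k + 1) l (by omega)
    rw [show j + 1 + k = j + (k + 1) by omega, show j + 1 + (l + 1) = j + (l + 1) + 1 by omega] at s1
    rw [show j + 1 + l = j + (l + 1) by omega, show j + 1 + (k + 1) = j + (k + 1) + 1 by omega] at s2
    rcases ones_step w (j + (k + 1)) with ⟨a1, a2⟩ | ⟨a1, a2⟩ <;>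
      rcases ones_step w (j + (l + 1)) with ⟨b1, b2⟩ | ⟨b1, b2⟩ <;>
      first
      | (exfalso; omega)
      | rw [a1, b1]
  have hpal' : ∀ k l, 0 < k → 0 < l → k + l = N + 1 → w (i + k) = w (i + l) := by
    intro k l hk hl hkl
    rw [hij' k hk (by omega), hij' l hl (by omega)]
    exact hpal k l hk hl hkl
  obtain ⟨s, hs⟩ := (hu (N + 1)).1
  have hs1 : Spec w N (s + 1) := by
    obtain ⟨t, h1, h2⟩ := hs
    refine ⟨t + 1, fun k hk => ?_, ?_⟩
    · rw [add_assoc, add_assoc]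
      exact h1 _ (by omega)
    · rwa [add_assoc, add_assoc, add_comm 1 N]
  have hi1 : Spec w N (i + 1) := by
    refine ⟨j + 1, fun k hk => ?_, ?_⟩
    · rw [add_assoc, add_assoc]
      exact (hij' _ (by omega) (by omega)).symm
    · rw [add_assoc, add_assoc, add_comm 1 N, hi', hj']
      simp
  have hsi : ∀ k, 0 < k → k ≤ N → w (s + k) = w (i + k) := by
    intro k hk hkN
    have := (hu N).2 _ _ hs1 hi1 (k - 1) (by omega)
    rwa [show s + 1 + (k - 1) = s + k by omega, show i + 1 + (k - 1) = i + k by omega] at this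
  apply hnp
  have hu' : ∀ x, Spec w (N + 1) x → ∀ k < N + 1, w (x + k) = w (s + k) :=
    fun x hx => (hu (N + 1)).2 x s hx hs
  cases h : w s
  · exact ultPeriodic_of_palindrome (b := true) (hc _) h hu'
      (fun k h1 h2 => (hsi k h1 h2).trans (hij' k h1 h2)) hj hj' hpal
  · exact ultPeriodic_of_palindrome (b := false) (hc _) h hu' hsi hi hi' hpal'

theorem Bal.window_lower (hb : Bal w) (i n k : ℕ) :
    (k : ℝ) * (ones w (i + n) - ones w i - 1) ≤ ones w (n * k) := by
  induction k with
  | zero => simp [ones]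
  | succ k ih =>
    have h : ones w (i + n) + ones w (n * k) ≤ ones w (n * k + n) + ones w i + 1 :=
      hb n (n * k) i
    have h' : (ones w (i + n) + ones w (n * k) : ℝ) ≤ ones w (n * k + n) + ones w i + 1 := by
      exact_mod_cast h
    rw [Nat.mul_succ]
    push_cast
    linarith

theorem Bal.window_upper (hb : Bal w) (i n k : ℕ) :
    (ones w (n * k) : ℝ) ≤ k * (ones w (i + n) - ones w i + 1) := by
  induction k with
  | zero => simp [ones]
  | succ k ih =>
    have h : ones w (n * k + n) + ones w i ≤ ones w (i + n) + ones w (n * k) + 1 :=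
      hb n i (n * k)
    have h' : (ones w (n * k + n) + ones w i : ℝ) ≤ ones w (i + n) + ones w (n * k) + 1 := by
      exact_mod_cast h
    rw [Nat.mul_succ]
    push_cast
    linarith

/-- A balanced word has a slope. -/
theorem Bal.exists_slope (hb : Bal w) :
    ∃ α : ℝ, ∀ i n, |(ones w (i + n) - (i + n : ℕ) * α) - (ones w i - i * α)| ≤ 1 := by
  let f : ℕ × ℕ → ℝ := fun x => (ones w (x.1 + (x.2 + 1)) - ones w x.1 - 1) / (x.2 + 1)
  have hf : ∀ (x : ℕ × ℕ) j k, f x ≤ (ones w (j + (k + 1)) - ones w j + 1) / (k + 1) := by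
    rintro ⟨i, n⟩ j k
    have h1 := hb.window_lower i (n + 1) (k + 1)
    have h2 := hb.window_upper j (k + 1) (n + 1)
    rw [mul_comm (k + 1)] at h2
    rw [div_le_div_iff₀ (by positivity) (by positivity)]
    push_cast at h1 h2
    linarith
  refine ⟨⨆ x, f x, fun i n => ?_⟩
  rcases n with _ | n
  · simp
  · have hn : (0 : ℝ) < n + 1 := by positivity
    have h1 : f (i, n) ≤ ⨆ x, f x :=
      le_ciSup ⟨_, by rintro _ ⟨x, rfl⟩; exact hf x 0 0⟩ (i, n)
    have h2 : ⨆ x, f x ≤ _ := ciSup_le fun x => hf x i n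
    rw [div_le_iff₀ hn] at h1
    rw [le_div_iff₀ hn] at h2
    push_cast
    rw [abs_le]
    constructor <;> linarith

/-- A balanced word of rational slope is ultimately periodic. -/
theorem Bal.ultPeriodic_of_rational (hb : Bal w) {α : ℝ}
    (h : ∀ i n, |(ones w (i + n) - (i + n : ℕ) * α) - (ones w i - i * α)| ≤ 1) {p : ℤ} {q : ℕ}
    (hq : 0 < q) (hα : q * α = p) : UltPeriodicW w := by
  let D : ℕ → ℝ := fun i => ones w i - i * α
  have hD : ∀ i n, |D (i + n) - D i| ≤ 1 := h
  let d : ℕ → ℤ := fun i => ones w (i + q) - ones w i - p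
  have hd : ∀ i, D (i + q) = D i + d i := by
    intro i
    simp only [D, d]
    push_cast
    rw [← hα]
    ring
  have hd1 : ∀ i, -1 ≤ d i ∧ d i ≤ 1 := by
    intro i
    have := hD i q
    rw [hd, add_sub_cancel_left, abs_le] at this
    exact_mod_cast this
  have key : ∀ s : ℤ, (s = 1 ∨ s = -1) → (∀ i, 0 ≤ s * d i) → {i | d i ≠ 0}.Finite := by
    intro s hs hpos
    by_contra hinf
    obtain ⟨i, hi, j, hj, hij, he⟩ := Set.Infinite.exists_ne_map_eq_of_mapsTo
      (f := fun i => i % q) (t := Set.Iio q) hinf (fun i _ => Nat.mod_lt _ hq) (Set.finite_Iio q)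
    wlog hlt : i < j generalizing i j
    · exact this j hj i hi hij.symm he.symm (by omega)
    have hmono : ∀ t, (s : ℝ) * D (i + q) ≤ s * D (i + q + q * t) := by
      intro t
      induction t with
      | zero => simp
      | succ t ih =>
        have := hpos (i + q + q * t)
        have h2 : (0 : ℝ) ≤ s * d (i + q + q * t) := by exact_mod_cast this
        rw [Nat.mul_succ, ← add_assoc, hd (i + q + q * t), mul_add]
        linarith
    have hdvd : q ∣ j - i := (Nat.modEq_iff_dvd' hlt.le).1 he
    obtain ⟨t, ht⟩ := hdvd
    obtain ⟨t, rfl⟩ : ∃ t', t = t' + 1 :=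
      Nat.exists_eq_succ_of_ne_zero (by rintro rfl; omega)
    rw [Nat.mul_succ] at ht
    have h1 := hmono t
    rw [show i + q + q * t = j by omega, hd] at h1
    have h2 := hD i (j + q - i)
    rw [show i + (j + q - i) = j + q by omega, hd, abs_le] at h2
    have hsd : ∀ i, d i ≠ 0 → s * d i = 1 := by
      intro i hi
      have h1 := hpos i
      have h2 := hd1 i
      rcases hs with rfl | rfl <;> omega
    have e1 : (s : ℝ) * d i = 1 := by exact_mod_cast hsd i hi
    have e2 : (s : ℝ) * d j = 1 := by exact_mod_cast hsd j hj
    rcases hs with rfl | rfl <;> push_cast at * <;> linarith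
  have hsame : ∀ i j, d i - d j ≤ 1 := by
    intro i j
    have := hb q j i
    simp only [d]
    omega
  have hfin : {i | d i ≠ 0}.Finite := by
    by_cases hex : ∃ i, d i < 0
    · obtain ⟨i, hi⟩ := hex
      refine key (-1) (Or.inr rfl) fun j => ?_
      have := hsame j i
      omega
    · push Not at hex
      exact key 1 (Or.inl rfl) fun j => by simpa using hex j
  obtain ⟨M, hM⟩ := hfin.bddAbove
  refine ⟨q, hq, M + 1, fun i hi => ?_⟩
  have hz : ∀ j, M < j → d j = 0 := by
    intro j hj
    by_contra hne
    exact absurd (hM hne) (by omega)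
  have h1 := hz i (by omega)
  have h2 := hz (i + 1) (by omega)
  simp only [d] at h1 h2
  rw [show i + 1 + q = i + q + 1 by omega] at h2
  rcases ones_step w i with ⟨a1, a2⟩ | ⟨a1, a2⟩ <;>
    rcases ones_step w (i + q) with ⟨b1, b2⟩ | ⟨b1, b2⟩ <;>
    first
    | (exfalso; omega)
    | rw [a1, b1]

/-- The discrepancies of an aperiodic balanced word eventually lie in an open unit interval. -/
theorem Bal.exists_discrepancy (hb : Bal w) (hnp : ¬ UltPeriodicW w) : ∃ (α lo : ℝ) (i₀ : ℕ),
    (∀ (q : ℕ) (p : ℤ), 0 < q → q * α ≠ p) ∧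
    ∀ i, i₀ ≤ i → lo < ones w i - i * α ∧ ones w i - i * α < lo + 1 := by
  obtain ⟨α, h⟩ := hb.exists_slope
  have hirr : ∀ (q : ℕ) (p : ℤ), 0 < q → q * α ≠ p := fun q p hq he =>
    hnp (hb.ultPeriodic_of_rational h hq he)
  let D : ℕ → ℝ := fun i => ones w i - i * α
  have hD : ∀ i j, D i ≤ D j + 1 := by
    intro i j
    rcases le_total i j with hij | hij <;> obtain ⟨n, rfl⟩ := Nat.exists_eq_add_of_le hij
    · have := (abs_le.1 (h i n)).1
      simp only [D]
      linarith
    · have := (abs_le.1 (h j n)).2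
      simp only [D]
      linarith
  have hinj : Function.Injective D := by
    intro i j hij
    by_contra hne
    wlog hlt : i < j generalizing i j
    · exact this hij.symm (Ne.symm hne) (by omega)
    obtain ⟨n, rfl⟩ := Nat.exists_eq_add_of_lt hlt
    refine hirr (n + 1) (ones w (i + n + 1) - ones w i) n.succ_pos ?_
    simp only [D] at hij
    push_cast at *
    linarith
  let lo := ⨅ i, D i
  have hlo : ∀ i, lo ≤ D i := fun i =>
    ciInf_le ⟨D 0 - 1, by rintro _ ⟨j, rfl⟩; linarith [hD 0 j]⟩ i
  have hhi : ∀ i, D i ≤ lo + 1 := fun i => by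
    have : D i - 1 ≤ lo := le_ciInf fun j => by linarith [hD i j]
    linarith
  have hfin : (D ⁻¹' {lo, lo + 1}).Finite :=
    (Set.toFinite {lo, lo + 1}).preimage hinj.injOn
  obtain ⟨M, hM⟩ := hfin.bddAbove
  refine ⟨α, lo, M + 1, hirr, fun i hi => ?_⟩
  have hni : D i ≠ lo ∧ D i ≠ lo + 1 := by
    constructor <;> intro he
    · exact absurd (hM (show i ∈ D ⁻¹' {lo, lo + 1} by simp [he])) (by omega)
    · exact absurd (hM (show i ∈ D ⁻¹' {lo, lo + 1} by simp [he])) (by omega)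
  exact ⟨lt_of_le_of_ne (hlo i) hni.1.symm, lt_of_le_of_ne (hhi i) hni.2⟩

/-- An irrational rotation has arbitrarily small steps of both signs. -/
theorem exists_small_step {α β : ℝ} (hα : ∀ (q : ℕ) (p : ℤ), 0 < q → q * α ≠ p) (hβ : 0 < β)
    (hβ1 : β < 1) : ∃ m : ℕ, 0 < m ∧ ∃ p : ℤ, 0 < m * α + p ∧ m * α + p < β := by
  obtain ⟨n, hn⟩ := exists_nat_one_div_lt hβ
  obtain ⟨k, hk, -, h⟩ := Real.exists_nat_abs_mul_sub_round_le α n.succ_pos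
  have hlt : |k * α - round (k * α)| < β := by
    refine (h.trans ?_).trans_lt hn
    apply one_div_le_one_div_of_le <;> push_cast <;> linarith
  rw [abs_lt] at hlt
  rcases lt_trichotomy (k * α - round (k * α)) 0 with h0 | h0 | h0
  · set r := -(k * α - round (k * α)) with hr
    have hr0 : 0 < r := by linarith
    have h1 := Nat.floor_le (a := 1 / r) (by positivity)
    have h2 := Nat.lt_floor_add_one (1 / r)
    have hne := hα (⌊1 / r⌋₊ * k) (⌊1 / r⌋₊ * round (k * α) - 1)
    rw [le_div_iff₀ hr0] at h1
    rw [div_lt_iff₀ hr0] at h2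
    have hpos : 0 < ⌊1 / r⌋₊ := by
      refine Nat.pos_of_ne_zero fun hz => ?_
      rw [hz] at h2
      push_cast at h2
      linarith
    have hpos' : 0 < ⌊1 / r⌋₊ * k := Nat.mul_pos hpos hk
    have hne := hne hpos'
    push_cast at hne
    have e : (⌊1 / r⌋₊ : ℝ) * r = ⌊1 / r⌋₊ * round (k * α) - ⌊1 / r⌋₊ * k * α := by
      rw [hr]; ring
    refine ⟨⌊1 / r⌋₊ * k, hpos', 1 - ⌊1 / r⌋₊ * round (k * α), ?_, ?_⟩ <;> push_cast
    · refine lt_of_le_of_ne (by linarith) fun he => hne (by linarith)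
    · linarith
  · exact absurd (by linarith) (hα k (round (k * α)) hk)
  · exact ⟨k, hk, -round (k * α), by push_cast; linarith, by push_cast; linarith⟩

theorem three_gap {D : ℕ → ℝ} {α lo p β : ℝ} {i₀ : ℕ}
    (hα : ∀ (q : ℕ) (p : ℤ), 0 < q → q * α ≠ p) (hD : ∀ i m, ∃ k : ℤ, D (i + m) = D i + m * α + k)
    (hlo : ∀ i, i₀ ≤ i → lo < D i ∧ D i < lo + 1) (hβ : 0 < β) (hβ1 : β < 1) (hp : lo ≤ p)
    (hpβ : p + β ≤ lo + 1) {C : ℕ → Prop} (hC : ∀ i, i₀ ≤ i → (C i ↔ p < D i ∧ D i < p + β)) :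
    ∃ a b, (∀ i m, i₀ ≤ i → 0 < m → C i → C (i + m) → (∀ k, 0 < k → k < m → ¬ C (i + k)) →
      m = a ∨ m = b ∨ m = a + b) ∧
      ((∃ i j, i₀ ≤ i ∧ i₀ ≤ j ∧ C i ∧ C (i + 1) ∧ C j ∧ C (j + 1) ∧ D i < D (i + 1) ∧
        D (j + 1) < D j) → a = 1 ∧ b = 1) := by
  classical
  let F : ℕ → ℝ → Prop := fun m r => 0 < r ∧ r < β ∧ ∃ k : ℤ, r = m * α + k
  let G : ℕ → ℝ → Prop := fun m r => 0 < r ∧ r < β ∧ ∃ k : ℤ, r = -(m * α) + k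
  have hF : ∃ m, 0 < m ∧ ∃ r, F m r := by
    obtain ⟨m, hm, k, h1, h2⟩ := exists_small_step hα hβ hβ1
    exact ⟨m, hm, _, h1, h2, k, rfl⟩
  have hG : ∃ m, 0 < m ∧ ∃ r, G m r := by
    obtain ⟨m, hm, k, h1, h2⟩ := exists_small_step (α := -α)
      (fun q p hq he => hα q (-p) hq (by push_cast; linarith)) hβ hβ1
    exact ⟨m, hm, _, h1, h2, k, by ring⟩
  obtain ⟨ha, η, hη0, hηβ, kη, hη⟩ := Nat.find_spec hF
  obtain ⟨hb, θ, hθ0, hθβ, kθ, hθ⟩ := Nat.find_spec hG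
  have hamin : ∀ m r, 0 < m → F m r → Nat.find hF ≤ m := fun m r h1 h2 =>
    Nat.find_min' hF ⟨h1, r, h2⟩
  have hbmin : ∀ m r, 0 < m → G m r → Nat.find hG ≤ m := fun m r h1 h2 =>
    Nat.find_min' hG ⟨h1, r, h2⟩
  generalize Nat.find hF = a at *
  generalize Nat.find hG = b at *
  have hsum : β ≤ η + θ := by
    by_contra! hlt
    rcases lt_trichotomy a b with hab | hab | hab
    · obtain ⟨c, rfl⟩ := Nat.exists_eq_add_of_lt hab
      have := hbmin (c + 1) (η + θ) c.succ_pos ⟨by linarith, hlt, kη + kθ, by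
        push_cast at *; linarith⟩
      omega
    · have h1 : η + θ = ((kη + kθ : ℤ) : ℝ) := by subst hab; push_cast; linarith
      have h2 : ((kη + kθ : ℤ) : ℝ) < (1 : ℤ) := by push_cast at *; linarith
      have h3 : ((0 : ℤ) : ℝ) < (kη + kθ : ℤ) := by rw [← h1]; push_cast; linarith
      rw [Int.cast_lt] at h2 h3
      omega
    · obtain ⟨c, rfl⟩ := Nat.exists_eq_add_of_lt hab
      have := hamin (c + 1) (η + θ) c.succ_pos ⟨by linarith, hlt, kη + kθ, by
        push_cast at *; linarith⟩
      omega
  have hFη : ∀ m r, 0 < m → F m r → r < η → a + b ≤ m := by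
    rintro m r hm hmr hr
    obtain ⟨h0, h1, k, hk⟩ := id hmr
    have h2 := hamin m r hm hmr
    obtain ⟨c, rfl⟩ := Nat.exists_eq_add_of_le h2
    have hc : 0 < c := by
      refine Nat.pos_of_ne_zero ?_
      rintro rfl
      have h3 : η - r = ((kη - k : ℤ) : ℝ) := by push_cast; rw [hη, hk]; push_cast; ring
      have h4 : ((kη - k : ℤ) : ℝ) < (1 : ℤ) := by rw [← h3]; push_cast; linarith
      have h5 : ((0 : ℤ) : ℝ) < (kη - k : ℤ) := by rw [← h3]; push_cast; linarith
      rw [Int.cast_lt] at h4 h5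
      omega
    have := hbmin c (η - r) hc ⟨by linarith, by linarith, kη - k, by
      push_cast at *; linarith⟩
    omega
  have hGθ : ∀ m r, 0 < m → G m r → r < θ → a + b ≤ m := by
    rintro m r hm hmr hr
    obtain ⟨h0, h1, k, hk⟩ := id hmr
    have h2 := hbmin m r hm hmr
    obtain ⟨c, rfl⟩ := Nat.exists_eq_add_of_le h2
    have hc : 0 < c := by
      refine Nat.pos_of_ne_zero ?_
      rintro rfl
      have h3 : θ - r = ((kθ - k : ℤ) : ℝ) := by push_cast; rw [hθ, hk]; push_cast; ring
      have h4 : ((kθ - k : ℤ) : ℝ) < (1 : ℤ) := by rw [← h3]; push_cast; linarith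
      have h5 : ((0 : ℤ) : ℝ) < (kθ - k : ℤ) := by rw [← h3]; push_cast; linarith
      rw [Int.cast_lt] at h4 h5
      omega
    have := hamin c (θ - r) hc ⟨by linarith, by linarith, kθ - k, by
      push_cast at *; linarith⟩
    omega
  have hmove : ∀ (i m : ℕ) (r : ℝ), i₀ ≤ i → p < r → r < p + β → (∃ k : ℤ, r = D i + m * α + k) →
      C (i + m) := by
    rintro i m r hi h1 h2 ⟨k, hk⟩
    obtain ⟨k', hk'⟩ := hD i m
    have h3 := hlo (i + m) (by omega)
    have h4 : D (i + m) - r = ((k' - k : ℤ) : ℝ) := by push_cast; linarith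
    have h5 : ((k' - k : ℤ) : ℝ) < (1 : ℤ) := by rw [← h4]; push_cast; linarith
    have h6 : ((-1 : ℤ) : ℝ) < (k' - k : ℤ) := by rw [← h4]; push_cast; linarith
    rw [Int.cast_lt] at h5 h6
    obtain rfl : k' = k := by omega
    rw [hC _ (by omega), hk', ← hk]
    exact ⟨h1, h2⟩
  have hstep : ∀ i m, i₀ ≤ i → C i → C (i + m) → 0 < m →
      (D i < D (i + m) ∧ F m (D (i + m) - D i)) ∨ (D (i + m) < D i ∧ G m (D i - D (i + m))) := by
    intro i m hi h1 h2 hm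
    obtain ⟨k, hk⟩ := hD i m
    rw [hC _ hi] at h1
    rw [hC _ (by omega)] at h2
    rcases lt_trichotomy (D i) (D (i + m)) with h | h | h
    · exact Or.inl ⟨h, by linarith, by linarith, k, by linarith⟩
    · exact absurd (by push_cast; linarith) (hα m (-k) hm)
    · exact Or.inr ⟨h, by linarith, by linarith, -k, by push_cast; linarith⟩
  refine ⟨a, b, fun i m hi hm h1 h2 h3 => ?_, ?_⟩
  · have hle : ∀ c, 0 < c → C (i + c) → m ≤ c := by
      intro c hc hcc
      by_contra! hlt
      exact h3 c hc hlt hcc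
    have hs := hstep i m hi h1 h2 hm
    have c1 := (hC _ hi).1 h1
    have c2 := (hC _ (by omega)).1 h2
    by_cases x1 : D i + η < p + β
    · have hma := hle a ha (hmove i a _ hi (by linarith) x1 ⟨kη, by rw [hη]; ring⟩)
      rcases hs with ⟨-, hs⟩ | ⟨-, hs⟩
      · have := hamin m _ hm hs
        omega
      · have := hGθ m _ hm hs (by linarith)
        omega
    · push Not at x1
      by_cases x2 : p < D i - θ
      · have hmb := hle b hb (hmove i b _ hi x2 (by linarith) ⟨-kθ, by rw [hθ]; push_cast; ring⟩)
        rcases hs with ⟨-, hs⟩ | ⟨-, hs⟩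
        · have := hFη m _ hm hs (by linarith)
          omega
        · have := hbmin m _ hm hs
          omega
      · push Not at x2
        have hmb := hle (a + b) (by omega) (hmove i (a + b) (D i + η - θ) hi (by linarith)
          (by linarith) ⟨kη - kθ, by rw [hη, hθ]; push_cast; ring⟩)
        rcases hs with ⟨-, hs⟩ | ⟨-, hs⟩
        · have := hFη m _ hm hs (by linarith)
          omega
        · have := hGθ m _ hm hs (by linarith)
          omega
  · rintro ⟨i, j, hi, hj, c1, c2, c3, c4, d1, d2⟩
    rcases hstep i 1 hi c1 c2 one_pos with ⟨-, h⟩ | ⟨h, -⟩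
    · rcases hstep j 1 hj c3 c4 one_pos with ⟨h', -⟩ | ⟨-, h'⟩
      · linarith
      · have := hamin 1 _ one_pos h
        have := hbmin 1 _ one_pos h'
        omega
    · linarith

/-- In an aperiodic recurrent word no abelian class has a single return. -/
theorem atLeastTwo (hr : Rec w) (hnp : ¬ UltPeriodicW w) : AtLeastTwo w := by
  intro n c i hn hi
  by_contra hno
  have hsame : ∀ i₁ m₁ i₂ m₂, Ret w n c i₁ m₁ → Ret w n c i₂ m₂ →
      m₁ = m₂ ∧ ∀ k < m₁, w (i₁ + k) = w (i₂ + k) := by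
    intro i₁ m₁ i₂ m₂ r1 r2
    have hd : ¬ Diff w i₁ m₁ i₂ m₂ := fun hd => hno ⟨_, _, _, _, r1, r2, hd⟩
    have hm : m₁ = m₂ := by
      by_contra h
      exact hd (Or.inl h)
    refine ⟨hm, fun k hk => ?_⟩
    by_contra h
    exact hd (Or.inr ⟨k, hk, hm ▸ hk, h⟩)
  obtain ⟨m, hm⟩ := exists_ret hr hi
  have hall : ∀ t, Ret w n c (i + m * t) m := by
    intro t
    induction t with
    | zero => exact hm
    | succ t ih =>
      obtain ⟨m', hm'⟩ := exists_ret hr ih.2.2.1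
      rw [add_assoc, ← Nat.mul_succ] at hm'
      have := (hsame _ _ _ _ hm hm').1
      rwa [this] at hm' ⊢
  refine hnp ⟨m, hm.1, i, fun x hx => ?_⟩
  have h1 := Nat.mod_add_div (x - i) m
  have h2 := Nat.mod_lt (x - i) hm.1
  have := (hsame _ _ _ _ (hall ((x - i) / m + 1)) (hall ((x - i) / m))).2 _ h2
  rwa [show i + m * ((x - i) / m + 1) + (x - i) % m = x + m by rw [Nat.mul_succ]; omega,
    show i + m * ((x - i) / m) + (x - i) % m = x by omega] at this

theorem Ret.inner {n c i m : ℕ} (h : Ret w n c i (m + 2)) {k : ℕ} (hk : k ≤ m) :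
    ¬ InCl w n c (i + 1 + k) := by
  rw [add_assoc]
  exact h.2.2.2 _ (by omega) (by omega)

/-- Outside of an abelian class, a balanced word has windows of a single weight. -/
theorem Bal.weight_unique (hb : Bal w) {n c i j x : ℕ} (h : InCl w n c x) (hi : ¬ InCl w n c i)
    (hj : ¬ InCl w n c j) : ones w (i + n) + ones w j = ones w (j + n) + ones w i := by
  have h1 := hb n i x
  have h2 := hb n x i
  have h3 := hb n j x
  have h4 := hb n x j
  have h5 := hb n i j
  have h6 := hb n j i
  unfold InCl at *
  omega

theorem Bal.ret_inner (hb : Bal w) {n c i m : ℕ} (h : Ret w n c i (m + 2)) :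
    Spec w m (i + 1) ∧ w i ≠ w (i + n) ∧ w (i + (m + 1)) = w (i + n) := by
  have hu : ∀ k ≤ m, ones w (i + 1 + k + n) + ones w (i + 1) =
      ones w (i + 1 + n) + ones w (i + 1 + k) :=
    fun k hk => hb.weight_unique h.2.1 (h.inner hk) (h.inner (Nat.zero_le _))
  have h0 : w i ≠ w (i + n) := fun he => h.inner (Nat.zero_le _) (inCl_succ_of_eq h.2.1 he)
  have e1 := h.2.1
  have e2 := h.2.2.1
  have e3 := h.inner (k := m) le_rfl
  have e4 := hu m le_rfl
  unfold InCl at e1 e2 e3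
  have s1 := ones_step w i
  have s2 := ones_step w (i + n)
  have s3 := ones_step w (i + 1 + m)
  have s4 := ones_step w (i + 1 + m + n)
  rw [show i + (m + 2) + n = i + 1 + m + n + 1 by omega,
    show i + (m + 2) = i + 1 + m + 1 by omega] at e2
  rw [show i + 1 + n = i + n + 1 by omega] at e4
  have h1 : w (i + 1 + m) = w (i + n) ∧ w (i + 1 + m + n) = w i := by
    rcases s1 with s1 | s1 <;> rcases s2 with s2 | s2 <;>
      first
      | exact absurd (s1.1.trans s2.1.symm) h0
      | skip
    all_goals
      rcases s3 with s3 | s3 <;> rcases s4 with s4 | s4 <;>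
        first
        | (exfalso; omega)
        | exact ⟨s3.1.trans s2.1.symm, s4.1.trans s1.1.symm⟩
  refine ⟨⟨i + 1 + n, fun k hk => ?_, ?_⟩, h0, ?_⟩
  · have a1 := hu k hk.le
    have a2 := hu (k + 1) hk
    have s5 := ones_step w (i + 1 + k)
    have s6 := ones_step w (i + 1 + k + n)
    rw [show i + 1 + (k + 1) + n = i + 1 + k + n + 1 by omega,
      show i + 1 + (k + 1) = i + 1 + k + 1 by omega] at a2
    rw [show i + 1 + n + k = i + 1 + k + n by omega]
    rcases s5 with s5 | s5 <;> rcases s6 with s6 | s6 <;>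
      first
      | (exfalso; omega)
      | rw [s5.1, s6.1]
  · rw [show i + 1 + n + m = i + 1 + m + n by omega, h1.1, h1.2]
    exact h0
  · rw [← h1.1]
    congr 1
    omega

/-- Returns of the same length at least two are equal. -/
theorem Bal.ret_unique (hb : Bal w) {n c i j m : ℕ} (hi : Ret w n c i (m + 2))
    (hj : Ret w n c j (m + 2)) : ∀ k < m + 2, w (i + k) = w (j + k) := by
  obtain ⟨p1, p2, p3⟩ := hb.ret_inner hi
  obtain ⟨q1, q2, q3⟩ := hb.ret_inner hj
  have hu := hb.weight_unique hi.2.1 (hi.inner (Nat.zero_le _)) (hj.inner (Nat.zero_le _))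
  have e1 := hi.2.1
  have e2 := hj.2.1
  unfold InCl at e1 e2
  have hends : w i = w j ∧ w (i + n) = w (j + n) := by
    have s1 := ones_step w i
    have s2 := ones_step w (i + n)
    have s3 := ones_step w j
    have s4 := ones_step w (j + n)
    rw [add_zero, add_zero, show i + 1 + n = i + n + 1 by omega,
      show j + 1 + n = j + n + 1 by omega] at hu
    rcases s1 with s1 | s1 <;> rcases s2 with s2 | s2 <;>
      first
      | exact absurd (s1.1.trans s2.1.symm) p2
      | skip
    all_goals
      rcases s3 with s3 | s3 <;> rcases s4 with s4 | s4 <;>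
        first
        | exact absurd (s3.1.trans s4.1.symm) q2
        | (exfalso; omega)
        | exact ⟨s1.1.trans s3.1.symm, s2.1.trans s4.1.symm⟩
  intro k hk
  rcases Nat.eq_zero_or_pos k with rfl | hk0
  · exact hends.1
  · rcases Nat.lt_or_ge k (m + 1) with hk1 | hk1
    · have := hb.spec_unique p1 q1 (k - 1) (by omega)
      rwa [show i + 1 + (k - 1) = i + k by omega, show j + 1 + (k - 1) = j + k by omega] at this
    · rw [show k = m + 1 by omega, p3, q3, hends.2]

theorem Bal.ret_diff (hb : Bal w) {n c i j m m' : ℕ} (hi : Ret w n c i m)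
    (hj : Ret w n c j m') (hd : Diff w i m j m') (hm : m = m') : m = 1 ∧ w i ≠ w j := by
  subst hm
  obtain ⟨k, hk, -, hne⟩ := hd.resolve_left fun h => h rfl
  have h1 := hi.1
  rcases Nat.lt_or_ge 1 m with h | h
  · obtain ⟨m, rfl⟩ := Nat.exists_eq_add_of_le' h
    exact absurd (hb.ret_unique hi hj k hk) hne
  · obtain rfl : m = 1 := by omega
    obtain rfl : k = 0 := by omega
    exact ⟨rfl, hne⟩

/-- The returns of an abelian class that are far enough take at most three values. -/
theorem Bal.exists_code (hb : Bal w) (hnp : ¬ UltPeriodicW w) {n c : ℕ} (hn : 0 < n) :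
    ∃ (i₀ : ℕ) (g : ℕ → ℕ → Fin 3), ∀ i m j m', i₀ ≤ i → i₀ ≤ j → Ret w n c i m →
      Ret w n c j m' → Diff w i m j m' → g i m ≠ g j m' := by
  obtain ⟨α, lo, i₀, hα, hlo⟩ := hb.exists_discrepancy hnp
  by_cases hex : ∃ x, i₀ ≤ x ∧ InCl w n c x
  swap
  · exact ⟨i₀, fun _ _ => 0, fun i m j m' hi _ r => absurd ⟨i, hi, r.2.1⟩ hex⟩
  obtain ⟨x, hx, hxc⟩ := hex
  let D : ℕ → ℝ := fun i => ones w i - i * α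
  replace hlo : ∀ i, i₀ ≤ i → lo < D i ∧ D i < lo + 1 := hlo
  have hDn : ∀ i, D (i + n) = D i + (((ones w (i + n) : ℤ) - ones w i : ℤ) - n * α) := by
    intro i
    simp only [D]
    push_cast
    ring
  have hin : ∀ i, InCl w n c i ↔ ((ones w (i + n) : ℤ) - ones w i : ℤ) = c := by
    intro i
    unfold InCl
    omega
  set y : ℝ := c - n * α with hy
  have hy0 : y ≠ 0 := fun h => hα n c hn (by push_cast; linarith)
  have hin' : ∀ i, InCl w n c i → D (i + n) = D i + y := by
    intro i h
    rw [hDn, (hin i).1 h, hy]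
    push_cast
    ring
  have hstep : ∀ i, i₀ ≤ i → |D (i + n) - D i| < 1 := by
    intro i hi
    have h1 := hlo i hi
    have h2 := hlo (i + n) (by omega)
    rw [abs_lt]
    constructor <;> linarith
  have hy1 : |y| < 1 := by
    have := hstep x hx
    rwa [hin' x hxc, add_sub_cancel_left] at this
  have hint : ∃ p β, 0 < β ∧ β < 1 ∧ lo ≤ p ∧ p + β ≤ lo + 1 ∧
      ∀ i, i₀ ≤ i → (InCl w n c i ↔ p < D i ∧ D i < p + β) := by
    rw [abs_lt] at hy1
    have hout : ∀ i, i₀ ≤ i → ¬ InCl w n c i → ∃ k : ℤ, k ≠ 0 ∧ D (i + n) = D i + y + k ∧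
        |y + k| < 1 := by
      intro i hi h
      rw [hin] at h
      refine ⟨((ones w (i + n) : ℤ) - ones w i : ℤ) - c, sub_ne_zero.2 h, ?_, ?_⟩
      · rw [hDn, hy]
        push_cast
        ring
      · have := hstep i hi
        rw [hDn, add_sub_cancel_left] at this
        convert this using 2
        rw [hy]
        push_cast
        ring
    rcases lt_or_gt_of_ne hy0 with hneg | hpos
    · refine ⟨lo - y, 1 + y, by linarith, by linarith, by linarith, by linarith, fun i hi => ?_⟩
      have h1 := hlo i hi
      have h2 := hlo (i + n) (by omega)
      constructor
      · intro h
        rw [hin' i h] at h2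
        constructor <;> linarith
      · rintro ⟨h3, -⟩
        by_contra hno
        obtain ⟨k, hk0, hk, hk1⟩ := hout i hi hno
        rw [abs_lt] at hk1
        have h4 : (k : ℝ) < (2 : ℤ) := by push_cast; linarith
        have h5 : ((-1 : ℤ) : ℝ) < k := by push_cast; linarith
        rw [Int.cast_lt] at h4 h5
        obtain rfl : k = 1 := by omega
        push_cast at hk
        linarith
    · refine ⟨lo, 1 - y, by linarith, by linarith, by linarith, by linarith, fun i hi => ?_⟩
      have h1 := hlo i hi
      have h2 := hlo (i + n) (by omega)
      constructor
      · intro h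
        rw [hin' i h] at h2
        constructor <;> linarith
      · rintro ⟨-, h3⟩
        by_contra hno
        obtain ⟨k, hk0, hk, hk1⟩ := hout i hi hno
        rw [abs_lt] at hk1
        have h4 : (k : ℝ) < (1 : ℤ) := by push_cast; linarith
        have h5 : ((-2 : ℤ) : ℝ) < k := by push_cast; linarith
        rw [Int.cast_lt] at h4 h5
        obtain rfl : k = -1 := by omega
        push_cast at hk
        linarith
  obtain ⟨p, β, hβ0, hβ1, hp, hpβ, hC⟩ := hint
  obtain ⟨a, b, hgap, hflat⟩ := three_gap (D := D) (α := -α)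
    (fun q p hq he => hα q (-p) hq (by push_cast; linarith))
    (fun i m => ⟨ones w (i + m) - ones w i, by simp only [D]; push_cast; ring⟩)
    hlo hβ0 hβ1 hp hpβ hC
  have hlen : ∀ i m, i₀ ≤ i → Ret w n c i m → m = a ∨ m = b ∨ m = a + b :=
    fun i m hi r => hgap i m hi r.1 r.2.1 r.2.2.1 r.2.2.2
  by_cases hab : a = 1 ∧ b = 1
  · obtain ⟨rfl, rfl⟩ := hab
    refine ⟨i₀, fun i m => if m = 1 then (if w i then 0 else 1) else 2, ?_⟩
    intro i m j m' hi hj r r' hd hg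
    beta_reduce at hg
    have l1 := hlen i m hi r
    have l2 := hlen j m' hj r'
    have key := hb.ret_diff r r' hd
    by_cases h1 : m = 1 <;> by_cases h2 : m' = 1
    · obtain ⟨-, h3⟩ := key (h1.trans h2.symm)
      rw [if_pos h1, if_pos h2] at hg
      revert hg h3
      cases w i <;> cases w j <;> simp
    · rw [if_pos h1, if_neg h2] at hg
      revert hg
      cases w i <;> simp
    · rw [if_neg h1, if_pos h2] at hg
      revert hg
      cases w j <;> simp
    · have := (key (by omega)).1
      omega
  · refine ⟨i₀, fun i m => if m = a then 0 else if m = b then 1 else 2, ?_⟩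
    intro i m j m' hi hj r r' hd hg
    beta_reduce at hg
    have l1 := hlen i m hi r
    have l2 := hlen j m' hj r'
    have hmm : m = m' := by
      split_ifs at hg <;> omega
    obtain ⟨h1, h2⟩ := hb.ret_diff r r' hd hmm
    subst hmm
    subst h1
    have hflats : ∀ i j, i₀ ≤ i → i₀ ≤ j → Ret w n c i 1 → Ret w n c j 1 → w i = true →
        w j = false → a = 1 ∧ b = 1 := by
      intro i j hi hj r r' h h'
      have ei : D (i + 1) = D i + 1 - α := by
        simp only [D, ones_succ_true h]
        push_cast
        ring
      have ej : D (j + 1) = D j - α := by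
        simp only [D, ones_succ_false h']
        push_cast
        ring
      have ti := hlo i hi
      have ti' := hlo (i + 1) (by omega)
      have tj := hlo j hj
      have tj' := hlo (j + 1) (by omega)
      have h0 : α ≠ 0 := fun h => hα 1 0 one_pos (by simp [h])
      have h1 : α ≠ 1 := fun h => hα 1 1 one_pos (by simp [h])
      have h0 : 0 < α := lt_of_le_of_ne (by linarith) h0.symm
      have h1 : α < 1 := lt_of_le_of_ne (by linarith) h1
      exact hflat ⟨i, j, hi, hj, r.2.1, r.2.2.1, r'.2.1, r'.2.2.1, by linarith, by linarith⟩
    cases hwi : w i <;> cases hwj : w j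
    · exact absurd (hwi.trans hwj.symm) h2
    · exact hab (hflats j i hj hi r' r hwj hwi)
    · exact hab (hflats i j hi hj r r' hwi hwj)
    · exact absurd (hwi.trans hwj.symm) h2

theorem atMostThree (hr : Rec w) (hb : Bal w) (hnp : ¬ UltPeriodicW w) : AtMostThree w := by
  intro n c hn i₁ m₁ i₂ m₂ i₃ m₃ i₄ m₄ r1 r2 r3 r4 d12 d13 d14 d23 d24 d34
  obtain ⟨i₀, g, hg⟩ := hb.exists_code hnp (c := c) hn
  have hfar : ∀ i m, ∃ j, i₀ ≤ j ∧ (Ret w n c i m → Ret w n c j m) ∧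
      ∀ k < m, w (i + k) = w (j + k) := by
    intro i m
    obtain ⟨j, hj, h⟩ := hr i (m + n) i₀
    exact ⟨j, hj, fun r => ret_congr (fun k hk => (h k hk).symm) r,
      fun k hk => (h k (by omega)).symm⟩
  obtain ⟨j₁, h1, s1, e1⟩ := hfar i₁ m₁
  obtain ⟨j₂, h2, s2, e2⟩ := hfar i₂ m₂
  obtain ⟨j₃, h3, s3, e3⟩ := hfar i₃ m₃
  obtain ⟨j₄, h4, s4, e4⟩ := hfar i₄ m₄
  have n12 := hg _ _ _ _ h1 h2 (s1 r1) (s2 r2) (diff_congr e1 e2 d12)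
  have n13 := hg _ _ _ _ h1 h3 (s1 r1) (s3 r3) (diff_congr e1 e3 d13)
  have n14 := hg _ _ _ _ h1 h4 (s1 r1) (s4 r4) (diff_congr e1 e4 d14)
  have n23 := hg _ _ _ _ h2 h3 (s2 r2) (s3 r3) (diff_congr e2 e3 d23)
  have n24 := hg _ _ _ _ h2 h4 (s2 r2) (s4 r4) (diff_congr e2 e4 d24)
  have n34 := hg _ _ _ _ h3 h4 (s3 r3) (s4 r4) (diff_congr e3 e4 d34)
  omega

theorem good_of_sturmian (hr : Rec w) (h : SturmianW w) : Good w :=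
  ⟨hr, atMostThree hr (bal_of_sturmian h) h.1, atLeastTwo hr h.1⟩

theorem count_true_wordAt (i n : ℕ) : (wordAt w i n).count true + ones w i = ones w (i + n) := by
  induction n with
  | zero => simp [wordAt]
  | succ n ih =>
    rw [wordAt_succ, List.count_append, ← add_assoc, ones_succ]
    cases w (i + n) <;> simp <;> omega

theorem abEquiv_iff {u v : List Bool} (h : u.length = v.length) :
    AbEquiv u v ↔ u.count true = v.count true := by
  have h1 := List.count_true_add_count_false u
  have h2 := List.count_true_add_count_false v
  constructor
  · exact fun h => h true
  · rintro h (_ | _) <;> omega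

theorem mem_abOcc {n i j : ℕ} {c : ℕ} (h : InCl w n c i) :
    j ∈ abOcc w (wordAt w i n) ↔ InCl w n c j := by
  have h1 := count_true_wordAt (w := w) i n
  have h2 := count_true_wordAt (w := w) j n
  rw [abOcc, Set.mem_ofPred_eq, wordAt_length, abEquiv_iff (by simp only [wordAt_length])]
  unfold InCl at *
  omega

theorem mem_semiAbReturns {n i c : ℕ} (h : InCl w n c i) {r : List Bool} :
    r ∈ semiAbReturns w (wordAt w i n) ↔ ∃ x m, Ret w n c x m ∧ r = wordAt w x m := by
  rw [semiAbReturns, Set.mem_ofPred_eq]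
  simp only [mem_abOcc h]
  constructor
  · rintro ⟨x, y, hx, hy, hlt, hno, rfl⟩
    refine ⟨x, y - x, ⟨by omega, hx, by rwa [Nat.add_sub_cancel' hlt.le], fun k h1 h2 => ?_⟩, rfl⟩
    exact hno _ (by omega) (by omega)
  · rintro ⟨x, m, ⟨h1, h2, h3, h4⟩, rfl⟩
    refine ⟨x, x + m, h2, h3, by omega, fun k hk hkm => ?_, by rw [Nat.add_sub_cancel_left]⟩
    have := h4 (k - x) (by omega) (by omega)
    rwa [Nat.add_sub_cancel' hk.le] at this

theorem diff_iff {i m j m' : ℕ} : Diff w i m j m' ↔ wordAt w i m ≠ wordAt w j m' := by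
  constructor
  · rintro (h | ⟨k, h1, h2, h3⟩) he
    · have := congrArg List.length he
      rw [wordAt_length, wordAt_length] at this
      exact h this
    · have hm := congrArg List.length he
      rw [wordAt_length, wordAt_length] at hm
      subst hm
      exact h3 (wordAt_eq_iff.1 he k h1)
  · intro h
    by_cases hm : m = m'
    · subst hm
      rw [Ne, wordAt_eq_iff] at h
      push Not at h
      obtain ⟨k, h1, h2⟩ := h
      exact Or.inr ⟨k, h1, h1, h2⟩
    · exact Or.inl hm

theorem rec_iff : Rec w ↔ RecurrentW w := by
  constructor
  · rintro h u ⟨i, hu⟩ N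
    obtain ⟨j, hj, h⟩ := h i u.length N
    refine ⟨j, hj, ?_⟩
    rw [hu, wordAt_length]
    exact wordAt_eq_iff.2 fun k hk => (h k hk).symm
  · intro h i n N
    obtain ⟨j, hj, h⟩ := h (wordAt w i n) ⟨i, by rw [wordAt_length]⟩ N
    rw [wordAt_length] at h
    exact ⟨j, hj, fun k hk => (wordAt_eq_iff.1 h k hk).symm⟩

theorem exists_range_two_or_three {β : Type*} (S : Set β) :
    ((∃ f : Fin 2 → β, Function.Injective f ∧ S = Set.range f) ∨
      ∃ f : Fin 3 → β, Function.Injective f ∧ S = Set.range f) ↔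
    (∃ x ∈ S, ∃ y ∈ S, x ≠ y) ∧ ∀ x ∈ S, ∀ y ∈ S, ∀ z ∈ S, ∀ t ∈ S,
      x ≠ y → x ≠ z → x ≠ t → y ≠ z → y ≠ t → z ≠ t → False := by
  constructor
  · rintro (⟨f, hf, rfl⟩ | ⟨f, hf, rfl⟩)
    all_goals
      refine ⟨⟨f 0, ⟨0, rfl⟩, f 1, ⟨1, rfl⟩, hf.ne (by decide)⟩, ?_⟩
      rintro _ ⟨x, rfl⟩ _ ⟨y, rfl⟩ _ ⟨z, rfl⟩ _ ⟨t, rfl⟩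
      simp only [hf.ne_iff]
      omega
  · rintro ⟨⟨x, hx, y, hy, hxy⟩, h⟩
    by_cases hz : ∃ z ∈ S, z ≠ x ∧ z ≠ y
    · obtain ⟨z, hz, hzx, hzy⟩ := hz
      refine Or.inr ⟨![x, y, z], ?_, ?_⟩
      · intro a b hab
        fin_cases a <;> fin_cases b <;> simp_all
      · ext t
        simp only [Matrix.range_cons, Matrix.range_empty, Set.union_empty, Set.mem_union,
          Set.mem_singleton_iff]
        constructor
        · intro ht
          by_contra! hno
          exact h x hx y hy z hz t ht hxy hzx.symm hno.1.symm hzy.symm hno.2.1.symm hno.2.2.symm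
        · rintro (rfl | rfl | rfl) <;> assumption
    · push Not at hz
      refine Or.inl ⟨![x, y], ?_, ?_⟩
      · intro a b hab
        fin_cases a <;> fin_cases b <;> simp_all
      · ext t
        simp only [Matrix.range_cons, Matrix.range_empty, Set.union_empty, Set.mem_union,
          Set.mem_singleton_iff]
        constructor
        · intro ht
          by_contra! hno
          exact hno.2 (hz t ht hno.1)
        · rintro (rfl | rfl) <;> assumption

theorem exactly_iff {n i c : ℕ} (h : InCl w n c i) :
    (ExactlyKSemiAbReturns w (wordAt w i n) 2 ∨ ExactlyKSemiAbReturns w (wordAt w i n) 3) ↔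
    (∃ i₁ m₁ i₂ m₂, Ret w n c i₁ m₁ ∧ Ret w n c i₂ m₂ ∧ Diff w i₁ m₁ i₂ m₂) ∧
    ∀ i₁ m₁ i₂ m₂ i₃ m₃ i₄ m₄,
    Ret w n c i₁ m₁ → Ret w n c i₂ m₂ → Ret w n c i₃ m₃ → Ret w n c i₄ m₄ →
    Diff w i₁ m₁ i₂ m₂ → Diff w i₁ m₁ i₃ m₃ → Diff w i₁ m₁ i₄ m₄ →
    Diff w i₂ m₂ i₃ m₃ → Diff w i₂ m₂ i₄ m₄ → Diff w i₃ m₃ i₄ m₄ → False := by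
  unfold ExactlyKSemiAbReturns
  rw [exists_range_two_or_three]
  simp only [mem_semiAbReturns h, diff_iff]
  constructor
  · rintro ⟨⟨_, ⟨i₁, m₁, r1, rfl⟩, _, ⟨i₂, m₂, r2, rfl⟩, hd⟩, h4⟩
    exact ⟨⟨i₁, m₁, i₂, m₂, r1, r2, hd⟩, fun i₁ m₁ i₂ m₂ i₃ m₃ i₄ m₄ r1 r2 r3 r4 =>
      h4 _ ⟨_, _, r1, rfl⟩ _ ⟨_, _, r2, rfl⟩ _ ⟨_, _, r3, rfl⟩ _ ⟨_, _, r4, rfl⟩⟩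
  · rintro ⟨⟨i₁, m₁, i₂, m₂, r1, r2, hd⟩, h4⟩
    refine ⟨⟨_, ⟨i₁, m₁, r1, rfl⟩, _, ⟨i₂, m₂, r2, rfl⟩, hd⟩, ?_⟩
    rintro _ ⟨i₁, m₁, r1, rfl⟩ _ ⟨i₂, m₂, r2, rfl⟩ _ ⟨i₃, m₃, r3, rfl⟩ _ ⟨i₄, m₄, r4, rfl⟩
    exact h4 _ _ _ _ _ _ _ _ r1 r2 r3 r4

theorem good_iff (hr : Rec w) : Good w ↔ ∀ u, IsFactorW w u → u ≠ [] →
    (ExactlyKSemiAbReturns w u 2 ∨ ExactlyKSemiAbReturns w u 3) := by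
  have hcl : ∀ i n, InCl w n (ones w (i + n) - ones w i) i := by
    intro i n
    have := ones_add_bounds w i n
    unfold InCl
    omega
  constructor
  · rintro hg u ⟨i, hu⟩ hne
    have hn : 0 < u.length := List.length_pos_iff.2 hne
    rw [hu]
    exact (exactly_iff (hcl i _)).2 ⟨hg.two _ _ _ hn (hcl i _), hg.four _ _ hn⟩
  · intro h
    have key : ∀ n c i, 0 < n → InCl w n c i → _ := fun n c i hn hi =>
      (exactly_iff hi).1 (h _ ⟨i, by rw [wordAt_length]⟩
        (List.length_pos_iff.1 (by rwa [wordAt_length])))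
    exact ⟨hr, fun n c hn i₁ m₁ i₂ m₂ i₃ m₃ i₄ m₄ r1 =>
      (key n c i₁ hn r1.2.1).2 i₁ m₁ i₂ m₂ i₃ m₃ i₄ m₄ r1, fun n c i hn hi => (key n c i hn hi).1⟩

end SemiAb

/-- A recurrent infinite binary word is Sturmian iff every (nonempty) factor has exactly
two or three semi-abelian returns. -/
theorem stmt1 (w : ℕ → Bool) (hrec : RecurrentW w) :
    SturmianW w ↔
      ∀ u, IsFactorW w u → u ≠ [] →
        (ExactlyKSemiAbReturns w u 2 ∨ ExactlyKSemiAbReturns w u 3) := by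
  have hr := SemiAb.rec_iff.2 hrec
  rw [← SemiAb.good_iff hr]
  exact ⟨SemiAb.good_of_sturmian hr, SemiAb.Good.sturmian⟩
end

section
/- Every semi-abelian return to a factor of a Sturmian word is a Christoffel word; more precisely, each semi-abelian return is either a single letter or a word of the form a B b where a ≠ b are letters and B is a bispecial factor of the Sturmian word. -/
/-- The number of letters `true` among the first `m` letters of `w`. -/
def trueCount (w : ℕ → Bool) (m : ℕ) : ℕ :=
  Nat.count (fun k => w k = true) m

/-- The windows of length `m` of `w` at positions `x` and `y` agree. -/
def SameWindow (w : ℕ → Bool) (m x y : ℕ) : Prop :=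
  ∀ t < m, w (x + t) = w (y + t)

/-- The window of length `m` of `w` at position `x` has a right extension other than the
letter `w (x + m)`. -/
def SpecialAt (w : ℕ → Bool) (m x : ℕ) : Prop :=
  ∃ y, SameWindow w m x y ∧ w (x + m) ≠ w (y + m)

theorem trueCount_succ (w : ℕ → Bool) (m : ℕ) :
    trueCount w (m + 1) = trueCount w m + if w m = true then 1 else 0 :=
  Nat.count_succ _ _

theorem length_wordAt {α : Type*} (w : ℕ → α) (i n : ℕ) : (wordAt w i n).length = n := by
  simp [wordAt]

theorem wordAt_succ {α : Type*} (w : ℕ → α) (i n : ℕ) :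
    wordAt w i (n + 1) = wordAt w i n ++ [w (i + n)] := by
  simp [wordAt, List.range_succ]

theorem wordAt_succ_eq_cons {α : Type*} (w : ℕ → α) (i n : ℕ) :
    wordAt w i (n + 1) = w i :: wordAt w (i + 1) n := by
  simp [wordAt, List.range_succ_eq_map, Function.comp_def, Nat.add_comm, Nat.add_left_comm]

theorem isFactorW_wordAt {α : Type*} (w : ℕ → α) (i n : ℕ) : IsFactorW w (wordAt w i n) :=
  ⟨i, by rw [length_wordAt]⟩

theorem wordAt_eq_iff {w : ℕ → Bool} {m x y : ℕ} :
    wordAt w x m = wordAt w y m ↔ SameWindow w m x y := by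
  simp [wordAt, SameWindow]

theorem setOf_factors_eq_range {α : Type*} (w : ℕ → α) (n : ℕ) :
    {u : List α | u.length = n ∧ IsFactorW w u} = Set.range fun i => wordAt w i n := by
  ext u
  constructor
  · rintro ⟨rfl, i, hi⟩
    exact ⟨i, hi.symm⟩
  · rintro ⟨i, rfl⟩
    exact ⟨length_wordAt w i n, isFactorW_wordAt w i n⟩

theorem count_true_wordAt (w : ℕ → Bool) (i n : ℕ) :
    trueCount w i + (wordAt w i n).count true = trueCount w (i + n) := by
  induction n with
  | zero => simp [wordAt]
  | succ n ih =>
    rw [wordAt_succ, List.count_append, ← Nat.add_assoc, ih, ← Nat.add_assoc i, trueCount_succ]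
    cases w (i + n) <;> simp

theorem abEquiv_iff_count_true {u v : List Bool} (h : u.length = v.length) :
    AbEquiv u v ↔ u.count true = v.count true := by
  have hu := List.count_not_add_count u true
  have hv := List.count_not_add_count v true
  simp only [Bool.not_true] at hu hv
  refine ⟨fun H => H true, fun H a => ?_⟩
  cases a <;> omega

theorem mem_abOcc_iff {w : ℕ → Bool} {u : List Bool} {i : ℕ} :
    i ∈ abOcc w u ↔ trueCount w i + u.count true = trueCount w (i + u.length) := by
  have h := count_true_wordAt w i u.length
  rw [abOcc, Set.mem_ofPred_eq, abEquiv_iff_count_true (length_wordAt w i u.length)]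
  omega

theorem SameWindow.symm {w : ℕ → Bool} {m x y : ℕ} (h : SameWindow w m x y) :
    SameWindow w m y x :=
  fun t ht => (h t ht).symm

theorem SameWindow.trans {w : ℕ → Bool} {m x y z : ℕ} (h : SameWindow w m x y)
    (h' : SameWindow w m y z) : SameWindow w m x z :=
  fun t ht => (h t ht).trans (h' t ht)

theorem SameWindow.mono {w : ℕ → Bool} {m n x y : ℕ} (h : SameWindow w n x y) (hmn : m ≤ n) :
    SameWindow w m x y :=
  fun t ht => h t (by omega)

theorem SameWindow.tail {w : ℕ → Bool} {m x y : ℕ} (h : SameWindow w (m + 1) x y) :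
    SameWindow w m (x + 1) (y + 1) := fun t ht => by
  have := h (t + 1) (by omega)
  rwa [show x + 1 + t = x + (t + 1) by omega, show y + 1 + t = y + (t + 1) by omega]

theorem SameWindow.snoc {w : ℕ → Bool} {m x y : ℕ} (h : SameWindow w m x y)
    (h' : w (x + m) = w (y + m)) : SameWindow w (m + 1) x y := fun t ht => by
  rcases Nat.lt_succ_iff_lt_or_eq.mp ht with h1 | rfl
  · exact h t h1
  · exact h'

theorem SameWindow.cons {w : ℕ → Bool} {m x y : ℕ} (h : SameWindow w m (x + 1) (y + 1))
    (h' : w x = w y) : SameWindow w (m + 1) x y := fun t ht => by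
  rcases t with _ | t
  · exact h'
  · have := h t (by omega)
    rwa [show x + 1 + t = x + (t + 1) by omega, show y + 1 + t = y + (t + 1) by omega] at this

theorem SpecialAt.tail {w : ℕ → Bool} {m x : ℕ} (h : SpecialAt w (m + 1) x) :
    SpecialAt w m (x + 1) := by
  obtain ⟨y, h1, h2⟩ := h
  refine ⟨y + 1, h1.tail, ?_⟩
  rwa [show x + 1 + m = x + (m + 1) by omega, show y + 1 + m = y + (m + 1) by omega]

theorem SpecialAt.congr {w : ℕ → Bool} {m x z : ℕ} (h : SpecialAt w m x)
    (hz : SameWindow w m x z) : SpecialAt w m z := by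
  obtain ⟨y, h1, h2⟩ := h
  by_cases hx : w (z + m) = w (x + m)
  · exact ⟨y, hz.symm.trans h1, hx ▸ h2⟩
  · exact ⟨x, hz.symm, hx⟩

/-- A Sturmian word has at most one right special factor of each length. -/
theorem SpecialAt.sameWindow {w : ℕ → Bool} (hst : SturmianW w) {m x y : ℕ}
    (hx : SpecialAt w m x) (hy : SpecialAt w m y) : SameWindow w m x y := by
  by_contra hne
  obtain ⟨x', hx', hxn⟩ := hx
  obtain ⟨y', hy', hyn⟩ := hy
  have h0 := hst.2 m
  have h1 := hst.2 (m + 1)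
  simp only [complexityW, setOf_factors_eq_range] at h0 h1
  set F := Set.range fun i => wordAt w i (m + 1) with hF
  have hfin : F.Finite := Set.finite_of_ncard_ne_zero (by omega)
  have hsub : Set.range (fun i => wordAt w i m) ⊆
      List.dropLast '' (F \ {wordAt w x (m + 1), wordAt w y (m + 1)}) := by
    have key : ∀ q z, SameWindow w m z q → ¬ SameWindow w (m + 1) z x →
        ¬ SameWindow w (m + 1) z y → wordAt w q m ∈
        List.dropLast '' (F \ {wordAt w x (m + 1), wordAt w y (m + 1)}) := by
      intro q z h hzx hzy
      refine ⟨wordAt w z (m + 1), ⟨⟨z, rfl⟩, ?_⟩, ?_⟩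
      · simp only [Set.mem_insert_iff, Set.mem_singleton_iff, wordAt_eq_iff]
        tauto
      · rw [wordAt_succ, List.dropLast_concat]
        exact wordAt_eq_iff.mpr h
    rintro _ ⟨q, rfl⟩
    by_cases hqx : SameWindow w (m + 1) q x
    · have hq := hqx.mono (Nat.le_succ m)
      refine key q x' (hx'.symm.trans hq.symm) (fun h => hxn (h m (by omega)).symm) fun h => ?_
      exact hne (hx'.trans (h.mono (Nat.le_succ m)))
    by_cases hqy : SameWindow w (m + 1) q y
    · have hq := hqy.mono (Nat.le_succ m)
      refine key q y' (hy'.symm.trans hq.symm) (fun h => ?_) fun h => hyn (h m (by omega)).symm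
      exact hne (hy'.trans (h.mono (Nat.le_succ m))).symm
    exact key q q (fun _ _ => rfl) hqx hqy
  have hpair : ({wordAt w x (m + 1), wordAt w y (m + 1)} : Set (List Bool)).ncard = 2 :=
    Set.ncard_pair fun h => hne ((wordAt_eq_iff.mp h).mono (Nat.le_succ m))
  have hdiff : (F \ {wordAt w x (m + 1), wordAt w y (m + 1)}).ncard = m := by
    rw [Set.ncard_sdiff (by
      rintro _ (rfl | rfl)
      exacts [⟨x, rfl⟩, ⟨y, rfl⟩]), hpair, h1]
    omega
  have h2 := Set.ncard_le_ncard hsub ((hfin.sdiff).image _)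
  have h3 := Set.ncard_image_le (f := List.dropLast)
    (hfin.sdiff (t := {wordAt w x (m + 1), wordAt w y (m + 1)}))
  omega

/-- If a window recurs and no window between the two occurrences can be extended in two ways,
the word is ultimately periodic. -/
theorem ultPeriodicW_of_sameWindow {w : ℕ → Bool} {m s t : ℕ} (hst : s < t)
    (h : SameWindow w (m + 1) s t) (hns : ∀ x, s ≤ x → x < t → ¬ SpecialAt w (m + 1) x) :
    UltPeriodicW w := by
  obtain ⟨d, rfl⟩ := Nat.exists_eq_add_of_lt hst
  set D := d + 1 with hD
  have hDpos : 0 < D := Nat.succ_pos d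
  have key : ∀ k, SameWindow w (m + 1) (s + k) (s + k % D) := by
    intro k
    induction k with
    | zero => intro t _; simp
    | succ k ih =>
      have hlt := Nat.mod_lt k hDpos
      have hlast : w (s + k % D + (m + 1)) = w (s + k + (m + 1)) := by
        by_contra hne
        exact hns (s + k % D) (by omega) (by omega) ⟨s + k, ih.symm, hne⟩
      have hstep : SameWindow w (m + 1) (s + (k + 1)) (s + (k % D + 1)) :=
        (ih.snoc hlast.symm).tail
      rcases Nat.lt_or_ge (k % D + 1) D with h1 | h1
      · rwa [Nat.add_mod, Nat.mod_eq_of_lt (a := 1) (by omega), Nat.mod_eq_of_lt h1]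
      · have h2 : k % D + 1 = D := by omega
        have h3 : (k + 1) % D = 0 := by
          rw [← Nat.mod_add_mod, h2, Nat.mod_self]
        rw [h3]
        rw [h2] at hstep
        exact hstep.trans h.symm
  refine ⟨D, hDpos, s, fun n hn => ?_⟩
  obtain ⟨k, rfl⟩ := Nat.exists_eq_add_of_le hn
  have h1 := key k 0 (by omega)
  have h2 := key (k + D) 0 (by omega)
  rw [Nat.add_mod_right] at h2
  simpa [Nat.add_assoc] using h2.trans h1.symm

/-- In a Sturmian word, if `a p a` and `b p b` are factors with `a ≠ b` and `p` a palindrome,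
then `a p` is right special. -/
theorem specialAt_of_palindrome {w : ℕ → Bool} (hst : SturmianW w) {L i j : ℕ}
    (hij : w i ≠ w j) (hi : w (i + (L + 1)) = w i) (hj : w (j + (L + 1)) = w j)
    (hp : SameWindow w L (i + 1) (j + 1))
    (hpal : ∀ k < L, w (i + (k + 1)) = w (i + (L - k))) : SpecialAt w (L + 1) i := by
  by_contra hnot
  have hspec : SpecialAt w L (i + 1) := by
    refine ⟨j + 1, hp, ?_⟩
    rwa [show i + 1 + L = i + (L + 1) by omega, show j + 1 + L = j + (L + 1) by omega, hi, hj]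
  have honly : ∀ x, SpecialAt w (L + 1) x → SameWindow w (L + 1) x j := by
    intro x hx
    have hxi := hx.tail.sameWindow hst hspec
    by_cases h : w x = w j
    · exact (hxi.trans hp).cons h
    · refine absurd (hx.congr (hxi.cons ?_)) hnot
      revert h hij
      cases w x <;> cases w i <;> cases w j <;> simp
  have havoid : ∀ k ≤ L + 1, ¬ SameWindow w (L + 1) (i + k) j := by
    intro k hk h
    have h0 : w (i + k) = w j := h 0 (by omega)
    rcases Nat.eq_zero_or_pos k with rfl | hk0
    · exact hij h0
    rcases Nat.lt_or_ge L k with hkL | hkL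
    · obtain rfl : k = L + 1 := by omega
      exact hij (hi ▸ h0)
    have h1 := h (L + 1 - k) (by omega)
    have h2 := hp (L - k) (by omega)
    have h3 := hpal (k - 1) (by omega)
    rw [show i + k + (L + 1 - k) = i + (L + 1) by omega] at h1
    rw [show i + 1 + (L - k) = i + (L + 1 - k) by omega,
      show j + 1 + (L - k) = j + (L + 1 - k) by omega] at h2
    rw [show k - 1 + 1 = k by omega, show L - (k - 1) = L + 1 - k by omega] at h3
    exact hij (by rw [← hi, h1, ← h2, ← h3, h0])
  have hcard := hst.2 (L + 1)
  simp only [complexityW, setOf_factors_eq_range] at hcard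
  set F := Set.range fun i => wordAt w i (L + 1) with hF
  have hfin : F.Finite := Set.finite_of_ncard_ne_zero (by omega)
  have hdiff : (F \ {wordAt w j (L + 1)}).ncard = L + 1 := by
    rw [Set.ncard_sdiff_singleton_of_mem (Set.mem_range_self j), hcard]
    omega
  obtain ⟨s, hs, t, ht, hne, heq⟩ := Set.exists_ne_map_eq_of_ncard_lt_of_maps_to
    (s := (Finset.Icc i (i + (L + 1)) : Set ℕ)) (t := F \ {wordAt w j (L + 1)})
    (f := fun x => wordAt w x (L + 1))
    (by rw [hdiff, Set.ncard_coe_finset, Nat.card_Icc]; omega)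
    (fun x hx => by
      simp only [Finset.coe_Icc, Set.mem_Icc] at hx
      refine ⟨⟨x, rfl⟩, fun h => ?_⟩
      obtain ⟨k, rfl⟩ := Nat.exists_eq_add_of_le hx.1
      exact havoid k (by omega) (wordAt_eq_iff.mp h)) (hfin.sdiff)
  simp only [Finset.coe_Icc, Set.mem_Icc] at hs ht
  have hns : ∀ x, i ≤ x → x ≤ i + (L + 1) → ¬ SpecialAt w (L + 1) x := by
    intro x hx1 hx2 hx
    obtain ⟨k, rfl⟩ := Nat.exists_eq_add_of_le hx1
    exact havoid k (by omega) (honly _ hx)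
  have heq' := wordAt_eq_iff.mp heq
  rcases Nat.lt_or_gt_of_ne hne with h | h
  · exact hst.1 (ultPeriodicW_of_sameWindow h heq' fun x h1 h2 => hns x (by omega) (by omega))
  · exact hst.1
      (ultPeriodicW_of_sameWindow h heq'.symm fun x h1 h2 => hns x (by omega) (by omega))

/-- In an unbalanced binary word there are a palindrome `p` and factors `1 p 1` and `0 p 0`. -/
theorem exists_palindrome_of_unbalanced {w : ℕ → Bool}
    (h : ∃ n i j, trueCount w (j + n) + trueCount w i + 2 ≤
      trueCount w (i + n) + trueCount w j) :
    ∃ L i j, w i = true ∧ w j = false ∧ w (i + (L + 1)) = true ∧ w (j + (L + 1)) = false ∧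
      SameWindow w L (i + 1) (j + 1) ∧ ∀ k < L, w (i + (k + 1)) = w (i + (L - k)) := by
  classical
  obtain ⟨i, j, hn⟩ := Nat.find_spec h
  have hmin : ∀ m < Nat.find h, ∀ x y, trueCount w (x + m) + trueCount w y ≤
      trueCount w (y + m) + trueCount w x + 1 := by
    intro m hm x y
    by_contra hc
    exact Nat.find_min h hm ⟨x, y, by omega⟩
  generalize Nat.find h = n at hn hmin
  have hsplit : ∀ k, 0 < k → k < n →
      trueCount w (i + k) + trueCount w j = trueCount w (j + k) + trueCount w i + 1 := by
    intro k h0 hk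
    have h1 := hmin k hk i j
    have h2 := hmin (n - k) (by omega) (i + k) (j + k)
    rw [show i + k + (n - k) = i + n by omega, show j + k + (n - k) = j + n by omega] at h2
    omega
  have hstep := trueCount_succ w
  have hn2 : 2 ≤ n := by
    rcases n with _ | _ | n
    · simp at hn; omega
    · simp only [zero_add, hstep] at hn
      split_ifs at hn <;> omega
    · omega
  obtain ⟨L, rfl⟩ := Nat.exists_eq_add_of_le' hn2
  have hfirst := hsplit 1 (by omega) (by omega)
  have hlast := hsplit (L + 1) (by omega) (by omega)
  have hi1 := hstep i
  have hj1 := hstep j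
  have hi2 := hstep (i + (L + 1))
  have hj2 := hstep (j + (L + 1))
  rw [show i + (L + 2) = i + (L + 1) + 1 by omega,
    show j + (L + 2) = j + (L + 1) + 1 by omega] at hn
  have hends : w i = true ∧ w j = false ∧ w (i + (L + 1)) = true ∧ w (j + (L + 1)) = false := by
    cases h1 : w i <;> cases h2 : w j <;> cases h3 : w (i + (L + 1)) <;>
      cases h4 : w (j + (L + 1)) <;>
      simp only [h1, h2, h3, h4, if_true, Bool.false_eq_true, if_false] at hi1 hj1 hi2 hj2 <;>
      first | omega | simp
  obtain ⟨hi, hj, hi', hj'⟩ := hends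
  have hmid : SameWindow w L (i + 1) (j + 1) := by
    intro t ht
    have h1 := hsplit (1 + t) (by omega) (by omega)
    have h2 := hsplit (1 + t + 1) (by omega) (by omega)
    simp only [← Nat.add_assoc] at h1 h2
    rw [hstep, hstep] at h2
    cases h3 : w (i + 1 + t) <;> cases h4 : w (j + 1 + t) <;> simp [h3, h4] at h2 ⊢ <;> omega
  have hcmp : ∀ t ≤ L, trueCount w (i + 1 + t) + trueCount w j =
      trueCount w (j + 1 + t) + trueCount w i + 1 := fun t ht => by
    have := hsplit (1 + t) (by omega) (by omega)
    simpa only [← Nat.add_assoc] using this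
  simp only [hi, hj, hi', hj', if_true, Bool.false_eq_true, if_false] at hi1 hj1 hi2 hj2
  -- a prefix of the middle block has as many letters `true` as the suffix of the same length
  have hletter : ∀ k < L, trueCount w (i + 1 + k) + trueCount w (i + 1 + (L - k)) =
      trueCount w (i + 1) + trueCount w (i + 1 + L) →
      w (i + 1 + k) = w (i + 1 + (L - (k + 1))) := by
    intro k hk hE
    have c1 := hcmp k hk.le
    have c2 := hcmp (k + 1) hk
    have c3 := hcmp (L - k) (by omega)
    have c4 := hcmp (L - (k + 1)) (by omega)
    have c5 := hcmp L le_rfl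
    have s1 := hstep (i + 1 + k)
    have s2 := hstep (i + 1 + (L - (k + 1)))
    have m1 := hmin (k + 2) (by omega) i (j + 1 + (L - (k + 1)))
    have m2 := hmin (k + 2) (by omega) (i + 1 + (L - (k + 1))) j
    rw [show j + 1 + (L - (k + 1)) + (k + 2) = j + (L + 1) + 1 by omega, hj2,
      show i + (k + 2) = i + 1 + k + 1 by omega,
      show j + (L + 1) = j + 1 + L by omega] at m1
    rw [show i + 1 + (L - (k + 1)) + (k + 2) = i + (L + 1) + 1 by omega, hi2,
      show j + (k + 2) = j + 1 + (k + 1) by omega,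
      show i + (L + 1) = i + 1 + L by omega] at m2
    rw [show i + 1 + (L - (k + 1)) + 1 = i + 1 + (L - k) by omega] at s2
    rw [← Nat.add_assoc (i + 1)] at c2
    cases h3 : w (i + 1 + k) <;> cases h4 : w (i + 1 + (L - (k + 1))) <;>
      simp only [h3, h4, if_true, Bool.false_eq_true, if_false] at s1 s2 ⊢ <;> omega
  have hcount : ∀ k ≤ L, trueCount w (i + 1 + k) + trueCount w (i + 1 + (L - k)) =
      trueCount w (i + 1) + trueCount w (i + 1 + L) := by
    intro k
    induction k with
    | zero => simp
    | succ k ih =>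
      intro hk
      have hE := ih (by omega)
      have hw := hletter k hk hE
      have s1 := hstep (i + 1 + k)
      have s2 := hstep (i + 1 + (L - (k + 1)))
      rw [show i + 1 + (L - (k + 1)) + 1 = i + 1 + (L - k) by omega, ← hw] at s2
      rw [← Nat.add_assoc, s1]
      omega
  refine ⟨L, i, j, hi, hj, hi', hj', hmid, fun k hk => ?_⟩
  have := hletter k hk (hcount k hk.le)
  rwa [show i + 1 + k = i + (k + 1) by omega,
    show i + 1 + (L - (k + 1)) = i + (L - k) by omega] at this

/-- Sturmian words are balanced. -/
theorem SturmianW.trueCount_le {w : ℕ → Bool} (hst : SturmianW w) (n i j : ℕ) :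
    trueCount w (i + n) + trueCount w j ≤ trueCount w (j + n) + trueCount w i + 1 := by
  by_contra hc
  obtain ⟨L, x, y, hx, hy, hx', hy', hp, hpal⟩ :=
    exists_palindrome_of_unbalanced (w := w) ⟨n, i, j, by omega⟩
  have hpal' : ∀ k < L, w (y + (k + 1)) = w (y + (L - k)) := by
    intro k hk
    have h1 := hp k hk
    have h2 := hp (L - k - 1) (by omega)
    rw [show x + 1 + k = x + (k + 1) by omega, show y + 1 + k = y + (k + 1) by omega] at h1
    rw [show x + 1 + (L - k - 1) = x + (L - k) by omega,
      show y + 1 + (L - k - 1) = y + (L - k) by omega] at h2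
    rw [← h1, ← h2, hpal k hk]
  have hX := specialAt_of_palindrome hst (by simp [hx, hy]) (hx'.trans hx.symm)
    (hy'.trans hy.symm) hp hpal
  have hY := specialAt_of_palindrome hst (by simp [hx, hy]) (hy'.trans hy.symm)
    (hx'.trans hx.symm) hp.symm hpal'
  have := hX.sameWindow hst hY 0 (by omega)
  simp [hx, hy] at this

/-- If `a B b` and `b B a` are factors for distinct letters `a` and `b`, then `B` is bispecial. -/
theorem bispecial_of_swap {w : ℕ → Bool} {x y m : ℕ} (hp : SameWindow w m (x + 1) (y + 1))
    (hl : w x ≠ w y) (hr : w (x + 1 + m) ≠ w (y + 1 + m)) :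
    Bispecial w (wordAt w (x + 1) m) := by
  have e := wordAt_eq_iff.mpr hp
  have r1 := isFactorW_wordAt w (x + 1) (m + 1)
  have r2 := isFactorW_wordAt w (y + 1) (m + 1)
  have l1 := isFactorW_wordAt w x (m + 1)
  have l2 := isFactorW_wordAt w y (m + 1)
  rw [wordAt_succ] at r1 r2
  rw [wordAt_succ_eq_cons] at l1 l2
  rw [← e] at r2 l2
  constructor
  · cases h1 : w (x + 1 + m) <;> cases h2 : w (y + 1 + m) <;>
      simp_all [RightSpecial]
  · cases h1 : w x <;> cases h2 : w y <;> simp_all [LeftSpecial]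

/-- Semi-abelian returns of factors of a Sturmian word are Christoffel words: single
letters or words `a B b` with `a ≠ b` and `B` bispecial. -/
theorem stmt5 (w : ℕ → Bool) (hst : SturmianW w) (u : List Bool)
    (hu : IsFactorW w u) (hne : u ≠ []) :
    ∀ r ∈ semiAbReturns w u,
      (∃ a : Bool, r = [a]) ∨
      (∃ (a b : Bool) (B : List Bool), a ≠ b ∧ Bispecial w B ∧ r = a :: (B ++ [b])) := by
  rintro r ⟨i, j, hi, hj, hij, hbetween, rfl⟩
  simp only [mem_abOcc_iff] at hi hj hbetween
  generalize u.length = n at hi hj hbetween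
  generalize u.count true = c at hi hj hbetween
  obtain ⟨d, rfl⟩ := Nat.exists_eq_add_of_lt hij
  rw [show i + d + 1 - i = d + 1 by omega]
  rcases d with _ | m
  · exact Or.inl ⟨w i, by simp [wordAt]⟩
  right
  have hbal := hst.trueCount_le n
  have hshift : ∀ k, trueCount w (k + 1 + n) =
      trueCount w (k + n) + if w (k + n) = true then 1 else 0 := fun k => by
    rw [show k + 1 + n = k + n + 1 by omega, trueCount_succ]
  have hstep := trueCount_succ w
  -- all intermediate windows have the same number of letters `true`
  have hconst : ∀ k ≤ m, trueCount w (i + 1 + k + n) + trueCount w (i + 1) =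
      trueCount w (i + 1 + n) + trueCount w (i + 1 + k) := by
    intro k hk
    have h1 := hbetween (i + 1 + k) (by omega) (by omega)
    have h2 := hbetween (i + 1) (by omega) (by omega)
    have h3 := hbal (i + 1 + k) i
    have h4 := hbal i (i + 1 + k)
    have h5 := hbal (i + 1) i
    have h6 := hbal i (i + 1)
    have h7 := hbal (i + 1) (i + 1 + k)
    have h8 := hbal (i + 1 + k) (i + 1)
    omega
  have hp : SameWindow w m (i + 1) (i + n + 1) := by
    intro t ht
    have h1 := hconst t (by omega)
    have h2 := hconst (t + 1) (by omega)
    rw [← Nat.add_assoc, hshift, hstep (i + 1 + t)] at h2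
    rw [show i + n + 1 + t = i + 1 + t + n by omega]
    cases h3 : w (i + 1 + t) <;> cases h4 : w (i + 1 + t + n) <;> simp [h3, h4] at h2 ⊢ <;> omega
  have h1 := hbetween (i + 1) (by omega) (by omega)
  have h2 := hconst m le_rfl
  have ej : i + (m + 1) + 1 = i + 1 + m + 1 := by omega
  rw [ej, hshift, hstep (i + 1 + m)] at hj
  rw [hshift, hstep i] at h1 h2
  have hletters : w i ≠ w (i + n) ∧ w (i + 1 + m) ≠ w (i + 1 + m + n) ∧ w i ≠ w (i + 1 + m) := by
    cases h3 : w i <;> cases h4 : w (i + n) <;> cases h5 : w (i + 1 + m) <;>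
      cases h6 : w (i + 1 + m + n) <;> simp [h3, h4, h5, h6] at h1 h2 hj ⊢ <;> omega
  refine ⟨w i, w (i + 1 + m), wordAt w (i + 1) m, hletters.2.2,
    bispecial_of_swap hp hletters.1 ?_, by rw [wordAt_succ_eq_cons, wordAt_succ]⟩
  rw [show i + n + 1 + m = i + 1 + m + n by omega]
  exact hletters.2.1
end
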